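/- arXiv:2007.11844 — 5 statements merged into one kernel-verified Lean document; each statement's English description precedes it below -/
import Mathlib

section
/- Let n ≥ 5 and let G be a connected simple graph on n vertices. Then G belongs to 𝒢₁(n, n−3) and has diameter 3 if and only if G is (isomorphic to) the graph G₁ for some a, b ≥ 0 with a + b + 4 = n. -/
open Matrix

/-- The normalized Laplacian matrix of a finite simple graph. -/
noncomputable def normLap {V : Type*} [Fintype V] [DecidableEq V] (G : SimpleGraph V) [DecidableRel G.Adj] :
    Matrix V V ℝ :=
  Matrix.of fun u v =>
    if u = v then 1
    else if G.Adj u v then -1 / Real.sqrt ((G.degree u : ℝ) * (G.degree v : ℝ))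
    else 0

/-- The (geometric) multiplicity of `μ` as an eigenvalue of the matrix `M`. -/
noncomputable def eigMult {V : Type*} [Fintype V] [DecidableEq V]
    (M : Matrix V V ℝ) (μ : ℝ) : ℕ :=
  Module.finrank ℝ (LinearMap.ker (M - μ • (1 : Matrix V V ℝ)).mulVecLin)

/-- The multiset of eigenvalues (with multiplicity) of a hermitian matrix. -/
noncomputable def eigMultiset {V : Type*} [Fintype V] [DecidableEq V]
    (M : Matrix V V ℝ) : Multiset ℝ :=
  if h : M.IsHermitian then Finset.univ.val.map h.eigenvalues else 0

/-- The second-smallest eigenvalue (counted with multiplicity) of a hermitian matrix. -/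
noncomputable def secondSmallestEig {V : Type*} [Fintype V] [DecidableEq V]
    (M : Matrix V V ℝ) : ℝ :=
  ((eigMultiset M).sort (· ≤ ·)).getD 1 0

/-- The independence number of a finite simple graph. -/
noncomputable def indepNum {V : Type*} [Fintype V] (G : SimpleGraph V) : ℕ :=
  sSup {k | ∃ s : Finset V, (∀ u ∈ s, ∀ v ∈ s, u ≠ v → ¬ G.Adj u v) ∧ s.card = k}

/-- `G ∈ 𝒢₁(n, n-3)`. -/
def memG1Family {V : Type*} [Fintype V] [DecidableEq V]
    (G : SimpleGraph V) [DecidableRel G.Adj] (n : ℕ) : Prop :=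
  G.Connected ∧ Fintype.card V = n ∧
    (∃ θ : ℝ, eigMult (normLap G) θ = n - 3) ∧
    secondSmallestEig (normLap G) ≠ 1 ∧
    indepNum G = 2

/-- `v₁v₂v₃v₄` is an induced path `P₄`. -/
def IsInducedP4 {V : Type*} (G : SimpleGraph V) (v1 v2 v3 v4 : V) : Prop :=
  G.Adj v1 v2 ∧ G.Adj v2 v3 ∧ G.Adj v3 v4 ∧
    ¬ G.Adj v1 v3 ∧ ¬ G.Adj v1 v4 ∧ ¬ G.Adj v2 v4

/-- A cograph: no induced path on 4 vertices. -/
def IsCograph {V : Type*} (G : SimpleGraph V) : Prop :=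
  ∀ a b c d : V, ¬ IsInducedP4 G a b c d

/-- `S_U`: vertices outside the path `P` whose neighborhood inside `P` is exactly `U`. -/
def Sset {V : Type*} (G : SimpleGraph V) (P U : Set V) : Set V :=
  {u | u ∉ P ∧ G.neighborSet u ∩ P = U}

/-- The graph `G₁`: two cliques `A` (of size `a+1`) and `B` (of size `b+1`) forming a complete
graph together, a vertex `u` joined to all of `A` and a vertex `w` joined to all of `B`. -/
def graphG1 (a b : ℕ) : SimpleGraph (Unit ⊕ (Fin (a + 1) ⊕ (Fin (b + 1) ⊕ Unit))) :=
  SimpleGraph.fromRel fun x y =>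
    match x, y with
    | Sum.inl _, Sum.inr (Sum.inl _) => True
    | Sum.inr (Sum.inl _), Sum.inr (Sum.inl _) => True
    | Sum.inr (Sum.inl _), Sum.inr (Sum.inr (Sum.inl _)) => True
    | Sum.inr (Sum.inr (Sum.inl _)), Sum.inr (Sum.inr (Sum.inl _)) => True
    | Sum.inr (Sum.inr (Sum.inl _)), Sum.inr (Sum.inr (Sum.inr _)) => True
    | _, _ => False

noncomputable instance (a b : ℕ) : DecidableRel (graphG1 a b).Adj := Classical.decRel _

/-- The graph `G₂` on `m + 2` vertices: a complete graph on `m + 1` vertices together with a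
pendant vertex attached to one of its vertices. -/
def graphG2 (m : ℕ) : SimpleGraph (Unit ⊕ Fin (m + 1)) :=
  SimpleGraph.fromRel fun x y =>
    match x, y with
    | Sum.inl _, Sum.inr j => j = 0
    | Sum.inr _, Sum.inr _ => True
    | _, _ => False

noncomputable instance (m : ℕ) : DecidableRel (graphG2 m).Adj := Classical.decRel _

/-- The join of a single vertex with the disjoint union of two complete graphs `K_m`. -/
def joinTwoCliques (m : ℕ) : SimpleGraph (Unit ⊕ (Fin m ⊕ Fin m)) :=
  SimpleGraph.fromRel fun x y =>
    match x, y with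
    | Sum.inl _, Sum.inr _ => True
    | Sum.inr (Sum.inl _), Sum.inr (Sum.inl _) => True
    | Sum.inr (Sum.inr _), Sum.inr (Sum.inr _) => True
    | _, _ => False

noncomputable instance (m : ℕ) : DecidableRel (joinTwoCliques m).Adj := Classical.decRel _

/-- The matrix `A - c D`, where `A` is the adjacency matrix of `G` and `D` its degree matrix. -/
noncomputable def adjSubDeg {V : Type*} [Fintype V] [DecidableEq V] (G : SimpleGraph V)
    [DecidableRel G.Adj] (c : ℝ) : Matrix V V ℝ :=
  Matrix.of fun u v => if u = v then -c * G.degree u else if G.Adj u v then 1 else 0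

/-- `u` and `w` are distinct, non-adjacent, and their closed neighbourhoods are two cliques
which partition the vertex set. -/
structure IsCliqueSplit {V : Type*} (G : SimpleGraph V) (u w : V) : Prop where
  ne : u ≠ w
  not_adj : ¬ G.Adj u w
  cover : ∀ v, v ≠ u → v ≠ w → G.Adj u v ∨ G.Adj w v
  disj : ∀ v, G.Adj u v → ¬ G.Adj w v
  clique_left : ∀ v v', G.Adj u v → G.Adj u v' → v ≠ v' → G.Adj v v'
  clique_right : ∀ v v', G.Adj w v → G.Adj w v' → v ≠ v' → G.Adj v v'

section Matrix

variable {V : Type*} [Fintype V] [DecidableEq V] {G : SimpleGraph V} [DecidableRel G.Adj]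

lemma adjSubDeg_self (c : ℝ) (u : V) : adjSubDeg G c u u = -c * G.degree u := by
  simp [adjSubDeg]

lemma adjSubDeg_adj (c : ℝ) {u v : V} (h : G.Adj u v) : adjSubDeg G c u v = 1 := by
  simp [adjSubDeg, h, h.ne]

lemma adjSubDeg_not_adj (c : ℝ) {u v : V} (hne : u ≠ v) (h : ¬ G.Adj u v) :
    adjSubDeg G c u v = 0 := by
  simp [adjSubDeg, h, hne]

lemma normLap_sub_smul_one (hdeg : ∀ v, 0 < G.degree v) (θ : ℝ) :
    normLap G - θ • (1 : Matrix V V ℝ) =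
      diagonal (fun v => -(Real.sqrt (G.degree v))⁻¹) * adjSubDeg G (1 - θ) *
        diagonal (fun v => (Real.sqrt (G.degree v))⁻¹) := by
  ext u v
  rw [mul_diagonal, diagonal_mul]
  have hu : (0 : ℝ) < G.degree u := by exact_mod_cast hdeg u
  have hs : Real.sqrt (G.degree u) ≠ 0 := (Real.sqrt_pos.2 hu).ne'
  by_cases h : u = v
  · subst h
    have h2 : Real.sqrt (G.degree u) ^ 2 = G.degree u := Real.sq_sqrt hu.le
    simp only [normLap, adjSubDeg, Matrix.sub_apply, Matrix.smul_apply, Matrix.of_apply,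
      Matrix.one_apply_eq, if_true, smul_eq_mul]
    field_simp
    rw [h2]
  · by_cases ha : G.Adj u v
    · simp [normLap, adjSubDeg, h, ha]
      field_simp
    · simp [normLap, adjSubDeg, h, ha]

lemma isUnit_det_diagonal_of_ne_zero (f : V → ℝ) (hf : ∀ v, f v ≠ 0) :
    IsUnit (diagonal f).det := by
  rw [det_diagonal, isUnit_iff_ne_zero]
  exact Finset.prod_ne_zero_iff.2 fun v _ => hf v

lemma eigMult_normLap_add_rank (hdeg : ∀ v, 0 < G.degree v) (θ : ℝ) :
    eigMult (normLap G) θ + (adjSubDeg G (1 - θ)).rank = Fintype.card V := by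
  have hs : ∀ v, (Real.sqrt (G.degree v))⁻¹ ≠ 0 := fun v =>
    inv_ne_zero (Real.sqrt_pos.2 (by exact_mod_cast hdeg v)).ne'
  have h1 : (normLap G - θ • (1 : Matrix V V ℝ)).rank = (adjSubDeg G (1 - θ)).rank := by
    rw [normLap_sub_smul_one hdeg,
      rank_mul_eq_left_of_isUnit_det _ _ (isUnit_det_diagonal_of_ne_zero _ hs),
      rank_mul_eq_right_of_isUnit_det _ _
        (isUnit_det_diagonal_of_ne_zero _ fun v => neg_ne_zero.2 (hs v))]
  have h2 := LinearMap.finrank_range_add_finrank_ker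
    (normLap G - θ • (1 : Matrix V V ℝ)).mulVecLin
  rw [Module.finrank_fintype_fun_eq_card] at h2
  rw [← h1, ← h2, eigMult, Matrix.rank, add_comm]

lemma linearIndependent_path_columns (c : ℝ) {u x y w : V}
    (hux : G.Adj u x) (hxy : G.Adj x y) (hyw : G.Adj y w) (huy : ¬ G.Adj u y)
    (huw : ¬ G.Adj u w) (hxw : ¬ G.Adj x w) (huy' : u ≠ y) (huw' : u ≠ w) (hxw' : x ≠ w) :
    LinearIndependent ℝ ((adjSubDeg G c).col ∘ ![u, x, y]) := by
  rw [Fintype.linearIndependent_iff]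
  intro g hg
  have hv : ∀ v, g 0 * adjSubDeg G c v u + g 1 * adjSubDeg G c v x +
      g 2 * adjSubDeg G c v y = 0 := by
    intro v
    have := congrFun hg v
    simp only [Finset.sum_apply, Fin.sum_univ_three, Pi.smul_apply, smul_eq_mul,
      Pi.zero_apply] at this
    exact this
  have ew := hv w
  have ey := hv y
  have ex := hv x
  rw [adjSubDeg_not_adj c huw'.symm (fun h => huw h.symm),
    adjSubDeg_not_adj c hxw'.symm (fun h => hxw h.symm), adjSubDeg_adj c hyw.symm] at ew
  rw [adjSubDeg_not_adj c huy'.symm (fun h => huy h.symm), adjSubDeg_adj c hxy.symm] at ey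
  rw [adjSubDeg_adj c hux.symm] at ex
  have h2 : g 2 = 0 := by simpa using ew
  have h1 : g 1 = 0 := by simpa [h2] using ey
  have h0 : g 0 = 0 := by simpa [h2, h1] using ex
  intro i
  fin_cases i <;> assumption

lemma exists_column_relation {c : ℝ} (hr : (adjSubDeg G c).rank ≤ 3) {u x y w : V}
    (hux : G.Adj u x) (hxy : G.Adj x y) (hyw : G.Adj y w) (huy : ¬ G.Adj u y)
    (huw : ¬ G.Adj u w) (hxw : ¬ G.Adj x w) (huy' : u ≠ y) (huw' : u ≠ w) (hxw' : x ≠ w)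
    (z : V) :
    ∃ α β γ : ℝ, ∀ v, adjSubDeg G c v z =
      α * adjSubDeg G c v u + β * adjSubDeg G c v x + γ * adjSubDeg G c v y := by
  have hli := finrank_span_eq_card
    (linearIndependent_path_columns c hux hxy hyw huy huw hxw huy' huw' hxw')
  rw [rank_eq_finrank_span_cols] at hr
  have hspan := Submodule.eq_of_le_of_finrank_le (Submodule.span_mono (R := ℝ)
    (Set.range_comp_subset_range ![u, x, y] (adjSubDeg G c).col)) (by simpa [hli] using hr)
  have hz : (adjSubDeg G c).col z ∈ Submodule.span ℝ (Set.range (adjSubDeg G c).col) :=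
    Submodule.subset_span ⟨z, rfl⟩
  rw [← hspan, Submodule.mem_span_range_iff_exists_fun] at hz
  obtain ⟨g, hg⟩ := hz
  refine ⟨g 0, g 1, g 2, fun v => ?_⟩
  have := congrFun hg v
  simp only [Finset.sum_apply, Fin.sum_univ_three, Pi.smul_apply, smul_eq_mul] at this
  exact this.symm

lemma rank_adjSubDeg_eq_three {c : ℝ} {u x y w : V}
    (hux : G.Adj u x) (hxy : G.Adj x y) (hyw : G.Adj y w) (huy : ¬ G.Adj u y)
    (huw : ¬ G.Adj u w) (hxw : ¬ G.Adj x w) (huy' : u ≠ y) (huw' : u ≠ w) (hxw' : x ≠ w)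
    (hz : ∀ z, ∃ α β γ : ℝ, ∀ v, adjSubDeg G c v z =
      α * adjSubDeg G c v u + β * adjSubDeg G c v x + γ * adjSubDeg G c v y) :
    (adjSubDeg G c).rank = 3 := by
  have hli := finrank_span_eq_card
    (linearIndependent_path_columns c hux hxy hyw huy huw hxw huy' huw' hxw')
  have hspan : Submodule.span ℝ (Set.range (adjSubDeg G c).col) =
      Submodule.span ℝ (Set.range ((adjSubDeg G c).col ∘ ![u, x, y])) := by
    refine le_antisymm (Submodule.span_le.2 ?_)
      (Submodule.span_mono (Set.range_comp_subset_range _ _))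
    rintro _ ⟨z, rfl⟩
    obtain ⟨α, β, γ, h⟩ := hz z
    refine Submodule.mem_span_range_iff_exists_fun ℝ |>.2 ⟨![α, β, γ], ?_⟩
    ext v
    simp only [Finset.sum_apply, Fin.sum_univ_three, Pi.smul_apply, smul_eq_mul]
    exact (h v).symm
  rw [rank_eq_finrank_span_cols, hspan, hli, Fintype.card_fin]

lemma secondSmallestEig_ne_of_eigMult_eq_zero (M : Matrix V V ℝ) (hcard : 2 ≤ Fintype.card V)
    {μ : ℝ} (hμ : μ ≠ 0) (h : eigMult M μ = 0) : secondSmallestEig M ≠ μ := by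
  intro he
  unfold secondSmallestEig eigMultiset at he
  split_ifs at he with hM
  · rw [List.getD_eq_getElem _ _ (by simpa using Nat.lt_of_succ_le hcard)] at he
    have hmem := he ▸ List.getElem_mem (l := ((Finset.univ.val.map hM.eigenvalues).sort (· ≤ ·)))
      (n := 1) (by simpa using Nat.lt_of_succ_le hcard)
    simp only [Multiset.mem_sort, Multiset.mem_map, Finset.mem_val, Finset.mem_univ,
      true_and] at hmem
    obtain ⟨i, hi⟩ := hmem
    have hv := hM.mulVec_eigenvectorBasis i
    rw [hi] at hv
    have hker : (WithLp.ofLp (hM.eigenvectorBasis i) : V → ℝ) ∈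
        LinearMap.ker (M - μ • (1 : Matrix V V ℝ)).mulVecLin := by
      rw [LinearMap.mem_ker, mulVecLin_apply, sub_mulVec, smul_mulVec, one_mulVec, hv, sub_self]
    rw [eigMult, Submodule.finrank_eq_zero] at h
    rw [h, Submodule.mem_bot] at hker
    exact hM.eigenvectorBasis.toBasis.ne_zero i (by
      simpa using hker)
  · simp at he
    exact hμ he.symm

lemma adjSubDeg_zero_mulVec (g : V → ℝ) (v : V) :
    (adjSubDeg G 0 *ᵥ g) v = ∑ z ∈ G.neighborFinset v, g z := by
  rw [mulVec, dotProduct, SimpleGraph.neighborFinset_eq_filter, Finset.sum_filter]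
  refine Finset.sum_congr rfl fun z _ => ?_
  by_cases hvz : v = z
  · subst hvz; simp [adjSubDeg]
  · simp [adjSubDeg, hvz]

end Matrix

namespace IsCliqueSplit

variable {V : Type*} {G : SimpleGraph V} {u w : V}

lemma symm (h : IsCliqueSplit G u w) : IsCliqueSplit G w u where
  ne := h.ne.symm
  not_adj := fun ha => h.not_adj ha.symm
  cover := fun v h1 h2 => (h.cover v h2 h1).symm
  disj := fun v h1 h2 => h.disj v h2 h1
  clique_left := h.clique_right
  clique_right := h.clique_left

variable [Fintype V] [DecidableEq V] [DecidableRel G.Adj]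

lemma degree_eq (h : IsCliqueSplit G u w) {x : V} (hx : G.Adj u x) :
    G.degree x = G.degree u + (G.neighborFinset x ∩ G.neighborFinset w).card := by
  have hxw : ¬ G.Adj x w := fun ha => h.disj x hx ha.symm
  have hset : G.neighborFinset x = insert u ((G.neighborFinset u).erase x) ∪
      (G.neighborFinset x ∩ G.neighborFinset w) := by
    ext v
    have h1 := h.cover v
    have h2 := h.disj v
    have h3 := h.clique_left x v hx
    have h4 := hx.symm
    by_cases hvu : v = u
    · subst hvu; simp [h4]
    by_cases hvw : v = w
    · subst hvw; simp [hxw, hvu, h.not_adj]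
    by_cases hvx : v = x
    · subst hvx; simp [hvu]
    simp only [SimpleGraph.mem_neighborFinset, Finset.mem_union, Finset.mem_insert,
      Finset.mem_erase, Finset.mem_inter]
    have := h1 hvu hvw
    have : x ≠ v := fun h => hvx h.symm
    tauto
  have hdisj : Disjoint (insert u ((G.neighborFinset u).erase x))
      (G.neighborFinset x ∩ G.neighborFinset w) := by
    rw [Finset.disjoint_left]
    intro v hv hv'
    simp only [SimpleGraph.mem_neighborFinset, Finset.mem_insert,
      Finset.mem_erase, Finset.mem_inter] at hv hv'
    rcases hv with rfl | hv
    · exact h.not_adj hv'.2.symm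
    · exact h.disj v hv.2 hv'.2
  have hmem : x ∈ G.neighborFinset u := by simpa using hx
  have hpos := Finset.card_pos.2 ⟨x, hmem⟩
  conv_lhs => rw [← SimpleGraph.card_neighborFinset_eq_degree, hset]
  rw [Finset.card_union_of_disjoint hdisj, Finset.card_insert_of_notMem (by simp),
    Finset.card_erase_of_mem hmem, Nat.sub_add_cancel hpos,
    SimpleGraph.card_neighborFinset_eq_degree]

lemma card_eq (h : IsCliqueSplit G u w) :
    Fintype.card V = G.degree u + G.degree w + 2 := by
  have hset : (Finset.univ : Finset V) =
      insert u (G.neighborFinset u) ∪ insert w (G.neighborFinset w) := by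
    ext v
    have := h.cover v
    simp only [SimpleGraph.mem_neighborFinset, Finset.mem_union, Finset.mem_insert,
      Finset.mem_univ, true_iff]
    tauto
  have hdisj : Disjoint (insert u (G.neighborFinset u)) (insert w (G.neighborFinset w)) := by
    rw [Finset.disjoint_left]
    intro v hv hv'
    simp only [SimpleGraph.mem_neighborFinset, Finset.mem_insert] at hv hv'
    rcases hv with rfl | hv <;> rcases hv' with rfl | hv'
    · exact h.ne rfl
    · exact h.not_adj hv'.symm
    · exact h.not_adj hv
    · exact h.disj v hv hv'
  rw [← Finset.card_univ, hset, Finset.card_union_of_disjoint hdisj,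
    Finset.card_insert_of_notMem (by simp), Finset.card_insert_of_notMem (by simp),
    SimpleGraph.card_neighborFinset_eq_degree, SimpleGraph.card_neighborFinset_eq_degree]
  omega

section LowRank

variable {c : ℝ} {x y : V}

lemma twin_or (h : IsCliqueSplit G u w) (hr : (adjSubDeg G c).rank ≤ 3) (hc : c ≠ 0)
    (hx : G.Adj u x) (hy : G.Adj w y) (hxy : G.Adj x y) {x' : V} (hx' : G.Adj u x')
    (hne : x' ≠ x) :
    (G.Adj x' y ∧ c * G.degree x = -1 ∧ ∀ y', G.Adj w y' → (G.Adj x' y' ↔ G.Adj x y')) ∨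
      (¬ G.Adj x' y ∧ c * G.degree u = -1) := by
  have huy : ¬ G.Adj u y := fun ha => h.disj y ha hy
  have hxw : ¬ G.Adj x w := fun ha => h.disj x hx ha.symm
  have hx'w : ¬ G.Adj x' w := fun ha => h.disj x' hx' ha.symm
  have huy' : u ≠ y := fun e => h.not_adj (e ▸ hy.symm)
  have hxw' : x ≠ w := fun e => h.not_adj (e ▸ hx)
  have hx'w' : x' ≠ w := fun e => h.not_adj (e ▸ hx')
  obtain ⟨α, β, γ, e⟩ := exists_column_relation hr hx hxy hy.symm huy h.not_adj hxw huy' h.ne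
    hxw' x'
  have ew := e w
  have ey := e y
  have ex := e x
  have eu := e u
  have hx'x := h.clique_left x' x hx' hx hne
  rw [adjSubDeg_not_adj c hx'w'.symm (fun h => hx'w h.symm),
    adjSubDeg_not_adj c h.ne.symm (fun ha => h.not_adj ha.symm),
    adjSubDeg_not_adj c hxw'.symm (fun h => hxw h.symm), adjSubDeg_adj c hy] at ew
  rw [adjSubDeg_not_adj c huy'.symm (fun h => huy h.symm), adjSubDeg_adj c hxy.symm,
    adjSubDeg_self] at ey
  rw [adjSubDeg_adj c hx'x.symm, adjSubDeg_adj c hx.symm, adjSubDeg_adj c hxy,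
    adjSubDeg_self] at ex
  rw [adjSubDeg_adj c hx', adjSubDeg_adj c hx, adjSubDeg_not_adj c huy' huy,
    adjSubDeg_self] at eu
  have hγ : γ = 0 := by linarith
  subst hγ
  have hu : (G.degree u : ℝ) ≠ 0 := by
    have : 0 < G.degree u := (G.degree_pos_iff_exists_adj u).2 ⟨x, hx⟩
    exact_mod_cast this.ne'
  have hyx' : y ≠ x' := fun e => huy (e ▸ hx')
  by_cases ha : G.Adj x' y
  · left
    rw [adjSubDeg_adj c ha.symm] at ey
    have hβ : β = 1 := by linarith
    subst hβ
    have hα : α = 0 := by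
      have : α * (c * G.degree u) = 0 := by linarith
      exact (mul_eq_zero.1 this).resolve_right (mul_ne_zero hc hu)
    subst hα
    refine ⟨ha, by linarith, fun y' hy' => ?_⟩
    have e' := e y'
    have n1 : y' ≠ x := fun e => h.disj x hx (e ▸ hy')
    have n2 : y' ≠ x' := fun e => h.disj x' hx' (e ▸ hy')
    by_cases p1 : G.Adj x' y' <;> by_cases p2 : G.Adj x y' <;>
      simp [adjSubDeg, n1, n2, p1, p2, G.adj_comm y'] at e' ⊢
  · right
    rw [adjSubDeg_not_adj c hyx' (fun h => ha h.symm)] at ey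
    have hβ : β = 0 := by linarith
    subst hβ
    have hα : α = 1 := by linarith
    subst hα
    exact ⟨ha, by linarith⟩

lemma path_det (h : IsCliqueSplit G u w) (hr : (adjSubDeg G c).rank ≤ 3)
    (hx : G.Adj u x) (hy : G.Adj w y) (hxy : G.Adj x y) :
    (1 - c ^ 2 * G.degree w * G.degree y) * (1 - c ^ 2 * G.degree x * G.degree u) =
      c ^ 2 * G.degree w * G.degree u := by
  have huy : ¬ G.Adj u y := fun ha => h.disj y ha hy
  have hxw : ¬ G.Adj x w := fun ha => h.disj x hx ha.symm
  have huy' : u ≠ y := fun e => h.not_adj (e ▸ hy.symm)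
  have hxw' : x ≠ w := fun e => h.not_adj (e ▸ hx)
  obtain ⟨α, β, γ, e⟩ := exists_column_relation hr hx hxy hy.symm huy h.not_adj hxw huy' h.ne
    hxw' w
  have ew := e w
  have ey := e y
  have ex := e x
  have eu := e u
  rw [adjSubDeg_not_adj c h.ne.symm (fun ha => h.not_adj ha.symm),
    adjSubDeg_not_adj c hxw'.symm (fun h => hxw h.symm), adjSubDeg_adj c hy,
    adjSubDeg_self] at ew
  rw [adjSubDeg_not_adj c huy'.symm (fun h => huy h.symm), adjSubDeg_adj c hxy.symm,
    adjSubDeg_adj c hy.symm, adjSubDeg_self] at ey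
  rw [adjSubDeg_not_adj c hxw' hxw, adjSubDeg_adj c hx.symm, adjSubDeg_adj c hxy,
    adjSubDeg_self] at ex
  rw [adjSubDeg_not_adj c h.ne h.not_adj, adjSubDeg_adj c hx, adjSubDeg_not_adj c huy' huy,
    adjSubDeg_self] at eu
  have hγ : γ = -c * G.degree w := by linarith
  have hβ : β = 1 - c ^ 2 * G.degree w * G.degree y := by
    rw [hγ] at ey; linear_combination -ey
  rw [← hβ]
  rw [hγ] at ex
  linear_combination -eu - c * G.degree u * ex

lemma ne_zero_of_rank_le (h : IsCliqueSplit G u w) (hr : (adjSubDeg G c).rank ≤ 3)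
    (hx : G.Adj u x) (hy : G.Adj w y) (hxy : G.Adj x y) : c ≠ 0 := by
  rintro rfl
  simpa using h.path_det hr hx hy hxy

lemma left_twin (h : IsCliqueSplit G u w) (hr : (adjSubDeg G c).rank ≤ 3)
    (hx : G.Adj u x) (hy : G.Adj w y) (hxy : G.Adj x y) {x' : V} (hx' : G.Adj u x') :
    ∀ y', G.Adj w y' → (G.Adj x' y' ↔ G.Adj x y') := by
  by_cases hne : x' = x
  · subst hne; exact fun _ _ => Iff.rfl
  have hc := h.ne_zero_of_rank_le hr hx hy hxy
  rcases h.twin_or hr hc hx hy hxy hx' hne with ⟨_, _, h3⟩ | ⟨_, hcu⟩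
  · exact h3
  exfalso
  have hdx := h.degree_eq hx
  have hdy := h.symm.degree_eq hy
  have hymem : y ∈ G.neighborFinset x ∩ G.neighborFinset w := by simp [hxy, hy]
  have hp2 : 2 ≤ G.degree u := by
    rw [← SimpleGraph.card_neighborFinset_eq_degree]
    exact Finset.one_lt_card.2 ⟨x', by simpa using hx', x, by simpa using hx, hne⟩
  have hlt : G.degree u < G.degree x := by
    have := Finset.card_pos.2 ⟨y, hymem⟩
    omega
  have hno : ∀ x'', G.Adj u x'' → x'' ≠ x → ¬ G.Adj x'' y := by
    intro x'' hx'' hne'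
    rcases h.twin_or hr hc hx hy hxy hx'' hne' with ⟨_, h2, _⟩ | ⟨h1, _⟩
    · have := mul_left_cancel₀ hc (h2.trans hcu.symm)
      have : G.degree x = G.degree u := by exact_mod_cast this
      omega
    · exact h1
  have hyN : G.neighborFinset y ∩ G.neighborFinset u = {x} := by
    ext v
    simp only [Finset.mem_inter, SimpleGraph.mem_neighborFinset, Finset.mem_singleton]
    constructor
    · rintro ⟨h1, h2⟩
      by_contra hv
      exact hno v h2 hv h1.symm
    · rintro rfl
      exact ⟨hxy.symm, hx⟩
  rw [hyN, Finset.card_singleton] at hdy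
  have hdet := h.path_det hr hx hy hxy
  set p := G.degree u with hp
  set q := G.degree w with hq
  have hp0 : (2 : ℝ) ≤ p := by exact_mod_cast hp2
  have hpp : (p : ℝ) ≠ 0 := by linarith
  have hcp : c = -1 / p := by field_simp; linarith
  have hq1 : 1 ≤ q := (G.degree_pos_iff_exists_adj w).2 ⟨y, hy⟩
  have hq0 : (1 : ℝ) ≤ q := by exact_mod_cast hq1
  obtain ⟨k, hk⟩ : ∃ k, (G.neighborFinset x ∩ G.neighborFinset w).card = k := ⟨_, rfl⟩
  rw [hk] at hdx
  have key : (k : ℝ) * (q * (q + 1) - p ^ 2) = q * p ^ 2 := by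
    rw [hdx, hdy, hcp] at hdet
    push_cast at hdet
    field_simp at hdet
    nlinarith [hdet]
  have hcases : (k = 1 ∧ (q = 1 ∨ q = p)) ∨ (k = q ∧ q + 1 = p) := by
    by_cases hsingle : ∃ y', G.Adj w y' ∧ y' ≠ y
    · obtain ⟨y1, hy1, hy1ne⟩ := hsingle
      rcases h.symm.twin_or hr hc hy hx hxy.symm hy1 hy1ne with ⟨_, h2, _⟩ | ⟨_, h2⟩
      · right
        have e1 := mul_left_cancel₀ hc (h2.trans hcu.symm)
        have e2 : G.degree y = p := by exact_mod_cast e1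
        refine ⟨?_, by omega⟩
        rw [← hk, hq, ← SimpleGraph.card_neighborFinset_eq_degree]
        congr 1
        rw [Finset.inter_eq_right]
        intro v hv
        rw [SimpleGraph.mem_neighborFinset] at hv ⊢
        by_cases hvy : v = y
        · exact hvy ▸ hxy
        rcases h.symm.twin_or hr hc hy hx hxy.symm hv hvy with ⟨h1, _, _⟩ | ⟨_, h3⟩
        · exact h1.symm
        · have := mul_left_cancel₀ hc (h3.trans h2.symm)
          have : q = G.degree y := by exact_mod_cast this
          omega
      · left
        have e1 := mul_left_cancel₀ hc (h2.trans hcu.symm)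
        have e2 : q = p := by exact_mod_cast e1
        refine ⟨?_, Or.inr e2⟩
        rw [← hk, Finset.card_eq_one]
        refine ⟨y, ?_⟩
        ext v
        simp only [Finset.mem_inter, SimpleGraph.mem_neighborFinset, Finset.mem_singleton]
        constructor
        · rintro ⟨h1, h4⟩
          by_contra hv
          rcases h.symm.twin_or hr hc hy hx hxy.symm h4 hv with ⟨_, h3, _⟩ | ⟨h3, _⟩
          · have := mul_left_cancel₀ hc (h3.trans h2.symm)
            have : G.degree y = q := by exact_mod_cast this
            omega
          · exact h3 h1.symm
        · rintro rfl
          exact ⟨hxy, hy⟩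
    · push Not at hsingle
      have hw1 : G.neighborFinset w = {y} := by
        ext v
        simp only [SimpleGraph.mem_neighborFinset, Finset.mem_singleton]
        exact ⟨hsingle v, fun e => e ▸ hy⟩
      left
      constructor
      · rw [← hk, hw1, Finset.inter_singleton_of_mem (by simpa using hxy), Finset.card_singleton]
      · left
        rw [hq, ← SimpleGraph.card_neighborFinset_eq_degree, hw1, Finset.card_singleton]
  rcases hcases with ⟨hk1, hq1 | hqp⟩ | ⟨hkq, hqp⟩
  · rw [hk1, hq1] at key
    push_cast at key
    nlinarith
  · rw [hk1, hqp] at key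
    push_cast at key
    nlinarith [mul_pos (show (0 : ℝ) < p by linarith) (show (0 : ℝ) < p by linarith)]
  · rw [hkq, ← hqp] at key
    push_cast at key
    nlinarith [mul_pos (show (0 : ℝ) < q by linarith) (show (0 : ℝ) < q by linarith)]

lemma complete_of_rank_le (h : IsCliqueSplit G u w) (hr : (adjSubDeg G c).rank ≤ 3)
    (hx : G.Adj u x) (hy : G.Adj w y) (hxy : G.Adj x y) {x' y' : V} (hx' : G.Adj u x')
    (hy' : G.Adj w y') : G.Adj x' y' := by
  rw [h.left_twin hr hx hy hxy hx' y' hy', G.adj_comm,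
    h.symm.left_twin hr hy hx hxy.symm hy' x hx]
  exact hxy.symm

end LowRank

end IsCliqueSplit

namespace IsCliqueSplit

variable {V : Type*} {G : SimpleGraph V} {u w : V}

lemma of_iso {W : Type*} {H : SimpleGraph W} (e : G ≃g H) (h : IsCliqueSplit H (e u) (e w)) :
    IsCliqueSplit G u w where
  ne := fun he => h.ne (he ▸ rfl)
  not_adj := fun ha => h.not_adj (e.map_adj_iff.2 ha)
  cover := fun v h1 h2 => by
    simpa only [e.map_adj_iff] using h.cover (e v) (e.injective.ne h1) (e.injective.ne h2)
  disj := fun v h1 h2 => h.disj (e v) (e.map_adj_iff.2 h1) (e.map_adj_iff.2 h2)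
  clique_left := fun v v' h1 h2 h3 => e.map_adj_iff.1 <|
    h.clique_left _ _ (e.map_adj_iff.2 h1) (e.map_adj_iff.2 h2) (e.injective.ne h3)
  clique_right := fun v v' h1 h2 h3 => e.map_adj_iff.1 <|
    h.clique_right _ _ (e.map_adj_iff.2 h1) (e.map_adj_iff.2 h2) (e.injective.ne h3)

lemma graphG1 (a b : ℕ) :
    IsCliqueSplit (graphG1 a b) (Sum.inl ()) (Sum.inr (Sum.inr (Sum.inr ()))) where
  ne := by simp
  not_adj := by simp [_root_.graphG1]
  cover := by
    rintro (_ | _ | _ | _) h1 h2 <;> simp_all [_root_.graphG1]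
  disj := by
    rintro (_ | _ | _ | _) <;> simp [_root_.graphG1]
  clique_left := by
    rintro (_ | _ | _ | _) (_ | _ | _ | _) <;> simp [_root_.graphG1]
  clique_right := by
    rintro (_ | _ | _ | _) (_ | _ | _ | _) <;> simp [_root_.graphG1]

variable [Fintype V] [DecidableEq V] [DecidableRel G.Adj]

lemma nonempty_iso_graphG1 (h : IsCliqueSplit G u w)
    (hcomp : ∀ x y, G.Adj u x → G.Adj w y → G.Adj x y) {a b : ℕ}
    (ha : G.degree u = a + 1) (hb : G.degree w = b + 1) :
    Nonempty (G ≃g _root_.graphG1 a b) := by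
  let eA : Fin (a + 1) ≃ G.neighborFinset u :=
    (Finset.equivFinOfCardEq (by rw [SimpleGraph.card_neighborFinset_eq_degree, ha])).symm
  let eB : Fin (b + 1) ≃ G.neighborFinset w :=
    (Finset.equivFinOfCardEq (by rw [SimpleGraph.card_neighborFinset_eq_degree, hb])).symm
  have hA : ∀ i, G.Adj u (eA i) := fun i => (G.mem_neighborFinset u _).1 (eA i).2
  have hB : ∀ i, G.Adj w (eB i) := fun i => (G.mem_neighborFinset w _).1 (eB i).2
  have hA' : ∀ i, ¬ G.Adj w (eA i) := fun i => h.disj _ (hA i)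
  have hB' : ∀ i, ¬ G.Adj u (eB i) := fun i ha => h.disj _ ha (hB i)
  have hAB : ∀ i j, G.Adj (eA i) (eB j) := fun i j => hcomp _ _ (hA i) (hB j)
  have hAA : ∀ i j, G.Adj (eA i) (eA j) ↔ i ≠ j := fun i j =>
    ⟨fun e hij => e.ne (by rw [hij]), fun hij => h.clique_left _ _ (hA i) (hA j)
      fun e => hij (eA.injective (Subtype.ext e))⟩
  have hBB : ∀ i j, G.Adj (eB i) (eB j) ↔ i ≠ j := fun i j =>
    ⟨fun e hij => e.ne (by rw [hij]), fun hij => h.clique_right _ _ (hB i) (hB j)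
      fun e => hij (eB.injective (Subtype.ext e))⟩
  let f : Unit ⊕ (Fin (a + 1) ⊕ (Fin (b + 1) ⊕ Unit)) → V :=
    Sum.elim (fun _ => u) (Sum.elim (fun i => eA i) (Sum.elim (fun i => eB i) fun _ => w))
  have hadj : ∀ s t, G.Adj (f s) (f t) ↔ (_root_.graphG1 a b).Adj s t := by
    rintro (_ | i | i | _) (_ | j | j | _) <;>
      simp [f, _root_.graphG1, hA, hB, hA', hB', hAB, hAA, hBB, h.not_adj, G.adj_comm _ u,
        G.adj_comm _ w, G.adj_comm (eB _) (eA _)]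
  have hsurj : Function.Surjective f := by
    intro v
    by_cases h1 : v = u
    · exact ⟨Sum.inl (), h1.symm⟩
    by_cases h2 : v = w
    · exact ⟨Sum.inr (Sum.inr (Sum.inr ())), h2.symm⟩
    rcases h.cover v h1 h2 with h3 | h3
    · refine ⟨Sum.inr (Sum.inl (eA.symm ⟨v, by simpa using h3⟩)), ?_⟩
      simp [f]
    · refine ⟨Sum.inr (Sum.inr (Sum.inl (eB.symm ⟨v, by simpa using h3⟩))), ?_⟩
      simp [f]
  have hbij : Function.Bijective f := by
    rw [Fintype.bijective_iff_surjective_and_card]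
    refine ⟨hsurj, ?_⟩
    rw [h.card_eq, ha, hb]
    simp
    omega
  exact ⟨RelIso.symm ⟨Equiv.ofBijective f hbij, fun {s t} => hadj s t⟩⟩

lemma degree_of_complete (h : IsCliqueSplit G u w)
    (hcomp : ∀ x y, G.Adj u x → G.Adj w y → G.Adj x y) {x : V} (hx : G.Adj u x) :
    G.degree x = G.degree u + G.degree w := by
  rw [h.degree_eq hx, Finset.inter_eq_right.2, SimpleGraph.card_neighborFinset_eq_degree]
  intro v hv
  rw [SimpleGraph.mem_neighborFinset] at hv ⊢
  exact hcomp x v hx hv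

lemma column_of_complete (h : IsCliqueSplit G u w)
    (hcomp : ∀ x y, G.Adj u x → G.Adj w y → G.Adj x y) {x : V} (hx : G.Adj u x) (v : V) :
    adjSubDeg G (-1 / (G.degree u + G.degree w : ℝ)) v x = if v = w then 0 else 1 := by
  have hxw : ¬ G.Adj w x := h.disj x hx
  have hxw' : w ≠ x := fun e => h.not_adj (e ▸ hx)
  split_ifs with hvw
  · subst hvw
    exact adjSubDeg_not_adj _ hxw' hxw
  by_cases hvx : v = x
  · subst hvx
    have hpos : 0 < G.degree u := (G.degree_pos_iff_exists_adj u).2 ⟨v, hx⟩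
    have hd : (G.degree u + G.degree w : ℝ) ≠ 0 := by positivity
    rw [adjSubDeg_self, h.degree_of_complete hcomp hx]
    push_cast
    field_simp
  · apply adjSubDeg_adj
    by_cases hvu : v = u
    · exact hvu ▸ hx
    rcases h.cover v hvu hvw with h1 | h1
    · exact h.clique_left _ _ h1 hx hvx
    · exact (hcomp _ _ hx h1).symm

lemma rank_of_complete (h : IsCliqueSplit G u w)
    (hcomp : ∀ x y, G.Adj u x → G.Adj w y → G.Adj x y) {x y : V} (hx : G.Adj u x)
    (hy : G.Adj w y) :
    (adjSubDeg G (-1 / (G.degree u + G.degree w : ℝ))).rank = 3 := by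
  have huy : ¬ G.Adj u y := fun ha => h.disj y ha hy
  have hxw : ¬ G.Adj x w := fun ha => h.disj x hx ha.symm
  have huy' : u ≠ y := fun e => h.not_adj (e ▸ hy.symm)
  have hxw' : x ≠ w := fun e => h.not_adj (e ▸ hx)
  have hcomp' : ∀ x y, G.Adj w x → G.Adj u y → G.Adj x y := fun x y h1 h2 => (hcomp y x h2 h1).symm
  have hA : ∀ x, G.Adj u x → ∀ v, _ := fun x hx v => h.column_of_complete hcomp hx v
  have hB : ∀ y, G.Adj w y → ∀ v, _ := fun y hy v => h.symm.column_of_complete hcomp' hy v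
  simp only [add_comm (G.degree w : ℝ)] at hB
  have hpos : 0 < G.degree u := (G.degree_pos_iff_exists_adj u).2 ⟨x, hx⟩
  have hd : (G.degree u + G.degree w : ℝ) ≠ 0 := by positivity
  refine rank_adjSubDeg_eq_three hx (hcomp x y hx hy) hy.symm huy h.not_adj hxw huy' h.ne hxw'
    fun z => ?_
  by_cases hzu : z = u
  · exact ⟨1, 0, 0, fun v => by rw [hzu]; ring⟩
  by_cases hzw : z = w
  · subst hzw
    refine ⟨-1, G.degree u / (G.degree u + G.degree z), G.degree z / (G.degree u + G.degree z),
      fun v => ?_⟩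
    rw [hA x hx, hB y hy]
    by_cases hvu : v = u
    · subst hvu
      rw [adjSubDeg_self, adjSubDeg_not_adj _ h.ne h.not_adj]
      simp [h.ne]
      ring
    by_cases hvz : v = z
    · subst hvz
      rw [adjSubDeg_self, adjSubDeg_not_adj _ h.ne.symm (fun ha => h.not_adj ha.symm)]
      simp [h.ne.symm]
      ring
    rcases h.cover v hvu hvz with h1 | h1
    · rw [adjSubDeg_not_adj _ hvz (fun ha => h.disj v h1 ha.symm), adjSubDeg_adj _ h1.symm]
      simp [hvu, hvz]
      field_simp
      ring
    · rw [adjSubDeg_not_adj _ hvu (fun ha => h.disj v ha.symm h1), adjSubDeg_adj _ h1.symm]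
      simp [hvu, hvz]
      field_simp
  rcases h.cover z hzu hzw with h1 | h1
  · exact ⟨0, 1, 0, fun v => by rw [hA z h1, hA x hx]; ring⟩
  · exact ⟨0, 0, 1, fun v => by rw [hB z h1, hB y hy]; ring⟩

lemma rank_zero_of_complete (h : IsCliqueSplit G u w)
    (hcomp : ∀ x y, G.Adj u x → G.Adj w y → G.Adj x y) (hu : 0 < G.degree u)
    (hw : 0 < G.degree w) : (adjSubDeg G 0).rank = Fintype.card V := by
  have side : ∀ {u w : V}, IsCliqueSplit G u w →
      (∀ x y, G.Adj u x → G.Adj w y → G.Adj x y) → 0 < G.degree u → ∀ g : V → ℝ,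
      adjSubDeg G 0 *ᵥ g = 0 → g u = 0 ∧ ∀ x, G.Adj u x → g x = 0 := by
    intro u w h hcomp hu g hg
    have hs : ∀ v, ∑ z ∈ G.neighborFinset v, g z = 0 := fun v => by
      rw [← adjSubDeg_zero_mulVec, hg]; rfl
    have hx : ∀ x, G.Adj u x → g x = g u := by
      intro x hx
      have hxw : ¬ G.Adj x w := fun ha => h.disj x hx ha.symm
      have hset : insert x (G.neighborFinset x) =
          insert u (G.neighborFinset u ∪ G.neighborFinset w) := by
        ext v
        have h1 := h.cover v
        have h3 := h.clique_left x v hx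
        have h4 := hcomp x v hx
        by_cases hvu : v = u
        · subst hvu; simp [hx.symm]
        by_cases hvw : v = w
        · subst hvw
          have hvx : v ≠ x := fun e => h.not_adj (e ▸ hx)
          simp [hxw, hvu, hvx, h.not_adj]
        by_cases hvx : v = x
        · subst hvx; simp [hx]
        have : x ≠ v := fun e => hvx e.symm
        have := h1 hvu hvw
        simp only [SimpleGraph.mem_neighborFinset, Finset.mem_union, Finset.mem_insert]
        tauto
      have hdisj : Disjoint (G.neighborFinset u) (G.neighborFinset w) := by
        rw [Finset.disjoint_left]
        intro v h1 h2
        exact h.disj v (by simpa using h1) (by simpa using h2)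
      have hsum := congrArg (fun s => ∑ z ∈ s, g z) hset
      rw [Finset.sum_insert (by simp),
        Finset.sum_insert (by simp [G.adj_comm w, h.not_adj]),
        Finset.sum_union hdisj, hs, hs, hs] at hsum
      linarith
    have h0 : g u = 0 := by
      have h1 := hs u
      rw [Finset.sum_congr rfl fun x hx' => hx x (by simpa using hx'), Finset.sum_const,
        SimpleGraph.card_neighborFinset_eq_degree, nsmul_eq_mul] at h1
      exact (mul_eq_zero.1 h1).resolve_left (by exact_mod_cast hu.ne')
    exact ⟨h0, fun x hx' => (hx x hx').trans h0⟩
  have hinj : Function.Injective (adjSubDeg G 0).mulVecLin := by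
    rw [← LinearMap.ker_eq_bot, LinearMap.ker_eq_bot']
    intro g hg
    rw [mulVecLin_apply] at hg
    obtain ⟨h1, h2⟩ := side h hcomp hu g hg
    obtain ⟨h3, h4⟩ := side h.symm (fun x y hx hy => (hcomp y x hy hx).symm) hw g hg
    ext v
    by_cases hvu : v = u
    · rw [hvu, h1]; rfl
    by_cases hvw : v = w
    · rw [hvw, h3]; rfl
    exact (h.cover v hvu hvw).elim (h2 v) (h4 v)
  rw [Matrix.rank, LinearMap.finrank_range_of_inj hinj, Module.finrank_fintype_fun_eq_card]

lemma indepNum_eq_two (h : IsCliqueSplit G u w) : indepNum G = 2 := by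
  have hle : ∀ s : Finset V, (∀ u ∈ s, ∀ v ∈ s, u ≠ v → ¬ G.Adj u v) → s.card ≤ 2 := by
    intro s hs
    have hinj : Set.InjOn (fun v => decide (v = u ∨ G.Adj u v)) (s : Set V) := by
      intro v hv v' hv' he
      by_contra hne
      refine hs v hv v' hv' hne ?_
      have he' : (v = u ∨ G.Adj u v) ↔ (v' = u ∨ G.Adj u v') := decide_eq_decide.1 he
      have c1 := h.cover v
      have c2 := h.cover v'
      have l := h.clique_left v v'
      have r := h.clique_right v v'
      have s1 := G.adj_comm v u
      have s2 := G.adj_comm v w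
      by_cases e1 : v = u
      · subst e1
        exact (he'.1 (Or.inl rfl)).resolve_left fun e => hne e.symm
      by_cases e2 : v' = u
      · subst e2
        exact ((he'.2 (Or.inl rfl)).resolve_left e1).symm
      by_cases e3 : v = w
      · subst e3
        refine (c2 e2 fun e => hne e.symm).resolve_left fun hc => ?_
        exact (he'.2 (Or.inr hc)).elim e1 h.not_adj
      by_cases e4 : v' = w
      · subst e4
        refine ((c1 e1 hne).resolve_left fun hc => ?_).symm
        exact (he'.1 (Or.inr hc)).elim e2 h.not_adj
      tauto
    have := Finset.card_le_card_of_injOn (t := Finset.univ) _ (fun _ _ => Finset.mem_univ _) hinj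
    simpa using this
  refine le_antisymm (csSup_le ⟨0, ∅, by simp, by simp⟩ ?_) (le_csSup ⟨2, ?_⟩ ?_)
  · rintro k ⟨s, hs, rfl⟩
    exact hle s hs
  · rintro k ⟨s, hs, rfl⟩
    exact hle s hs
  · refine ⟨{u, w}, ?_, Finset.card_pair h.ne⟩
    have := h.not_adj
    have := G.adj_comm u w
    intro p hp q hq
    simp only [Finset.mem_insert, Finset.mem_singleton] at hp hq
    rcases hp with rfl | rfl <;> rcases hq with rfl | rfl <;> tauto

lemma diam_of_complete (h : IsCliqueSplit G u w) (hconn : G.Connected)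
    (hcomp : ∀ x y, G.Adj u x → G.Adj w y → G.Adj x y) (hu : 0 < G.degree u)
    (hw : 0 < G.degree w) : G.diam = 3 := by
  obtain ⟨x, hx⟩ := (G.degree_pos_iff_exists_adj u).1 hu
  obtain ⟨y, hy⟩ := (G.degree_pos_iff_exists_adj w).1 hw
  have : Nonempty V := ⟨u⟩
  apply le_antisymm
  · obtain ⟨v, v', hvv⟩ := G.exists_dist_eq_diam
    have near : ∀ v, ∃ m, (G.Adj u m ∨ G.Adj w m) ∧ G.dist v m ≤ 1 := by
      intro v
      by_cases h1 : v = u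
      · exact ⟨x, Or.inl hx, (SimpleGraph.dist_eq_one_iff_adj.2 (h1 ▸ hx)).le⟩
      by_cases h2 : v = w
      · exact ⟨y, Or.inr hy, (SimpleGraph.dist_eq_one_iff_adj.2 (h2 ▸ hy)).le⟩
      · exact ⟨v, h.cover v h1 h2, by simp⟩
    obtain ⟨m, hm, hd⟩ := near v
    obtain ⟨m', hm', hd'⟩ := near v'
    have hmm : G.dist m m' ≤ 1 := by
      by_cases he : m = m'
      · simp [he]
      refine (SimpleGraph.dist_eq_one_iff_adj.2 ?_).le
      rcases hm with hm | hm <;> rcases hm' with hm' | hm'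
      · exact h.clique_left _ _ hm hm' he
      · exact hcomp _ _ hm hm'
      · exact (hcomp _ _ hm' hm).symm
      · exact h.clique_right _ _ hm hm' he
    have t1 := hconn.dist_triangle (u := v) (v := m) (w := v')
    have t2 := hconn.dist_triangle (u := m) (v := m') (w := v')
    rw [SimpleGraph.dist_comm] at hd'
    omega
  · refine le_trans ?_ (SimpleGraph.dist_le_diam
      (SimpleGraph.connected_iff_ediam_ne_top.1 hconn) (u := u) (v := w))
    obtain ⟨p, hp⟩ := hconn.exists_walk_length_eq_dist u w
    rw [← hp]
    cases p with
    | nil => exact absurd rfl h.ne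
    | cons h1 p =>
      cases p with
      | nil => exact absurd h1 h.not_adj
      | cons h2 p =>
        cases p with
        | nil => exact absurd h2.symm (h.disj _ h1)
        | cons h3 p => simp only [SimpleGraph.Walk.length_cons]; omega

lemma of_dist_eq_three (hind : indepNum G = 2) (hd : G.dist u w = 3) :
    IsCliqueSplit G u w := by
  have htriple : ∀ p q r : V, p ≠ q → p ≠ r → q ≠ r → ¬ G.Adj p q → ¬ G.Adj p r →
      G.Adj q r := by
    intro p q r hpq hpr hqr h1 h2
    by_contra h3
    have hle : 3 ≤ indepNum G := by
      refine le_csSup ⟨Fintype.card V, ?_⟩ ⟨{p, q, r}, ?_, Finset.card_eq_three.2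
        ⟨p, q, r, hpq, hpr, hqr, rfl⟩⟩
      · rintro k ⟨s, -, rfl⟩
        exact Finset.card_le_univ s
      · have := G.adj_comm p q
        have := G.adj_comm p r
        have := G.adj_comm q r
        intro s hs t ht
        simp only [Finset.mem_insert, Finset.mem_singleton] at hs ht
        rcases hs with rfl | rfl | rfl <;> rcases ht with rfl | rfl | rfl <;> tauto
    omega
  have hne : u ≠ w := by
    rintro rfl
    simp at hd
  have hna : ¬ G.Adj u w := fun ha => by
    rw [SimpleGraph.dist_eq_one_iff_adj.2 ha] at hd; omega
  have hdisj : ∀ v, G.Adj u v → ¬ G.Adj w v := by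
    intro v h1 h2
    have := SimpleGraph.dist_le (.cons h1 (.cons h2.symm .nil) : G.Walk u w)
    simp [hd] at this
  have hna' : ¬ G.Adj w u := fun ha => hna ha.symm
  refine ⟨hne, hna, fun v h1 h2 => ?_, hdisj, fun v v' h1 h2 h3 => ?_, fun v v' h1 h2 h3 => ?_⟩
  · by_contra hc
    push Not at hc
    exact hc.2 (htriple u w v hne h1.symm h2.symm hna hc.1)
  · exact htriple w v v' (fun e => hna (e ▸ h1)) (fun e => hna (e ▸ h2)) h3 (hdisj v h1)
      (hdisj v' h2)
  · exact htriple u v v' (fun e => hna' (e ▸ h1)) (fun e => hna' (e ▸ h2)) h3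
      (fun e => hdisj v e h1) (fun e => hdisj v' e h2)

end IsCliqueSplit

lemma exists_path_of_dist_eq_three {V : Type*} {G : SimpleGraph V} {u w : V}
    (hd : G.dist u w = 3) : ∃ x y, G.Adj u x ∧ G.Adj x y ∧ G.Adj y w := by
  obtain ⟨p, hp⟩ := SimpleGraph.exists_walk_of_dist_ne_zero (G := G) (u := u) (v := w) (by omega)
  rw [hd] at hp
  cases p with
  | nil => simp at hp
  | cons h1 p =>
    cases p with
    | nil => simp at hp
    | cons h2 p =>
      cases p with
      | nil => simp at hp
      | cons h3 p =>
        have : p.length = 0 := by simpa using hp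
        obtain rfl := SimpleGraph.Walk.eq_of_length_eq_zero this
        exact ⟨_, _, h1, h2, h3⟩

theorem statement0 {V : Type*} [Fintype V] [DecidableEq V] (n : ℕ) (hn : 5 ≤ n)
    (G : SimpleGraph V) [DecidableRel G.Adj]
    (hcard : Fintype.card V = n) (hconn : G.Connected) :
    (memG1Family G n ∧ G.diam = 3) ↔
      ∃ a b : ℕ, a + b + 4 = n ∧ Nonempty (G ≃g graphG1 a b) := by
  have hnontriv : Nontrivial V := Fintype.one_lt_card_iff_nontrivial.1 (by omega)
  have hdeg : ∀ v, 0 < G.degree v := fun v =>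
    hconn.preconnected.degree_pos_of_nontrivial v
  constructor
  · rintro ⟨⟨-, -, ⟨θ, hθ⟩, -, hind⟩, hdiam⟩
    obtain ⟨u, w, huw⟩ := G.exists_dist_eq_diam
    rw [hdiam] at huw
    have h := IsCliqueSplit.of_dist_eq_three hind huw
    obtain ⟨x, y, hx, hxy, hy⟩ := exists_path_of_dist_eq_three huw
    have hrank := eigMult_normLap_add_rank hdeg θ
    have hV := h.card_eq
    have hu := hdeg u
    have hw := hdeg w
    refine ⟨G.degree u - 1, G.degree w - 1, by omega, ?_⟩
    exact h.nonempty_iso_graphG1 (fun x' y' hx' hy' =>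
      h.complete_of_rank_le (show (adjSubDeg G (1 - θ)).rank ≤ 3 by omega) hx hy.symm hxy hx' hy') (by omega) (by omega)
  · rintro ⟨a, b, -, ⟨e⟩⟩
    obtain ⟨u, hu⟩ := e.surjective (Sum.inl ())
    obtain ⟨w, hw⟩ := e.surjective (Sum.inr (Sum.inr (Sum.inr ())))
    have h : IsCliqueSplit G u w := .of_iso e (by rw [hu, hw]; exact .graphG1 a b)
    have hcomp : ∀ x y, G.Adj u x → G.Adj w y → G.Adj x y := by
      intro x y hx hy
      rw [← e.map_adj_iff] at hx hy ⊢
      rw [hu] at hx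
      rw [hw] at hy
      generalize e x = s at *
      generalize e y = t at *
      rcases s with _ | _ | _ | _ <;> rcases t with _ | _ | _ | _ <;> simp_all [graphG1]
    obtain ⟨x, hx⟩ := (G.degree_pos_iff_exists_adj u).1 (hdeg u)
    obtain ⟨y, hy⟩ := (G.degree_pos_iff_exists_adj w).1 (hdeg w)
    refine ⟨⟨hconn, hcard, ⟨1 + 1 / (G.degree u + G.degree w : ℝ), ?_⟩, ?_,
      h.indepNum_eq_two⟩, h.diam_of_complete hconn hcomp (hdeg u) (hdeg w)⟩
    · have hrank := eigMult_normLap_add_rank hdeg (1 + 1 / (G.degree u + G.degree w : ℝ))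
      rw [show (1 : ℝ) - (1 + 1 / (G.degree u + G.degree w : ℝ)) =
        -1 / (G.degree u + G.degree w : ℝ) by ring, h.rank_of_complete hcomp hx hy] at hrank
      omega
    · refine secondSmallestEig_ne_of_eigMult_eq_zero _ (by omega) one_ne_zero ?_
      have hrank := eigMult_normLap_add_rank hdeg 1
      rw [sub_self, h.rank_zero_of_complete hcomp (hdeg u) (hdeg w)] at hrank
      omega
end

section
/- Let n ≥ 5 and let G be a connected simple graph on n vertices. Then G belongs to 𝒢₁(n, n−3) and G is a cograph if and only if G is (isomorphic to) the graph G₂, i.e., the complete graph K_{n−1} with one pendant vertex attached to one of its vertices. -/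
open Matrix

section LinearAlgebra

variable {V : Type*} [Fintype V]

/-- The solutions `c` of `A c = t D c`, where `A` is the adjacency matrix of `G` and `D` its
degree matrix. -/
def adjKer (G : SimpleGraph V) [DecidableRel G.Adj] (t : ℝ) : Submodule ℝ (V → ℝ) where
  carrier := {c | ∀ v, ∑ u, (if G.Adj v u then c u else 0) = t * G.degree v * c v}
  add_mem' {c e} hc he v := by
    have h1 := hc v
    have h2 := he v
    rw [Pi.add_apply, mul_add, ← h1, ← h2, ← Finset.sum_add_distrib]
    refine Finset.sum_congr rfl fun u _ => ?_
    split_ifs <;> simp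
  zero_mem' v := by simp
  smul_mem' r c hc v := by
    have h1 := hc v
    rw [Pi.smul_apply, smul_eq_mul, mul_left_comm, ← h1, Finset.mul_sum]
    refine Finset.sum_congr rfl fun u _ => ?_
    split_ifs <;> simp

theorem mem_adjKer {G : SimpleGraph V} [DecidableRel G.Adj] {t : ℝ} {c : V → ℝ} :
    c ∈ adjKer G t ↔ ∀ v, ∑ u, (if G.Adj v u then c u else 0) = t * G.degree v * c v :=
  Iff.rfl

theorem normLap_sub_smul_mulVec [DecidableEq V] (G : SimpleGraph V) [DecidableRel G.Adj]
    (hd : ∀ v, 0 < G.degree v) (μ : ℝ) (c : V → ℝ) (v : V) :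
    ((normLap G - μ • (1 : Matrix V V ℝ)) *ᵥ fun u => √(G.degree u : ℝ) * c u) v =
      (√(G.degree v : ℝ))⁻¹ *
        ((1 - μ) * G.degree v * c v - ∑ u, (if G.Adj v u then c u else 0)) := by
  have hs : ∀ u, 0 < √(G.degree u : ℝ) := fun u => Real.sqrt_pos.2 (by exact_mod_cast hd u)
  have hterm : ∀ u, (normLap G - μ • (1 : Matrix V V ℝ)) v u * (√(G.degree u : ℝ) * c u) =
      (if u = v then (1 - μ) * √(G.degree v : ℝ) * c v else 0) -
        (√(G.degree v : ℝ))⁻¹ * (if G.Adj v u then c u else 0) := by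
    intro u
    rcases eq_or_ne u v with rfl | huv
    · simp [normLap, mul_assoc]
    · by_cases ha : G.Adj v u
      · have := hs u
        have := hs v
        simp only [normLap, Matrix.sub_apply, of_apply, huv.symm, huv, ha, Matrix.smul_apply, one_apply,
          if_true, if_false, Real.sqrt_mul (Nat.cast_nonneg (G.degree v))]
        field_simp
        simp
      · simp [normLap, huv.symm, huv, ha]
  simp only [mulVec, dotProduct, hterm, Finset.sum_sub_distrib, ← Finset.mul_sum,
    Finset.sum_ite_eq', Finset.mem_univ, if_true, mul_sub]
  congr 1
  have h1 := hs v
  have h2 : √(G.degree v : ℝ) * √(G.degree v : ℝ) = G.degree v :=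
    Real.mul_self_sqrt (Nat.cast_nonneg _)
  field_simp
  rw [sq, h2]
  ring

theorem mem_adjKer_iff_mulVec_eq_zero [DecidableEq V] (G : SimpleGraph V) [DecidableRel G.Adj]
    (hd : ∀ v, 0 < G.degree v) (μ : ℝ) (c : V → ℝ) :
    c ∈ adjKer G (1 - μ) ↔
      (normLap G - μ • (1 : Matrix V V ℝ)) *ᵥ (fun u => √(G.degree u : ℝ) * c u) = 0 := by
  rw [funext_iff, mem_adjKer]
  refine forall_congr' fun v => ?_
  have hs : √(G.degree v : ℝ) ≠ 0 := (Real.sqrt_pos.2 (by exact_mod_cast hd v)).ne'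
  rw [normLap_sub_smul_mulVec G hd, Pi.zero_apply, mul_eq_zero,
    or_iff_right (inv_ne_zero hs), sub_eq_zero, eq_comm]

theorem eigMult_normLap [DecidableEq V] (G : SimpleGraph V) [DecidableRel G.Adj]
    (hd : ∀ v, 0 < G.degree v) (μ : ℝ) :
    eigMult (normLap G) μ = Module.finrank ℝ (adjKer G (1 - μ)) := by
  have hs : ∀ u, √(G.degree u : ℝ) ≠ 0 :=
    fun u => (Real.sqrt_pos.2 (by exact_mod_cast hd u)).ne'
  let e : (V → ℝ) ≃ₗ[ℝ] (V → ℝ) :=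
    LinearEquiv.piCongrRight fun v => LinearEquiv.smulOfNeZero ℝ ℝ (√(G.degree v : ℝ)) (hs v)
  have key : (adjKer G (1 - μ)).map e.toLinearMap =
      LinearMap.ker (normLap G - μ • (1 : Matrix V V ℝ)).mulVecLin := by
    have hc : adjKer G (1 - μ) =
        (LinearMap.ker (normLap G - μ • (1 : Matrix V V ℝ)).mulVecLin).comap e.toLinearMap := by
      ext c
      have he : (e.toLinearMap c) = fun u => √(G.degree u : ℝ) * c u := by
        ext u; simp [e]
      rw [Submodule.mem_comap, LinearMap.mem_ker, he, mulVecLin_apply,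
        mem_adjKer_iff_mulVec_eq_zero G hd]
    rw [hc, Submodule.map_comap_eq_of_surjective e.surjective]
  rw [eigMult, ← key]
  exact LinearEquiv.finrank_map_eq e _

theorem exists_mem_adjKer_support_four [DecidableEq V] {G : SimpleGraph V} [DecidableRel G.Adj] {t : ℝ}
    (hV : 5 ≤ Fintype.card V) (hK : Module.finrank ℝ (adjKer G t) = Fintype.card V - 3)
    {s₁ s₂ s₃ s₄ : V} (h12 : s₁ ≠ s₂) (h13 : s₁ ≠ s₃) (h14 : s₁ ≠ s₄) (h23 : s₂ ≠ s₃)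
    (h24 : s₂ ≠ s₄) (h34 : s₃ ≠ s₄) :
    ∃ c₁ c₂ c₃ c₄ : ℝ, ¬ (c₁ = 0 ∧ c₂ = 0 ∧ c₃ = 0 ∧ c₄ = 0) ∧ ∀ v,
      (if G.Adj v s₁ then c₁ else 0) + (if G.Adj v s₂ then c₂ else 0) +
        (if G.Adj v s₃ then c₃ else 0) + (if G.Adj v s₄ then c₄ else 0) =
      t * G.degree v * ((if v = s₁ then c₁ else 0) + (if v = s₂ then c₂ else 0) +
        (if v = s₃ then c₃ else 0) + (if v = s₄ then c₄ else 0)) := by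
  let S : Finset V := {s₁, s₂, s₃, s₄}
  have hS : S.card = 4 := Finset.card_eq_of_equiv_fin (by
    refine Finset.equivFinOfCardEq ?_
    simp [S, h12, h13, h14, h23, h24, h34])
  let φ : adjKer G t →ₗ[ℝ] ((Sᶜ : Finset V) → ℝ) :=
    (LinearMap.funLeft ℝ ℝ (fun i : (Sᶜ : Finset V) => (i : V))).comp (adjKer G t).subtype
  have hlt : Module.finrank ℝ ((Sᶜ : Finset V) → ℝ) < Module.finrank ℝ (adjKer G t) := by
    rw [hK, Module.finrank_fintype_fun_eq_card, Fintype.card_coe, Finset.card_compl, hS]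
    omega
  obtain ⟨⟨c, hc⟩, hker, hne⟩ :=
    (Submodule.ne_bot_iff _).1 (LinearMap.ker_ne_bot_of_finrank_lt (f := φ) hlt)
  have hzero : ∀ u, u ∉ S → c u = 0 := fun u hu =>
    congrFun (LinearMap.mem_ker.1 hker) ⟨u, Finset.mem_compl.2 hu⟩
  refine ⟨c s₁, c s₂, c s₃, c s₄, ?_, fun v => ?_⟩
  · rintro ⟨h1, h2, h3, h4⟩
    refine hne (Subtype.ext (funext fun u => ?_))
    by_cases hu : u ∈ S
    · simp only [S, Finset.mem_insert, Finset.mem_singleton] at hu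
      rcases hu with rfl | rfl | rfl | rfl <;> assumption
    · exact hzero u hu
  · have h := mem_adjKer.1 hc v
    rw [← Finset.sum_subset (Finset.subset_univ S) (fun u _ hu => by simp [hzero u hu])] at h
    have hv : c v = (if v = s₁ then c s₁ else 0) + (if v = s₂ then c s₂ else 0) +
        (if v = s₃ then c s₃ else 0) + (if v = s₄ then c s₄ else 0) := by
      by_cases hu : v ∈ S
      · simp only [S, Finset.mem_insert, Finset.mem_singleton] at hu
        rcases hu with rfl | rfl | rfl | rfl <;> simp [*, Ne.symm]
      · have h0 := hzero v hu
        simp only [S, Finset.mem_insert, Finset.mem_singleton, not_or] at hu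
        simp [hu, h0]
    rw [← hv, ← h]
    simp only [S]
    rw [Finset.sum_insert (by simp [*]), Finset.sum_insert (by simp [*]),
      Finset.sum_insert (by simp [*]), Finset.sum_singleton]
    ring

theorem finrank_ker_add_card_ge {m : ℕ} (φ : (V → ℝ) →ₗ[ℝ] (Fin m → ℝ)) :
    Fintype.card V ≤ Module.finrank ℝ (LinearMap.ker φ) + m := by
  have h := LinearMap.finrank_range_add_finrank_ker φ
  have h2 := Submodule.finrank_le (LinearMap.range φ)
  rw [Module.finrank_fintype_fun_eq_card] at h
  rw [Module.finrank_fintype_fun_eq_card, Fintype.card_fin] at h2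
  omega

end LinearAlgebra
section JoinSplit

variable {V : Type*}

/-- The vertex set of `G` is the disjoint union of cliques `A` and `B` without edges between them
and of a set `R` all of whose vertices are adjacent to all vertices of `A` and `B`. -/
structure IsJoinSplit (G : SimpleGraph V) (A B R : Finset V) : Prop where
  cover : ∀ v, v ∈ A ∨ v ∈ B ∨ v ∈ R
  disj_left_right : Disjoint A B
  disj_left_join : Disjoint A R
  disj_right_join : Disjoint B R
  adj_left : ∀ u ∈ A, ∀ v ∈ A, u ≠ v → G.Adj u v
  adj_right : ∀ u ∈ B, ∀ v ∈ B, u ≠ v → G.Adj u v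
  not_adj : ∀ u ∈ A, ∀ v ∈ B, ¬ G.Adj u v
  adj_left_join : ∀ u ∈ A, ∀ v ∈ R, G.Adj u v
  adj_right_join : ∀ u ∈ B, ∀ v ∈ R, G.Adj u v

namespace IsJoinSplit

variable {G : SimpleGraph V} {A B R : Finset V}

theorem swap (h : IsJoinSplit G A B R) : IsJoinSplit G B A R where
  cover v := by have := h.cover v; tauto
  disj_left_right := h.disj_left_right.symm
  disj_left_join := h.disj_right_join
  disj_right_join := h.disj_left_join
  adj_left := h.adj_right
  adj_right := h.adj_left
  not_adj u hu v hv hadj := h.not_adj v hv u hu hadj.symm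
  adj_left_join := h.adj_right_join
  adj_right_join := h.adj_left_join

theorem ne_left_right (h : IsJoinSplit G A B R) {u v : V} (hu : u ∈ A) (hv : v ∈ B) : u ≠ v :=
  fun e => Finset.disjoint_left.1 h.disj_left_right hu (e ▸ hv)

theorem ne_left_join (h : IsJoinSplit G A B R) {u v : V} (hu : u ∈ A) (hv : v ∈ R) : u ≠ v :=
  fun e => Finset.disjoint_left.1 h.disj_left_join hu (e ▸ hv)

variable [Fintype V] [DecidableEq V]

theorem union_eq_univ (h : IsJoinSplit G A B R) : A ∪ B ∪ R = Finset.univ := by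
  ext v
  have := h.cover v
  simp only [Finset.mem_univ, Finset.mem_union, iff_true]
  tauto

theorem card_eq (h : IsJoinSplit G A B R) : Fintype.card V = A.card + B.card + R.card := by
  rw [← Finset.card_univ, ← h.union_eq_univ, Finset.card_union_of_disjoint
    (Finset.disjoint_union_left.2 ⟨h.disj_left_join, h.disj_right_join⟩),
    Finset.card_union_of_disjoint h.disj_left_right]

theorem sum_eq (h : IsJoinSplit G A B R) (f : V → ℝ) :
    ∑ u, f u = ∑ u ∈ A, f u + ∑ u ∈ B, f u + ∑ u ∈ R, f u := by
  rw [← h.union_eq_univ, Finset.sum_union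
    (Finset.disjoint_union_left.2 ⟨h.disj_left_join, h.disj_right_join⟩),
    Finset.sum_union h.disj_left_right]

variable [DecidableRel G.Adj] {t : ℝ}

theorem degree_left (h : IsJoinSplit G A B R) {u : V} (hu : u ∈ A) :
    (G.degree u : ℝ) = A.card - 1 + R.card := by
  have hn : G.neighborFinset u = A.erase u ∪ R := by
    ext v
    simp only [SimpleGraph.mem_neighborFinset, Finset.mem_union, Finset.mem_erase]
    constructor
    · intro hadj
      rcases h.cover v with hv | hv | hv
      · exact Or.inl ⟨hadj.ne', hv⟩
      · exact absurd hadj (h.not_adj u hu v hv)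
      · exact Or.inr hv
    · rintro (⟨hne, hv⟩ | hv)
      · exact h.adj_left u hu v hv hne.symm
      · exact h.adj_left_join u hu v hv
  rw [← G.card_neighborFinset_eq_degree, hn, Finset.card_union_of_disjoint
    (h.disj_left_join.mono_left (Finset.erase_subset _ _)), Finset.card_erase_of_mem hu,
    Nat.cast_add, Nat.cast_sub (Finset.card_pos.2 ⟨u, hu⟩), Nat.cast_one]

theorem degree_join_le (h : IsJoinSplit G A B R) {w z : V} (hwz : w ≠ z) (hadj : ¬ G.Adj w z) :
    (G.degree w : ℝ) ≤ A.card + B.card + R.card - 2 := by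
  have hsub : insert w (insert z (G.neighborFinset w)) ⊆ Finset.univ := Finset.subset_univ _
  have hc := Finset.card_le_card hsub
  rw [Finset.card_insert_of_notMem (by simp [hwz]), Finset.card_insert_of_notMem (by simp [hadj]),
    Finset.card_univ, h.card_eq, G.card_neighborFinset_eq_degree] at hc
  have : ((G.degree w + 1 + 1 : ℕ) : ℝ) ≤ ((A.card + B.card + R.card : ℕ) : ℝ) :=
    Nat.cast_le.2 hc
  push_cast at this
  linarith

theorem degree_join_eq (h : IsJoinSplit G A B R) {w : V} (hw : w ∈ R)
    (hR : ∀ z ∈ R, w ≠ z → G.Adj w z) :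
    (G.degree w : ℝ) = A.card + B.card + R.card - 1 := by
  have hn : insert w (G.neighborFinset w) = Finset.univ := by
    ext v
    simp only [Finset.mem_insert, SimpleGraph.mem_neighborFinset, Finset.mem_univ, iff_true]
    rcases eq_or_ne v w with hv | hv
    · exact Or.inl hv
    · right
      rcases h.cover v with hv' | hv' | hv'
      · exact (h.adj_left_join v hv' w hw).symm
      · exact (h.adj_right_join v hv' w hw).symm
      · exact hR v hv' hv.symm
  have hc := congrArg Finset.card hn
  rw [Finset.card_insert_of_notMem (by simp), Finset.card_univ, h.card_eq,
    G.card_neighborFinset_eq_degree] at hc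
  have : ((G.degree w + 1 : ℕ) : ℝ) = ((A.card + B.card + R.card : ℕ) : ℝ) := congrArg _ hc
  push_cast at this
  linarith

/-- A kernel vector supported on one vertex of each clique and two vertices of the join part. -/
theorem exists_support_join_pair (h : IsJoinSplit G A B R)
    (hV : 5 ≤ Fintype.card V) (hK : Module.finrank ℝ (adjKer G t) = Fintype.card V - 3)
    {x y w z : V} (hx : x ∈ A) (hy : y ∈ B) (hw : w ∈ R) (hz : z ∈ R) (hwz : w ≠ z) :
    ∃ α β γ δ : ℝ, ¬ (α = 0 ∧ β = 0 ∧ γ = 0 ∧ δ = 0) ∧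
      γ + δ = t * G.degree x * α ∧ γ + δ = t * G.degree y * β ∧
      α + β + (if G.Adj w z then δ else 0) = t * G.degree w * γ ∧
      α + β + (if G.Adj w z then γ else 0) = t * G.degree z * δ := by
  have nxy := h.ne_left_right hx hy
  have nxw := h.ne_left_join hx hw
  have nxz := h.ne_left_join hx hz
  have nyw := h.swap.ne_left_join hy hw
  have nyz := h.swap.ne_left_join hy hz
  have axy := h.not_adj x hx y hy
  have axw := h.adj_left_join x hx w hw
  have axz := h.adj_left_join x hx z hz
  have ayw := h.adj_right_join y hy w hw
  have ayz := h.adj_right_join y hy z hz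
  obtain ⟨α, β, γ, δ, hne, he⟩ := exists_mem_adjKer_support_four hV hK nxy nxw nxz nyw nyz hwz
  refine ⟨α, β, γ, δ, hne, ?_, ?_, ?_, ?_⟩
  · simpa [nxy, nxw, nxz, axy, axw, axz] using he x
  · simpa [nxy.symm, nyw, nyz, G.adj_comm y x, axy, ayw, ayz] using he y
  · simpa [nxw.symm, nyw.symm, hwz, axw.symm, ayw.symm] using he w
  · simpa [nxz.symm, nyz.symm, hwz.symm, axz.symm, ayz.symm, G.adj_comm z w] using he z

theorem adj_join_of_left_twin (h : IsJoinSplit G A B R)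
    (hV : 5 ≤ Fintype.card V) (hK : Module.finrank ℝ (adjKer G t) = Fintype.card V - 3)
    (hB : B.Nonempty) (hBA : B.card ≤ A.card)
    (ht : t * ((A.card : ℝ) - 1 + R.card) = -1) {w z : V} (hw : w ∈ R) (hz : z ∈ R)
    (hwz : w ≠ z) : G.Adj w z := by
  by_contra hadj
  obtain ⟨y, hy⟩ := hB
  obtain ⟨x, hx⟩ := Finset.card_pos.1 ((Finset.card_pos.2 ⟨y, hy⟩).trans_le hBA)
  obtain ⟨α, β, γ, δ, hne, e1, e2, e3, e4⟩ := h.exists_support_join_pair hV hK hx hy hw hz hwz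
  rw [if_neg hadj, add_zero] at e3 e4
  rw [h.degree_left hx] at e1
  rw [h.swap.degree_left hy] at e2
  have hdw := h.degree_join_le hwz hadj
  have hdz := h.degree_join_le hwz.symm (fun e => hadj e.symm)
  have hdw0 : (0 : ℝ) < G.degree w := by
    exact_mod_cast (G.degree_pos_iff_exists_adj w).2 ⟨x, (h.adj_left_join x hx w hw).symm⟩
  have hdz0 : (0 : ℝ) < G.degree z := by
    exact_mod_cast (G.degree_pos_iff_exists_adj z).2 ⟨x, (h.adj_left_join x hx z hz).symm⟩
  have hr : (1 : ℝ) ≤ R.card := by exact_mod_cast Finset.card_pos.2 ⟨w, hw⟩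
  have hb : (1 : ℝ) ≤ B.card := by exact_mod_cast Finset.card_pos.2 ⟨y, hy⟩
  have hba : (B.card : ℝ) ≤ A.card := by exact_mod_cast hBA
  generalize (G.degree w : ℝ) = d at *
  generalize (G.degree z : ℝ) = d' at *
  obtain ⟨p, hp⟩ : ∃ p : ℝ, p = A.card - 1 + R.card := ⟨_, rfl⟩
  obtain ⟨q, hq⟩ : ∃ q : ℝ, q = B.card - 1 + R.card := ⟨_, rfl⟩
  rw [← hp] at e1 ht
  rw [← hq] at e2
  have hp0 : 0 < p := by linarith
  have hq0 : 0 < q := by linarith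
  have hqp : q ≤ p := by linarith
  have hd : d ≤ p + q := by linarith
  have hd' : d' ≤ p + q := by linarith
  rw [ht] at e1
  have e2' : p * (γ + δ) = -q * β := by linear_combination p * e2 + q * β * ht
  have e3' : p * (α + β) = -d * γ := by linear_combination p * e3 + d * γ * ht
  have e4' : p * (α + β) = -d' * δ := by linear_combination p * e4 + d' * δ * ht
  have hs : α * (p * (p + q) * (d + d') - q * d * d') = 0 := by
    linear_combination ((d + d') * p * p - q * d * d') * e1 +
      (-(d + d') * p) * e2' + (q * d') * e3' + (q * d) * e4'
  have hpos : 0 < p * (p + q) * (d + d') - q * d * d' := by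
    have h1 : q * d * d' ≤ q * (p + q) * d' := by gcongr
    have h2 : q * (p + q) * d' ≤ p * (p + q) * d' := by gcongr
    have h3 : 0 < p * (p + q) * d := by positivity
    linarith
  have hα : α = 0 := (mul_eq_zero.1 hs).resolve_right hpos.ne'
  have hβ : β = 0 := by
    have : q * β = 0 := by linear_combination e2' - p * e1 + p * hα
    exact (mul_eq_zero.1 this).resolve_left hq0.ne'
  subst hα hβ
  have hγ : γ = 0 := by
    have : d * γ = 0 := by linear_combination e3'
    exact (mul_eq_zero.1 this).resolve_left hdw0.ne'
  have hδ : δ = 0 := by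
    have : d' * δ = 0 := by linear_combination e4'
    exact (mul_eq_zero.1 this).resolve_left hdz0.ne'
  exact hne ⟨rfl, rfl, hγ, hδ⟩

theorem card_join_le_one (h : IsJoinSplit G A B R)
    (hV : 5 ≤ Fintype.card V) (hK : Module.finrank ℝ (adjKer G t) = Fintype.card V - 3)
    (hB : B.Nonempty) (hBA : B.card ≤ A.card)
    (ht : t * ((A.card : ℝ) - 1 + R.card) = -1) : R.card ≤ 1 := by
  by_contra hcard
  obtain ⟨w, hw, z, hz, hwz⟩ := Finset.one_lt_card.1 (not_le.1 hcard)
  have hadj : ∀ w ∈ R, ∀ z ∈ R, w ≠ z → G.Adj w z := fun w hw z hz hwz =>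
    h.adj_join_of_left_twin hV hK hB hBA ht hw hz hwz
  obtain ⟨y, hy⟩ := hB
  obtain ⟨x, hx⟩ := Finset.card_pos.1 ((Finset.card_pos.2 ⟨y, hy⟩).trans_le hBA)
  obtain ⟨α, β, γ, δ, hne, e1, e2, e3, e4⟩ := h.exists_support_join_pair hV hK hx hy hw hz hwz
  rw [if_pos (hadj w hw z hz hwz), h.degree_join_eq hw (hadj w hw)] at e3
  rw [if_pos (hadj w hw z hz hwz), h.degree_join_eq hz (hadj z hz)] at e4
  rw [h.degree_left hx] at e1
  rw [h.swap.degree_left hy] at e2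
  have hr : (2 : ℝ) ≤ R.card := by exact_mod_cast not_le.1 hcard
  have hb : (1 : ℝ) ≤ B.card := by exact_mod_cast Finset.card_pos.2 ⟨y, hy⟩
  have hba : (B.card : ℝ) ≤ A.card := by exact_mod_cast hBA
  generalize (A.card : ℝ) = a at *
  generalize (B.card : ℝ) = b at *
  generalize (R.card : ℝ) = r at *
  obtain ⟨p, hp⟩ : ∃ p : ℝ, p = a - 1 + r := ⟨_, rfl⟩
  obtain rfl : a = p + 1 - r := by linarith
  have ht' : t * p = -1 := by linear_combination ht + t * hp
  have e3' : p * (α + β + δ) = -(p + b) * γ := by linear_combination p * e3 + (p + b) * γ * ht'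
  have e4' : p * (α + β + γ) = -(p + b) * δ := by linear_combination p * e4 + (p + b) * δ * ht'
  have e1' : γ + δ = -α := by linear_combination e1 + α * ht'
  have e2' : p * (γ + δ) = -(b - 1 + r) * β := by
    linear_combination p * e2 + (b - 1 + r) * β * ht'
  have hγδ : γ = δ := by
    have : b * (γ - δ) = 0 := by linear_combination e3' - e4'
    linarith [(mul_eq_zero.1 this).resolve_left (by linarith)]
  subst hγδ
  have hp0 : 0 < p := by linarith
  have hγ : γ = 0 := by
    have : γ * (2 * p * p - b * (b - 1 + r)) = 0 := by
      linear_combination p * e2' - (b - 1 + r) * e3' + p * (b - 1 + r) * e1'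
    refine (mul_eq_zero.1 this).resolve_right (ne_of_gt ?_)
    have h1 : b * (b - 1 + r) ≤ p * p := by
      apply mul_le_mul <;> linarith
    have h2 : 0 < p * p := by positivity
    linarith
  subst hγ
  have hα : α = 0 := by linarith
  subst hα
  have hβ : β = 0 := by
    have : p * β = 0 := by linear_combination e3'
    exact (mul_eq_zero.1 this).resolve_left hp0.ne'
  exact hne ⟨rfl, hβ, rfl, rfl⟩

theorem card_left_eq_card_right (h : IsJoinSplit G A B R)
    (hV : 5 ≤ Fintype.card V) (hK : Module.finrank ℝ (adjKer G t) = Fintype.card V - 3)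
    (hA : A.Nonempty) (hB : 2 ≤ B.card) (hR : R.Nonempty)
    (ht : t * ((A.card : ℝ) - 1 + R.card) = -1) : A.card = B.card := by
  by_contra hab
  obtain ⟨x, hx⟩ := hA
  obtain ⟨y, hy, y', hy', nyy⟩ := Finset.one_lt_card.1 hB
  obtain ⟨w, hw⟩ := hR
  have nxy := h.ne_left_right hx hy
  have nxy' := h.ne_left_right hx hy'
  have nxw := h.ne_left_join hx hw
  have nyw := h.swap.ne_left_join hy hw
  have nyw' := h.swap.ne_left_join hy' hw
  have axy := h.not_adj x hx y hy
  have axy' := h.not_adj x hx y' hy'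
  have ayy := h.adj_right y hy y' hy' nyy
  have axw := h.adj_left_join x hx w hw
  have ayw := h.adj_right_join y hy w hw
  have ayw' := h.adj_right_join y' hy' w hw
  obtain ⟨α, β, β', γ, hne, he⟩ :=
    exists_mem_adjKer_support_four hV hK nxy nxy' nxw nyy nyw nyw'
  have e1 : γ = t * G.degree x * α := by
    simpa [nxy, nxy', nxw, axy, axy', axw] using he x
  have e2 : β' + γ = t * G.degree y * β := by
    simpa [nxy.symm, nyy, nyw, G.adj_comm y x, axy, ayy, ayw] using he y
  have e3 : β + γ = t * G.degree y' * β' := by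
    simpa [nxy'.symm, nyy.symm, nyw', G.adj_comm y' x, axy', ayy.symm, ayw'] using he y'
  have e4 : α + β + β' = t * G.degree w * γ := by
    simpa [nxw.symm, nyw.symm, nyw'.symm, axw.symm, ayw.symm, ayw'.symm] using he w
  rw [h.degree_left hx, ht] at e1
  rw [h.swap.degree_left hy] at e2
  rw [h.swap.degree_left hy'] at e3
  have ha1 : (1 : ℝ) ≤ A.card := by exact_mod_cast Finset.card_pos.2 ⟨x, hx⟩
  have hr1 : (1 : ℝ) ≤ R.card := by exact_mod_cast Finset.card_pos.2 ⟨w, hw⟩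
  have hb2 : (2 : ℝ) ≤ B.card := by exact_mod_cast hB
  have hab' : (A.card : ℝ) ≠ B.card := by exact_mod_cast hab
  have ht0 : t < 0 := by nlinarith
  have htq : 1 + t * ((B.card : ℝ) - 1 + R.card) ≠ 0 := by
    intro h0
    have : t * ((A.card : ℝ) - B.card) = 0 := by linear_combination ht - h0
    rcases mul_eq_zero.1 this with h1 | h1
    · exact ht0.ne h1
    · exact hab' (sub_eq_zero.1 h1)
  have hβ : β = β' := by
    have : (1 + t * ((B.card : ℝ) - 1 + R.card)) * (β - β') = 0 := by
      linear_combination e3 - e2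
    exact sub_eq_zero.1 ((mul_eq_zero.1 this).resolve_left htq)
  subst hβ
  have hα : α = -γ := by linarith
  subst hα
  have htq0 : t * ((B.card : ℝ) - 1 + R.card) < 0 := mul_neg_of_neg_of_pos ht0 (by linarith)
  have hβ0 : β ≠ 0 := by
    rintro rfl
    have hγ : γ = 0 := by linarith
    subst hγ
    exact hne ⟨by simp, rfl, rfl, rfl⟩
  have hB2 : B.card ≤ 2 := by
    by_contra hcon
    obtain ⟨z, hz, hzn⟩ := Finset.exists_mem_notMem_of_card_lt_card
      (s := {y, y'}) (t := B) (by rw [Finset.card_pair nyy]; omega)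
    simp only [Finset.mem_insert, Finset.mem_singleton, not_or] at hzn
    have e5 : β + β + γ = 0 := by
      simpa [hzn.1, hzn.2, h.swap.ne_left_join hz hw, (h.ne_left_right hx hz).symm,
        G.adj_comm z x, h.not_adj x hx z hz, h.adj_right z hz y hy hzn.1,
        h.adj_right z hz y' hy' hzn.2, h.adj_right_join z hz w hw] using he z
    have : (1 + t * ((B.card : ℝ) - 1 + R.card)) * β = 0 := by linear_combination e5 - e3
    exact hβ0 ((mul_eq_zero.1 this).resolve_left htq)
  have hRz : ∀ z ∈ R, z = w := by
    intro z hz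
    by_contra hzw
    have e5 : -γ + β + β + (if G.Adj z w then γ else 0) = 0 := by
      simpa [hzw, (h.ne_left_join hx hz).symm, (h.swap.ne_left_join hy hz).symm,
        (h.swap.ne_left_join hy' hz).symm, (h.adj_left_join x hx z hz).symm,
        (h.adj_right_join y hy z hz).symm, (h.adj_right_join y' hy' z hz).symm] using he z
    split_ifs at e5
    · exact hβ0 (by linarith)
    · have : (3 - t * ((B.card : ℝ) - 1 + R.card)) * β = 0 := by linear_combination e5 + e3
      exact hβ0 ((mul_eq_zero.1 this).resolve_left (by linarith))
  have hRc : R.card = 1 := Finset.card_eq_one.2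
    ⟨w, Finset.eq_singleton_iff_unique_mem.2 ⟨hw, hRz⟩⟩
  have hBc : B.card = 2 := le_antisymm hB2 hB
  rw [h.degree_join_eq hw fun z hz hwz => absurd (hRz z hz).symm hwz] at e4
  rw [hRc] at e3 e4 ht
  rw [hBc] at e3 e4
  push_cast at e3 e4 ht
  obtain ⟨a, ha⟩ : ∃ a : ℝ, a = A.card := ⟨_, rfl⟩
  rw [← ha] at e4 ht
  have hγ : a * β = -γ := by
    linear_combination (1 / 2) * a * e4 + (1 / 2) * (a + 2) * γ * ht
  have hq : β * (a * a - a - 2) = 0 := by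
    linear_combination a * hγ - a * e3 - 2 * β * ht
  have h2 : (a - 2) * (a + 1) = 0 := by
    linear_combination (mul_eq_zero.1 hq).resolve_left hβ0
  rcases mul_eq_zero.1 h2 with h3 | h3
  · apply hab
    rw [hBc]
    have : (A.card : ℝ) = 2 := by linarith
    exact_mod_cast this
  · linarith

theorem sum_adj_left (h : IsJoinSplit G A B R) (c : V → ℝ) {v : V} (hv : v ∈ A) :
    ∑ u, (if G.Adj v u then c u else 0) = ∑ u ∈ A, c u + ∑ u ∈ R, c u - c v := by
  have hA : ∑ u ∈ A, (if G.Adj v u then c u else 0) = ∑ u ∈ A, c u - c v := by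
    rw [← Finset.add_sum_erase A _ hv, ← Finset.add_sum_erase A c hv,
      if_neg (G.irrefl), zero_add, add_sub_cancel_left]
    exact Finset.sum_congr rfl fun u hu => if_pos
      (h.adj_left v hv u (Finset.mem_of_mem_erase hu) (Finset.ne_of_mem_erase hu).symm)
  rw [h.sum_eq, hA, Finset.sum_eq_zero (s := B) fun u hu => if_neg (h.not_adj v hv u hu),
    Finset.sum_congr (s₁ := R) rfl fun u hu => if_pos (h.adj_left_join v hv u hu)]
  ring

theorem finrank_adjKer_of_card_eq (h : IsJoinSplit G A B R) (hAB : A.card = B.card)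
    (hR : R.card = 1) (ht : t * (A.card : ℝ) = -1) :
    Fintype.card V ≤ Module.finrank ℝ (adjKer G t) + 2 := by
  obtain ⟨w, rfl⟩ := Finset.card_eq_one.1 hR
  have hw : w ∈ ({w} : Finset V) := Finset.mem_singleton_self w
  let p : V → (V → ℝ) →ₗ[ℝ] ℝ := fun u => LinearMap.proj u
  let φ : (V → ℝ) →ₗ[ℝ] (Fin 2 → ℝ) := LinearMap.pi
    ![∑ u ∈ A, p u + p w, ∑ u ∈ B, p u + p w]
  refine (finrank_ker_add_card_ge φ).trans (Nat.add_le_add_right (Submodule.finrank_mono ?_) 2)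
  intro c hc v
  have h1 : ∑ u ∈ A, c u + c w = 0 := by
    simpa [φ, p, LinearMap.sum_apply] using congrFun (LinearMap.mem_ker.1 hc) 0
  have h2 : ∑ u ∈ B, c u + c w = 0 := by
    simpa [φ, p, LinearMap.sum_apply] using congrFun (LinearMap.mem_ker.1 hc) 1
  rcases h.cover v with hv | hv | hv
  · rw [h.sum_adj_left c hv, h.degree_left hv, hR, Finset.sum_singleton]
    push_cast
    linear_combination h1 - c v * ht
  · rw [h.swap.sum_adj_left c hv, h.swap.degree_left hv, hR, Finset.sum_singleton, ← hAB]
    push_cast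
    linear_combination h2 - c v * ht
  · obtain rfl := Finset.mem_singleton.1 hv
    rw [h.sum_eq, Finset.sum_singleton, if_neg G.irrefl,
      Finset.sum_congr (s₁ := A) rfl fun u hu => if_pos (h.adj_left_join u hu v hv).symm,
      Finset.sum_congr (s₁ := B) rfl fun u hu => if_pos (h.adj_right_join u hu v hv).symm,
      h.degree_join_eq hv fun z hz hne => absurd (Finset.mem_singleton.1 hz).symm hne, hR, ← hAB]
    push_cast
    linear_combination h1 + h2 - 2 * c v * ht

/-- A kernel vector supported on two vertices of `A`, one vertex of `B` and one of `R`. -/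
theorem exists_support_left_pair (h : IsJoinSplit G A B R)
    (hV : 5 ≤ Fintype.card V) (hK : Module.finrank ℝ (adjKer G t) = Fintype.card V - 3)
    (ht : t * ((A.card : ℝ) - 1 + R.card) ≠ -1) {x x' y w : V} (hx : x ∈ A) (hx' : x' ∈ A)
    (nxx : x ≠ x') (hy : y ∈ B) (hw : w ∈ R) :
    ∃ α β γ : ℝ, ¬ (α = 0 ∧ β = 0 ∧ γ = 0) ∧
      α + γ = t * ((A.card : ℝ) - 1 + R.card) * α ∧
      γ = t * ((B.card : ℝ) - 1 + R.card) * β ∧ 2 * α + β = t * G.degree w * γ ∧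
      (∀ z ∈ A, z ≠ x → z ≠ x' → 2 * α + γ = 0) ∧ (∀ z ∈ B, z ≠ y → β + γ = 0) ∧
      ∀ z ∈ R, z ≠ w → 2 * α + β + (if G.Adj z w then γ else 0) = 0 := by
  have nxy := h.ne_left_right hx hy
  have nxy' := h.ne_left_right hx' hy
  have nxw := h.ne_left_join hx hw
  have nxw' := h.ne_left_join hx' hw
  have nyw := h.swap.ne_left_join hy hw
  have axx := h.adj_left x hx x' hx' nxx
  have axy := h.not_adj x hx y hy
  have axy' := h.not_adj x' hx' y hy
  have axw := h.adj_left_join x hx w hw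
  have axw' := h.adj_left_join x' hx' w hw
  have ayw := h.adj_right_join y hy w hw
  obtain ⟨α, α', β, γ, hne, he⟩ :=
    exists_mem_adjKer_support_four hV hK nxx nxy nxw nxy' nxw' nyw
  have e1 : α' + γ = t * G.degree x * α := by
    simpa [nxx, nxy, nxw, axx, axy, axw] using he x
  have e2 : α + γ = t * G.degree x' * α' := by
    simpa [nxx.symm, nxy', nxw', axx.symm, axy', axw'] using he x'
  have e3 : γ = t * G.degree y * β := by
    simpa [nxy.symm, nxy'.symm, nyw, G.adj_comm y x, G.adj_comm y x', axy, axy', ayw] using he y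
  have e4 : α + α' + β = t * G.degree w * γ := by
    simpa [nxw.symm, nxw'.symm, nyw.symm, axw.symm, axw'.symm, ayw.symm] using he w
  rw [h.degree_left hx] at e1
  rw [h.degree_left hx'] at e2
  rw [h.swap.degree_left hy] at e3
  have hα : α = α' := by
    have : (t * ((A.card : ℝ) - 1 + R.card) + 1) * (α - α') = 0 := by linear_combination e2 - e1
    refine sub_eq_zero.1 ((mul_eq_zero.1 this).resolve_left fun h0 => ht ?_)
    linarith
  subst hα
  refine ⟨α, β, γ, fun h0 => hne ⟨h0.1, h0.1, h0.2⟩, e1, e3, by linarith, ?_, ?_, ?_⟩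
  · intro z hz n1 n2
    have : α + α + γ = 0 := by
      simpa [n1, n2, h.ne_left_right hz hy, h.ne_left_join hz hw, h.adj_left z hz x hx n1,
        h.adj_left z hz x' hx' n2, h.not_adj z hz y hy, h.adj_left_join z hz w hw] using he z
    linarith
  · intro z hz n1
    simpa [n1, (h.ne_left_right hx hz).symm, (h.ne_left_right hx' hz).symm,
      h.swap.ne_left_join hz hw, G.adj_comm z x, G.adj_comm z x', h.not_adj x hx z hz,
      h.not_adj x' hx' z hz, h.adj_right z hz y hy n1, h.adj_right_join z hz w hw] using he z
  · intro z hz n1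
    have : α + α + β + (if G.Adj z w then γ else 0) = 0 := by
      simpa [n1, (h.ne_left_join hx hz).symm, (h.ne_left_join hx' hz).symm,
        (h.swap.ne_left_join hy hz).symm, (h.adj_left_join x hx z hz).symm,
        (h.adj_left_join x' hx' z hz).symm, (h.adj_right_join y hy z hz).symm] using he z
    linarith

theorem left_twin_eigenvalue (h : IsJoinSplit G A B R)
    (hV : 5 ≤ Fintype.card V) (hK : Module.finrank ℝ (adjKer G t) = Fintype.card V - 3)
    (hA : 2 ≤ A.card) (hB : B.Nonempty) (hR : R.Nonempty) :
    t * ((A.card : ℝ) - 1 + R.card) = -1 := by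
  by_contra ht
  obtain ⟨x, hx, x', hx', nxx⟩ := Finset.one_lt_card.1 hA
  obtain ⟨y, hy⟩ := hB
  have key := fun w (hw : w ∈ R) => h.exists_support_left_pair hV hK ht hx hx' nxx hy hw
  have hr1 : (1 : ℝ) ≤ R.card := by exact_mod_cast Finset.card_pos.2 hR
  have hb1 : (1 : ℝ) ≤ B.card := by exact_mod_cast Finset.card_pos.2 ⟨y, hy⟩
  have hA2 : A.card = 2 := by
    refine le_antisymm (not_lt.1 fun hcon => ?_) hA
    obtain ⟨w, hw⟩ := hR
    obtain ⟨α, β, γ, hne, e1, e2, e3, eA, -, -⟩ := key w hw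
    obtain ⟨z, hz, hzn⟩ := Finset.exists_mem_notMem_of_card_lt_card
      (s := {x, x'}) (t := A) (by rwa [Finset.card_pair nxx])
    simp only [Finset.mem_insert, Finset.mem_singleton, not_or] at hzn
    have e4 := eA z hz hzn.1 hzn.2
    have h0 : (t * ((A.card : ℝ) - 1 + R.card) + 1) * α = 0 := by linear_combination e4 - e1
    have hα : α = 0 := (mul_eq_zero.1 h0).resolve_left fun h1 => ht (by linarith)
    have hγ : γ = 0 := by linarith
    subst hα hγ
    exact hne ⟨rfl, by linarith, rfl⟩
  have hB1 : B.card = 1 := by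
    refine le_antisymm (not_lt.1 fun hcon => ?_) (Finset.card_pos.2 ⟨y, hy⟩)
    obtain ⟨z, hz, hzy⟩ := Finset.exists_mem_ne hcon y
    by_cases htq : t * ((B.card : ℝ) - 1 + R.card) = -1
    · have hBA := h.swap.card_left_eq_card_right hV hK ⟨y, hy⟩ hA hR htq
      rw [hBA] at htq
      exact ht htq
    · obtain ⟨w, hw⟩ := hR
      obtain ⟨α, β, γ, hne, e1, e2, e3, -, eB, -⟩ := key w hw
      have e4 := eB z hz hzy
      have h0 : (t * ((B.card : ℝ) - 1 + R.card) + 1) * β = 0 := by linear_combination e4 - e2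
      have hβ : β = 0 := (mul_eq_zero.1 h0).resolve_left fun h1 => htq (by linarith)
      have hγ : γ = 0 := by linarith
      subst hβ hγ
      exact hne ⟨by linarith, rfl, rfl⟩
  have hadj : ∀ w ∈ R, ∀ z ∈ R, w ≠ z → G.Adj w z ∧ t * G.degree w = -1 := by
    intro w hw z hz hwz
    obtain ⟨α, β, γ, hne, e1, e2, e3, -, -, eR⟩ := key w hw
    have e4 := eR z hz hwz.symm
    have hγ : ¬ (γ = 0 ∧ 2 * α + β = 0) := by
      rintro ⟨rfl, h2⟩
      have hα : α ≠ 0 := by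
        rintro rfl
        exact hne ⟨rfl, by linarith, rfl⟩
      have h3 : t * (((B.card : ℝ) - 1 + R.card) * α) = 0 := by
        linear_combination (t * ((B.card : ℝ) - 1 + R.card) / 2) * h2 + (1 / 2) * e2
      have ht0 : t = 0 := (mul_eq_zero.1 h3).resolve_right
        (mul_ne_zero (by linarith) hα)
      rw [ht0] at e1
      exact hα (by linarith)
    split_ifs at e4 with hzw
    · refine ⟨hzw.symm, ?_⟩
      have h0 : (t * G.degree w + 1) * γ = 0 := by linear_combination e4 - e3
      rcases mul_eq_zero.1 h0 with h1 | h1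
      · linarith
      · exact absurd ⟨h1, by linarith⟩ hγ
    · refine absurd ⟨?_, by linarith⟩ hγ
      have hd : (G.degree w : ℝ) ≠ 0 := by
        have : 0 < G.degree w :=
          (G.degree_pos_iff_exists_adj w).2 ⟨x, (h.adj_left_join x hx w hw).symm⟩
        exact_mod_cast this.ne'
      have h1 : (G.degree w : ℝ) * (t * γ) = 0 := by linear_combination e4 - e3
      have h2 : t * γ = 0 := (mul_eq_zero.1 h1).resolve_left hd
      have h3 : γ * γ = 0 := by
        linear_combination γ * e2 + ((B.card : ℝ) - 1 + R.card) * β * h2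
      exact mul_self_eq_zero.1 h3
  have hRc : 1 < R.card := by
    have := h.card_eq
    omega
  obtain ⟨w, hw, z, hz, hwz⟩ := Finset.one_lt_card.1 hRc
  obtain ⟨α, β, γ, hne, e1, e2, e3, -, -, -⟩ := key w hw
  have htd := (hadj w hw z hz hwz).2
  rw [htd] at e3
  rw [h.degree_join_eq hw fun z hz hwz => (hadj w hw z hz hwz).1] at htd
  rw [hA2] at e1 htd
  rw [hB1] at e2 htd
  push_cast at e1 e2 htd
  generalize (R.card : ℝ) = r at *
  have e1' : (r + 2) * γ = -(2 * r + 3) * α := by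
    linear_combination (r + 2) * e1 + (r + 1) * α * htd
  have e2' : (r + 2) * γ = -r * β := by
    linear_combination (r + 2) * e2 + r * β * htd
  have h0 : (2 * r ^ 2 + 8 * r + 6) * α = 0 := by
    linear_combination r * (r + 2) * e3 - r * e1' + (r + 2) * (e1' - e2')
  have hα : α = 0 := (mul_eq_zero.1 h0).resolve_left (by positivity)
  subst hα
  have hγ : γ = 0 := by
    have : (r + 2) * γ = 0 := by linear_combination e1'
    exact (mul_eq_zero.1 this).resolve_left (by linarith)
  subst hγ
  exact hne ⟨rfl, by linarith, rfl⟩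

theorem card_right_eq_one_and_card_join_eq_one (h : IsJoinSplit G A B R)
    (hV : 5 ≤ Fintype.card V) (hK : Module.finrank ℝ (adjKer G t) = Fintype.card V - 3)
    (hA : 2 ≤ A.card) (hB : B.Nonempty) (hR : R.Nonempty) : B.card = 1 ∧ R.card = 1 := by
  have ht := h.left_twin_eigenvalue hV hK hA hB hR
  have hR0 := Finset.card_pos.2 hR
  have hB0 := Finset.card_pos.2 hB
  rcases Nat.lt_or_ge B.card 2 with hb | hb
  · have := h.card_join_le_one hV hK hB (by omega) ht
    omega
  · have hab := h.card_left_eq_card_right hV hK (Finset.card_pos.1 (by omega)) hb hR ht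
    have hr := h.card_join_le_one hV hK hB hab.ge ht
    have hr1 : R.card = 1 := by omega
    rw [hr1] at ht
    have := h.finrank_adjKer_of_card_eq hab hr1 (t := t) (by push_cast at ht; linarith)
    omega

end IsJoinSplit

end JoinSplit
section Structure

variable {V : Type*} {G : SimpleGraph V}

section

variable [Fintype V]

theorem card_le_indepNum (s : Finset V) (hs : ∀ u ∈ s, ∀ v ∈ s, u ≠ v → ¬ G.Adj u v) :
    s.card ≤ indepNum G :=
  le_csSup ⟨Fintype.card V, fun _ ⟨s, _, hk⟩ => hk ▸ Finset.card_le_univ s⟩ ⟨s, hs, rfl⟩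

theorem exists_card_eq_indepNum (G : SimpleGraph V) :
    ∃ s : Finset V, (∀ u ∈ s, ∀ v ∈ s, u ≠ v → ¬ G.Adj u v) ∧ s.card = indepNum G :=
  Nat.sSup_mem (s := {k | ∃ s : Finset V, (∀ u ∈ s, ∀ v ∈ s, u ≠ v → ¬ G.Adj u v) ∧ s.card = k})
    ⟨0, ∅, by simp⟩ ⟨Fintype.card V, fun _ ⟨s, _, hk⟩ => hk ▸ Finset.card_le_univ s⟩

theorem indepNum_eq_two_iff : indepNum G = 2 ↔
    (∃ x y, x ≠ y ∧ ¬ G.Adj x y) ∧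
      ∀ x y z, x ≠ y → x ≠ z → y ≠ z → G.Adj x y ∨ G.Adj x z ∨ G.Adj y z := by
  classical
  constructor
  · intro h
    obtain ⟨s, hs, hcard⟩ := exists_card_eq_indepNum G
    obtain ⟨x, hx, y, hy, hxy⟩ := Finset.one_lt_card.1 (show 1 < s.card by omega)
    refine ⟨⟨x, y, hxy, hs x hx y hy hxy⟩, fun x y z hxy hxz hyz => ?_⟩
    by_contra! hcon
    obtain ⟨h1, h2, h3⟩ := hcon
    have hle := card_le_indepNum (G := G) {x, y, z} (by
      intro u hu v hv huv
      simp only [Finset.mem_insert, Finset.mem_singleton] at hu hv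
      rcases hu with rfl | rfl | rfl <;> rcases hv with rfl | rfl | rfl <;>
        simp_all [G.adj_comm])
    rw [Finset.card_eq_three.2 ⟨x, y, z, hxy, hxz, hyz, rfl⟩] at hle
    omega
  · rintro ⟨⟨x, y, hxy, hadj⟩, h3⟩
    have hle := card_le_indepNum (G := G) {x, y} (by
      intro u hu v hv huv
      simp only [Finset.mem_insert, Finset.mem_singleton] at hu hv
      rcases hu with rfl | rfl <;> rcases hv with rfl | rfl <;> simp_all [G.adj_comm])
    rw [Finset.card_pair hxy] at hle
    obtain ⟨s, hs, hcard⟩ := exists_card_eq_indepNum G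
    refine le_antisymm (not_lt.1 fun hlt => ?_) hle
    obtain ⟨a, b, c, ha, hb, hc, hab, hac, hbc⟩ := Finset.two_lt_card_iff.1 (hcard ▸ hlt)
    rcases h3 a b c hab hac hbc with h | h | h
    exacts [hs a ha b hb hab h, hs a ha c hc hac h, hs b hb c hc hbc h]

end

theorem isJoinSplit_of_isCograph [Fintype V] [DecidableEq V] [DecidableRel G.Adj]
    (hc : IsCograph G)
    (hind : ∀ x y z, x ≠ y → x ≠ z → y ≠ z → G.Adj x y ∨ G.Adj x z ∨ G.Adj y z)
    {x y : V} (hxy : x ≠ y) (hadj : ¬ G.Adj x y) :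
    IsJoinSplit G {v | v ≠ y ∧ ¬ G.Adj v y} {v | v ≠ x ∧ ¬ G.Adj v x}
      {v | G.Adj v x ∧ G.Adj v y} := by
  have hnot : ∀ x y, x ≠ y → ¬ G.Adj x y → ∀ u v, u ≠ y → ¬ G.Adj u y → v ≠ x → ¬ G.Adj v x →
      ¬ G.Adj u v := by
    intro x y hxy hadj u v huy huy' hvx hvx' huv
    have hux : u ≠ x := fun e => hvx' (e ▸ huv.symm)
    have hvy : v ≠ y := fun e => huy' (e ▸ huv)
    have hxu : G.Adj x u := by
      have := hind x u y hux.symm hxy huy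
      tauto
    have hvy' : G.Adj v y := by
      have := hind x v y hvx.symm hxy hvy
      rw [G.adj_comm x v] at this
      tauto
    exact hc x u v y ⟨hxu, huv, hvy', fun e => hvx' e.symm, hadj, huy'⟩
  have hjoin : ∀ x y, x ≠ y → ¬ G.Adj x y → ∀ u v, u ≠ y → ¬ G.Adj u y → G.Adj v x →
      G.Adj v y → G.Adj u v := by
    intro x y hxy hadj u v huy huy' hvx hvy
    rcases eq_or_ne u x with rfl | hux
    · exact hvx.symm
    · by_contra huv
      have hxu : G.Adj x u := by
        have := hind x u y hux.symm hxy huy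
        tauto
      exact hc y v x u ⟨hvy.symm, hvx, hxu, fun e => hadj e.symm, fun e => huy' e.symm,
        fun e => huv e.symm⟩
  have hclique : ∀ y u v, u ≠ y → ¬ G.Adj u y → v ≠ y → ¬ G.Adj v y → u ≠ v → G.Adj u v := by
    intro y u v huy huy' hvy hvy' huv
    have := hind u v y huv huy hvy
    tauto
  have hadj' : ¬ G.Adj y x := fun e => hadj e.symm
  constructor
  · intro v
    simp only [Finset.mem_filter, Finset.mem_univ, true_and]
    rcases eq_or_ne v x with rfl | hvx
    · tauto
    rcases eq_or_ne v y with rfl | hvy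
    · tauto
    tauto
  · rw [Finset.disjoint_left]
    simp only [Finset.mem_filter, Finset.mem_univ, true_and]
    intro v h1 h2
    have := hind v x y h2.1 h1.1 hxy
    tauto
  · rw [Finset.disjoint_left]
    simp only [Finset.mem_filter, Finset.mem_univ, true_and]
    tauto
  · rw [Finset.disjoint_left]
    simp only [Finset.mem_filter, Finset.mem_univ, true_and]
    tauto
  all_goals
    simp only [Finset.mem_filter, Finset.mem_univ, true_and]
    intro u hu v hv
  · exact hclique y u v hu.1 hu.2 hv.1 hv.2
  · exact hclique x u v hu.1 hu.2 hv.1 hv.2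
  · exact hnot x y hxy hadj u v hu.1 hu.2 hv.1 hv.2
  · exact hjoin x y hxy hadj u v hu.1 hu.2 hv.1 hv.2
  · exact hjoin y x hxy.symm hadj' u v hu.1 hu.2 hv.2 hv.1

theorem IsJoinSplit.join_nonempty {A B R : Finset V} (h : IsJoinSplit G A B R)
    (hconn : G.Connected) {x y : V} (hx : x ∈ A) (hy : y ∈ B) : R.Nonempty := by
  rw [Finset.nonempty_iff_ne_empty]
  rintro rfl
  obtain ⟨p⟩ := hconn.preconnected x y
  obtain ⟨d, -, h1, h2⟩ := p.exists_boundary_dart (A : Set V) hx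
    (fun hy' => Finset.disjoint_left.1 h.disj_left_right hy' hy)
  rcases h.cover d.snd with h3 | h3 | h3
  · exact h2 h3
  · exact h.not_adj _ h1 _ h3 d.adj
  · simp at h3

/-- `G` is a complete graph on the vertices other than `y`, with `y` pendant at `w`. -/
def IsPendantClique (G : SimpleGraph V) (y w : V) : Prop :=
  y ≠ w ∧ ∀ u v, G.Adj u v ↔ u ≠ v ∧ (u = y → v = w) ∧ (v = y → u = w)

theorem IsJoinSplit.isPendantClique {A : Finset V} {y w : V}
    (h : IsJoinSplit G A {y} {w}) : IsPendantClique G y w := by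
  have hyw : G.Adj y w := h.adj_right_join y (by simp) w (by simp)
  have hyA : y ∉ A := fun hy => Finset.disjoint_left.1 h.disj_left_right hy (by simp)
  have hyu : ∀ v, G.Adj y v ↔ v = w := by
    intro v
    refine ⟨fun hv => ?_, fun hv => hv ▸ hyw⟩
    rcases h.cover v with h1 | h1 | h1
    · exact absurd hv.symm (h.not_adj v h1 y (by simp))
    · exact absurd (Finset.mem_singleton.1 h1) hv.ne'
    · exact Finset.mem_singleton.1 h1
  refine ⟨hyw.ne, fun u v => ?_⟩
  rcases eq_or_ne u y with rfl | hu
  · rw [hyu]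
    have := hyw.ne
    constructor
    · rintro rfl
      simp [this, this.symm]
    · exact fun e => e.2.1 rfl
  rcases eq_or_ne v y with rfl | hv
  · rw [G.adj_comm, hyu]
    simp +contextual [hu]
  · simp only [hu, hv, false_imp_iff, and_true]
    refine ⟨fun e => e.ne, fun huv => ?_⟩
    have key : ∀ u, u ≠ y → u ∈ A ∨ u = w := by
      intro u hu
      rcases h.cover u with h1 | h1 | h1
      · exact Or.inl h1
      · exact absurd (Finset.mem_singleton.1 h1) hu
      · exact Or.inr (Finset.mem_singleton.1 h1)
    rcases key u hu with h1 | rfl <;> rcases key v hv with h2 | rfl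
    · exact h.adj_left u h1 v h2 huv
    · exact h.adj_left_join u h1 v (by simp)
    · exact (h.adj_left_join v h2 u (by simp)).symm
    · exact absurd rfl huv

theorem graphG2_isPendantClique (m : ℕ) :
    IsPendantClique (graphG2 m) (Sum.inl ()) (Sum.inr 0) := by
  refine ⟨by simp, ?_⟩
  rintro (⟨⟩ | i) (⟨⟩ | j) <;> simp [graphG2, eq_comm]

theorem IsPendantClique.of_iso {W : Type*} {H : SimpleGraph W} (f : G ≃g H) {y w : W}
    (h : IsPendantClique H y w) : IsPendantClique G (f.symm y) (f.symm w) := by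
  refine ⟨fun e => h.1 (f.symm.injective e), fun u v => ?_⟩
  have e : ∀ u y, u = f.symm y ↔ f u = y := fun u y => by
    exact f.toEquiv.eq_symm_apply
  rw [← f.map_adj_iff, h.2, e, e, e, e, f.injective.ne_iff]

theorem IsPendantClique.nonempty_iso {W : Type*} [Fintype V] [Fintype W] {H : SimpleGraph W}
    {y w : V} {y' w' : W} (h : IsPendantClique G y w) (h' : IsPendantClique H y' w')
    (hcard : Fintype.card V = Fintype.card W) : Nonempty (G ≃g H) := by
  classical
  let e₀ : V ≃ W := Fintype.equivOfCardEq hcard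
  let e₁ : V ≃ W := e₀.trans (Equiv.swap (e₀ y) y')
  have h1 : e₁ y = y' := by simp [e₁]
  let e : V ≃ W := e₁.trans (Equiv.swap (e₁ w) w')
  have hw : e w = w' := by simp [e]
  have hy : e y = y' := by
    have : y' ≠ e₁ w := fun hc => h.1 (e₁.injective (h1.trans hc))
    simp [e, h1, Equiv.swap_apply_of_ne_of_ne this h'.1]
  refine ⟨⟨e, fun {u v} => ?_⟩⟩
  rw [h.2, h'.2, ← hy, ← hw]
  simp only [e.apply_eq_iff_eq, ne_eq]

end Structure
section Spectrum

variable {V : Type*} [Fintype V]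

theorem secondSmallestEig_spec [DecidableEq V] {M : Matrix V V ℝ} (hM : M.IsHermitian)
    (hV : 2 ≤ Fintype.card V) :
    (∃ i, hM.eigenvalues i = secondSmallestEig M) ∧
      (∀ t, secondSmallestEig M < t →
        ∃ i j, i ≠ j ∧ hM.eigenvalues i < t ∧ hM.eigenvalues j < t) ∧
      ∀ t i j, i ≠ j → hM.eigenvalues i ≤ t → hM.eigenvalues j ≤ t →
        secondSmallestEig M ≤ t := by
  have hE : eigMultiset M = Finset.univ.val.map hM.eigenvalues := dif_pos hM
  have hcount : ∀ p : ℝ → Prop, ∀ [DecidablePred p],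
      ((eigMultiset M).sort (· ≤ ·)).countP (fun x => decide (p x)) =
        (Finset.univ.filter fun i => p (hM.eigenvalues i)).card := by
    intro p _
    rw [← Multiset.coe_countP, Multiset.sort_eq, hE, Multiset.countP_map]
    rfl
  have hlen : 2 ≤ ((eigMultiset M).sort (· ≤ ·)).length := by
    rw [Multiset.length_sort, hE, Multiset.card_map]
    exact hV
  have hpw := (eigMultiset M).pairwise_sort (· ≤ ·)
  have hmem : ∀ x ∈ (eigMultiset M).sort (· ≤ ·), ∃ i, hM.eigenvalues i = x := by
    intro x hx
    rw [Multiset.mem_sort, hE, Multiset.mem_map] at hx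
    obtain ⟨i, -, hi⟩ := hx
    exact ⟨i, hi⟩
  unfold secondSmallestEig
  generalize (eigMultiset M).sort (· ≤ ·) = L at *
  match L, hlen with
  | a :: b :: l, _ =>
    simp only [List.pairwise_cons, List.mem_cons, forall_eq_or_imp] at hpw
    obtain ⟨⟨hab, -⟩, hbl, -⟩ := hpw
    simp only [List.getD_cons_succ, List.getD_cons_zero]
    refine ⟨hmem b (by simp), fun t ht => ?_, fun t i j hij hi hj => ?_⟩
    · have h := hcount (fun x => x < t)
      have hlt : 1 < (Finset.univ.filter fun i => hM.eigenvalues i < t).card := by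
        rw [← h, List.countP_cons_of_pos (by simpa using hab.trans_lt ht),
          List.countP_cons_of_pos (by simpa using ht)]
        omega
      obtain ⟨i, hi, j, hj, hij⟩ := Finset.one_lt_card.1 hlt
      exact ⟨i, j, hij, (Finset.mem_filter.1 hi).2, (Finset.mem_filter.1 hj).2⟩
    · by_contra! hlt
      have h := hcount (fun x => x ≤ t)
      have hlt' : 1 < (Finset.univ.filter fun i => hM.eigenvalues i ≤ t).card :=
        Finset.one_lt_card.2 ⟨i, by simpa using hi, j, by simpa using hj, hij⟩
      have h0 : l.countP (fun x => decide (x ≤ t)) = 0 := by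
        rw [List.countP_eq_zero]
        intro x hx
        simpa using hlt.trans_le (hbl x hx)
      rw [List.countP_cons, List.countP_cons_of_neg (by simpa using hlt), h0] at h
      split_ifs at h <;> omega

variable [DecidableEq V] {G : SimpleGraph V} [DecidableRel G.Adj]

theorem normLap_isHermitian (G : SimpleGraph V) [DecidableRel G.Adj] :
    (normLap G).IsHermitian := by
  ext u v
  simp only [normLap, conjTranspose_apply, of_apply, star_trivial, eq_comm (a := u) (b := v),
    G.adj_comm u v, mul_comm (G.degree u : ℝ)]

theorem exists_eigenvalue_eq (hd : ∀ v, 0 < G.degree v) {μ : ℝ} {c : V → ℝ} (hc0 : c ≠ 0)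
    (hc : c ∈ adjKer G (1 - μ)) : ∃ i, (normLap_isHermitian G).eigenvalues i = μ := by
  have hs : ∀ u, √(G.degree u : ℝ) ≠ 0 :=
    fun u => (Real.sqrt_pos.2 (by exact_mod_cast hd u)).ne'
  have hmem : μ ∈ spectrum ℝ (normLap G) := by
    have hdet : (normLap G - μ • (1 : Matrix V V ℝ)).det = 0 := by
      rw [← exists_mulVec_eq_zero_iff]
      refine ⟨_, fun h0 => hc0 (funext fun u => ?_), (mem_adjKer_iff_mulVec_eq_zero G hd μ c).1 hc⟩
      exact (mul_eq_zero.1 (congrFun h0 u)).resolve_left (hs u)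
    rw [spectrum.mem_iff, ← IsUnit.neg_iff, neg_sub, Algebra.algebraMap_eq_smul_one,
      isUnit_iff_isUnit_det, hdet]
    simp
  rwa [(normLap_isHermitian G).spectrum_real_eq_range_eigenvalues] at hmem

/-- The eigenvectors of the normalized Laplacian, rescaled to solutions of `A c = t D c`. -/
theorem exists_adjKer_basis (hd : ∀ v, 0 < G.degree v) :
    ∃ c : V → V → ℝ, (∀ i, c i ≠ 0) ∧
      (∀ i, c i ∈ adjKer G (1 - (normLap_isHermitian G).eigenvalues i)) ∧
      ∀ i j, i ≠ j → ∑ u, (G.degree u : ℝ) * c i u * c j u = 0 := by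
  have hs : ∀ u, √(G.degree u : ℝ) ≠ 0 :=
    fun u => (Real.sqrt_pos.2 (by exact_mod_cast hd u)).ne'
  let b := (normLap_isHermitian G).eigenvectorBasis
  refine ⟨fun i u => b i u / √(G.degree u : ℝ), fun i h0 => ?_, fun i => ?_, fun i j hij => ?_⟩
  · refine b.orthonormal.ne_zero i ?_
    ext u
    have := congrFun h0 u
    simpa [hs u] using this
  · rw [mem_adjKer_iff_mulVec_eq_zero G hd]
    have : (fun u => √(G.degree u : ℝ) * (b i u / √(G.degree u : ℝ))) = ⇑(b i) :=
      funext fun u => mul_div_cancel₀ _ (hs u)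
    rw [this, sub_mulVec, (normLap_isHermitian G).mulVec_eigenvectorBasis i, smul_mulVec,
      one_mulVec, sub_self]
  · have h := b.orthonormal.2 hij
    simp only [PiLp.inner_apply, RCLike.inner_apply, conj_trivial] at h
    rw [← h]
    refine Finset.sum_congr rfl fun u _ => ?_
    have h2 : √(G.degree u : ℝ) * √(G.degree u : ℝ) = G.degree u :=
      Real.mul_self_sqrt (Nat.cast_nonneg _)
    rw [← h2]
    have := hs u
    field_simp

omit [DecidableEq V] in
theorem sum_mul_sum_adj_nonpos
    (hm : ∀ u v v', u ≠ v → ¬ G.Adj u v → u ≠ v' → ¬ G.Adj u v' → v = v')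
    {c : V → ℝ} (hc : ∑ u, c u = 0) :
    ∑ u, c u * ∑ v, (if G.Adj u v then c v else 0) ≤ 0 := by
  classical
  have hsplit : ∀ u, ∑ v, (if G.Adj u v then c v else 0) =
      -(c u + ∑ v, (if u ≠ v ∧ ¬ G.Adj u v then c v else 0)) := by
    intro u
    have : ∑ v, c v = ∑ v, (if G.Adj u v then c v else 0) + ∑ v, (if u = v then c v else 0) +
        ∑ v, (if u ≠ v ∧ ¬ G.Adj u v then c v else 0) := by
      rw [← Finset.sum_add_distrib, ← Finset.sum_add_distrib]
      refine Finset.sum_congr rfl fun v _ => ?_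
      rcases eq_or_ne u v with rfl | huv
      · simp
      · by_cases h : G.Adj u v <;> simp [h, huv]
    rw [hc, Finset.sum_ite_eq, if_pos (Finset.mem_univ u)] at this
    linarith
  have hcount : ∀ u, ∑ v, (if u ≠ v ∧ ¬ G.Adj u v then c u ^ 2 else 0) ≤ c u ^ 2 := by
    intro u
    rw [← Finset.sum_filter, Finset.sum_const, nsmul_eq_mul]
    have h1 : (Finset.univ.filter fun v => u ≠ v ∧ ¬ G.Adj u v).card ≤ 1 := by
      refine Finset.card_le_one.2 fun v hv v' hv' => ?_
      simp only [Finset.mem_filter, Finset.mem_univ, true_and] at hv hv'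
      exact hm u v v' hv.1 hv.2 hv'.1 hv'.2
    have h2 : ((Finset.univ.filter fun v => u ≠ v ∧ ¬ G.Adj u v).card : ℝ) ≤ 1 := by
      exact_mod_cast h1
    nlinarith [sq_nonneg (c u)]
  have hsymm : ∑ u, ∑ v, (if u ≠ v ∧ ¬ G.Adj u v then c v ^ 2 else 0) =
      ∑ u, ∑ v, (if u ≠ v ∧ ¬ G.Adj u v then c u ^ 2 else 0) := by
    rw [Finset.sum_comm]
    simp only [ne_comm, G.adj_comm]
  have hkey : ∑ u, c u ^ 2 + ∑ u, ∑ v, (if u ≠ v ∧ ¬ G.Adj u v then c u * c v else 0) ≥ 0 := by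
    have h1 := Finset.sum_le_sum fun u (_ : u ∈ Finset.univ) => hcount u
    have h2 : ∑ u, ∑ v, (if u ≠ v ∧ ¬ G.Adj u v then c u ^ 2 else 0) +
        ∑ u, ∑ v, (if u ≠ v ∧ ¬ G.Adj u v then c v ^ 2 else 0) +
        2 * ∑ u, ∑ v, (if u ≠ v ∧ ¬ G.Adj u v then c u * c v else 0) ≥ 0 := by
      simp only [Finset.mul_sum, ← Finset.sum_add_distrib]
      refine Finset.sum_nonneg fun u _ => Finset.sum_nonneg fun v _ => ?_
      split_ifs
      · nlinarith [sq_nonneg (c u + c v)]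
      · simp
    rw [hsymm] at h2
    linarith
  have heq : ∑ u, c u * ∑ v, (if G.Adj u v then c v else 0) =
      -(∑ u, c u ^ 2 + ∑ u, ∑ v, (if u ≠ v ∧ ¬ G.Adj u v then c u * c v else 0)) := by
    rw [← Finset.sum_add_distrib, ← Finset.sum_neg_distrib]
    refine Finset.sum_congr rfl fun u _ => ?_
    rw [hsplit, mul_neg, mul_add, Finset.mul_sum, sq]
    simp only [mul_ite, mul_zero]
  linarith

omit [DecidableEq V] in
theorem not_two_pos_adjKer (hd : ∀ v, 0 < G.degree v)
    (hm : ∀ u v v', u ≠ v → ¬ G.Adj u v → u ≠ v' → ¬ G.Adj u v' → v = v')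
    {s t : ℝ} (hs : 0 < s) (ht : 0 < t) {c e : V → ℝ} (hc : c ∈ adjKer G s) (he : e ∈ adjKer G t)
    (hc0 : c ≠ 0) (he0 : e ≠ 0) (hce : ∑ u, (G.degree u : ℝ) * c u * e u = 0) : False := by
  have hW : ∀ c : V → ℝ, c ≠ 0 → 0 < ∑ u, (G.degree u : ℝ) * c u * c u := by
    intro c hc0
    obtain ⟨u, hu⟩ := Function.ne_iff.1 hc0
    have hnn : ∀ v, 0 ≤ (G.degree v : ℝ) * c v * c v := fun v => by
      rw [mul_assoc]
      exact mul_nonneg (Nat.cast_nonneg _) (mul_self_nonneg _)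
    refine Finset.sum_pos' (fun v _ => hnn v) ⟨u, Finset.mem_univ u, ?_⟩
    rw [mul_assoc]
    exact mul_pos (by exact_mod_cast hd u) (mul_self_pos.2 hu)
  have hQ : ∀ x y : ℝ, x * ∑ u, c u + y * ∑ u, e u = 0 →
      x ^ 2 * s * (∑ u, (G.degree u : ℝ) * c u * c u) +
        y ^ 2 * t * (∑ u, (G.degree u : ℝ) * e u * e u) ≤ 0 := by
    intro x y hxy
    have h0 : ∑ u, (x • c + y • e) u = 0 := by
      rw [← hxy, Finset.mul_sum, Finset.mul_sum, ← Finset.sum_add_distrib]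
      simp
    refine le_of_eq_of_le ?_ (sum_mul_sum_adj_nonpos hm h0)
    have hrow : ∀ u, ∑ v, (if G.Adj u v then (x • c + y • e) v else 0) =
        x * (s * G.degree u * c u) + y * (t * G.degree u * e u) := by
      intro u
      rw [← hc u, ← he u, Finset.mul_sum, Finset.mul_sum, ← Finset.sum_add_distrib]
      refine Finset.sum_congr rfl fun v _ => ?_
      split_ifs <;> simp
    have hsum : ∑ u, (x • c + y • e) u * ∑ v, (if G.Adj u v then (x • c + y • e) v else 0) =
        x ^ 2 * s * ∑ u, (G.degree u : ℝ) * c u * c u +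
          y ^ 2 * t * ∑ u, (G.degree u : ℝ) * e u * e u +
          x * y * (s + t) * ∑ u, (G.degree u : ℝ) * c u * e u := by
      simp only [hrow, Finset.mul_sum, ← Finset.sum_add_distrib]
      refine Finset.sum_congr rfl fun u _ => ?_
      simp only [Pi.add_apply, Pi.smul_apply, smul_eq_mul]
      ring
    rw [hsum, hce]
    ring
  have hWc := hW c hc0
  have hWe := hW e he0
  by_cases hsum : ∑ u, c u = 0
  · have h1 := hQ 1 0 (by simp [hsum])
    have : 0 < s * ∑ u, (G.degree u : ℝ) * c u * c u := mul_pos hs hWc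
    linarith
  · have h1 := hQ (∑ u, e u) (-∑ u, c u) (by ring)
    have h2 : 0 < (-∑ u, c u) ^ 2 * t * ∑ u, (G.degree u : ℝ) * e u * e u := by
      have : -∑ u, c u ≠ 0 := neg_ne_zero.2 hsum
      positivity
    have h3 : 0 ≤ (∑ u, e u) ^ 2 * s * ∑ u, (G.degree u : ℝ) * c u * c u := by positivity
    linarith

theorem secondSmallestEig_eq_one (hV : 2 ≤ Fintype.card V) (hd : ∀ v, 0 < G.degree v)
    (hm : ∀ u v v', u ≠ v → ¬ G.Adj u v → u ≠ v' → ¬ G.Adj u v' → v = v')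
    {x y : V} (hxy : x ≠ y) (hadj : ¬ G.Adj x y) : secondSmallestEig (normLap G) = 1 := by
  obtain ⟨-, hlt, hle⟩ := secondSmallestEig_spec (normLap_isHermitian G) hV
  refine le_antisymm ?_ (not_lt.1 fun h1 => ?_)
  · obtain ⟨i, hi⟩ := exists_eigenvalue_eq (G := G) hd (μ := 0) (c := fun _ => 1)
      (fun h0 => one_ne_zero (congrFun h0 x)) (fun v => by
        simp [← G.card_neighborFinset_eq_degree, G.neighborFinset_eq_filter])
    obtain ⟨j, hj⟩ := exists_eigenvalue_eq (G := G) hd (μ := 1)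
      (c := Pi.single x 1 - Pi.single y 1)
      (fun h0 => by simpa [hxy] using congrFun h0 x) (fun v => by
        have hxv : G.Adj v x ↔ G.Adj v y := by
          rcases eq_or_ne v x with rfl | hvx
          · simp [hadj]
          rcases eq_or_ne v y with rfl | hvy
          · simp [G.adj_comm, hadj]
          constructor
          · intro h
            by_contra h'
            exact hvx (hm y v x hvy.symm (fun e => h' e.symm) hxy.symm (fun e => hadj e.symm))
          · intro h
            by_contra h'
            exact hvy (hm x v y hvx.symm (fun e => h' e.symm) hxy hadj)
        have hterm : ∀ u, (if G.Adj v u then (Pi.single x 1 - Pi.single y 1 : V → ℝ) u else 0) =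
            (if u = x then (if G.Adj v x then 1 else 0) else 0) -
              (if u = y then (if G.Adj v y then 1 else 0) else 0) := by
          intro u
          simp only [Pi.sub_apply, Pi.single_apply]
          split_ifs <;> simp_all
        refine (Finset.sum_congr rfl fun u _ => hterm u).trans ?_
        simp [hxv])
    refine hle 1 i j ?_ (by linarith) hj.le
    rintro rfl
    linarith
  · obtain ⟨i, j, hij, hi, hj⟩ := hlt 1 h1
    obtain ⟨c, hc0, hc, horth⟩ := exists_adjKer_basis (G := G) hd
    exact not_two_pos_adjKer hd hm (sub_pos.2 hi) (sub_pos.2 hj) (hc i) (hc j) (hc0 i) (hc0 j)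
      (horth i j hij)

end Spectrum

section PendantClique

variable {V : Type*} [Fintype V] {G : SimpleGraph V} {y w : V}

theorem exists_ne_and_ne (hV : 3 ≤ Fintype.card V) (y w : V) : ∃ z, z ≠ y ∧ z ≠ w := by
  classical
  by_contra! hall
  have h1 : Finset.univ ⊆ ({y, w} : Finset V) := fun z _ => by
    rw [Finset.mem_insert, Finset.mem_singleton]
    exact or_iff_not_imp_left.2 (hall z)
  have h2 := Finset.card_le_card h1
  have h3 := Finset.card_le_two (a := y) (b := w)
  rw [Finset.card_univ] at h2
  omega

omit [Fintype V] in
theorem IsPendantClique.isCograph (h : IsPendantClique G y w) : IsCograph G := by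
  obtain ⟨hyw, h⟩ := h
  rintro a b c d ⟨h1, h2, h3, h4, h5, h6⟩
  rw [h] at *
  grind

theorem IsPendantClique.indepNum_eq_two (h : IsPendantClique G y w) (hV : 3 ≤ Fintype.card V) :
    indepNum G = 2 := by
  classical
  obtain ⟨hyw, h⟩ := h
  rw [indepNum_eq_two_iff]
  obtain ⟨z, hz⟩ := exists_ne_and_ne (by omega : 3 ≤ Fintype.card V) y w
  refine ⟨⟨y, z, Ne.symm hz.1, ?_⟩, fun a b c hab hac hbc => ?_⟩
  · rw [h]
    exact fun h' => hz.2 (h'.2.1 rfl)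
  · simp only [h]
    grind

variable [DecidableRel G.Adj]

theorem IsPendantClique.sum_adj [DecidableEq V] (h : IsPendantClique G y w) (c : V → ℝ) (v : V) :
    ∑ u, (if G.Adj v u then c u else 0) =
      if v = y then c w else if v = w then ∑ u, c u - c w else ∑ u, c u - c y - c v := by
  obtain ⟨hyw, h⟩ := h
  split_ifs with hvy hvw
  · subst hvy
    have : ∀ u, (if G.Adj v u then c u else 0) = if u = w then c u else 0 := fun u =>
      if_congr (by rw [h]; grind) rfl rfl
    simp [this]
  · subst hvw
    have : ∀ u, (if G.Adj v u then c u else 0) = c u - if u = v then c u else 0 := fun u => by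
      have : G.Adj v u ↔ u ≠ v := by rw [h]; grind
      by_cases huv : u = v <;> simp [this, huv]
    simp [this]
  · have : ∀ u, (if G.Adj v u then c u else 0) =
        c u - (if u = y then c u else 0) - if u = v then c u else 0 := fun u => by
      have : G.Adj v u ↔ u ≠ v ∧ u ≠ y := by rw [h]; grind
      by_cases huv : u = v
      · simp [huv, hvy]
      · by_cases huy : u = y
        · rw [if_neg fun h' => (this.1 h').2 huy, if_pos huy, if_neg huv]
          ring
        · simp [this, huv, huy]
    simp [this]

theorem IsPendantClique.degree_eq [DecidableEq V] (h : IsPendantClique G y w) (v : V) :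
    (G.degree v : ℝ) =
      if v = y then 1 else if v = w then (Fintype.card V : ℝ) - 1 else Fintype.card V - 2 := by
  have := h.sum_adj (fun _ => (1 : ℝ)) v
  rw [Finset.sum_boole, ← G.neighborFinset_eq_filter, G.card_neighborFinset_eq_degree] at this
  rw [this]
  simp only [Finset.sum_const, Finset.card_univ, nsmul_eq_mul, mul_one]
  split_ifs <;> ring

theorem IsPendantClique.adjKer_zero_eq_bot (h : IsPendantClique G y w)
    (hV : 4 ≤ Fintype.card V) : adjKer G 0 = ⊥ := by
  classical
  rw [eq_bot_iff]
  intro c hc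
  rw [mem_adjKer] at hc
  simp only [h.sum_adj, zero_mul] at hc
  have hwy : w ≠ y := h.1.symm
  have hw : c w = 0 := by simpa using hc y
  have hSw : ∑ u, c u = 0 := by simpa [hwy, hw] using hc w
  have hother : ∀ v, v ≠ y → v ≠ w → c v = -c y := by
    intro v hvy hvw
    have := hc v
    rw [if_neg hvy, if_neg hvw, hSw] at this
    linarith
  have hsum : ∑ u, c u = c y + c w - (Fintype.card V - 2) * c y := by
    have : ∀ u, c u = (if u = y then 2 * c y else 0) + (if u = w then c w + c y else 0) - c y := by
      intro u
      by_cases huy : u = y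
      · subst huy
        simp only [if_pos, if_neg h.1]
        ring
      · by_cases huw : u = w
        · subst huw
          simp [hwy]
        · simp [huy, huw, hother u huy huw]
    rw [Finset.sum_congr rfl fun u _ => this u]
    simp only [Finset.sum_sub_distrib, Finset.sum_add_distrib, Finset.sum_ite_eq', Finset.mem_univ,
      if_true, Finset.sum_const, Finset.card_univ, nsmul_eq_mul]
    ring
  have hV' : (4 : ℝ) ≤ Fintype.card V := by exact_mod_cast hV
  have hy : c y = 0 := by
    rw [hsum, hw] at hSw
    have : (Fintype.card V - 3 : ℝ) * c y = 0 := by linarith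
    exact (mul_eq_zero.1 this).resolve_left (by linarith)
  rw [Submodule.mem_bot]
  ext v
  by_cases hvy : v = y
  · rw [hvy, hy, Pi.zero_apply]
  · by_cases hvw : v = w
    · rw [hvw, hw, Pi.zero_apply]
    · rw [hother v hvy hvw, hy, neg_zero, Pi.zero_apply]

theorem IsPendantClique.mem_adjKer_iff (h : IsPendantClique G y w) (hV : 4 ≤ Fintype.card V)
    (c : V → ℝ) : c ∈ adjKer G (-1 / (Fintype.card V - 2)) ↔
      c y = 0 ∧ c w = 0 ∧ ∑ u, c u = 0 := by
  classical
  have hV' : (4 : ℝ) ≤ Fintype.card V := by exact_mod_cast hV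
  have hm : (Fintype.card V - 2 : ℝ) ≠ 0 := by linarith
  have hwy : w ≠ y := h.1.symm
  rw [mem_adjKer]
  simp only [h.sum_adj, h.degree_eq]
  constructor
  · intro hc
    obtain ⟨z, hz⟩ := exists_ne_and_ne (by omega : 3 ≤ Fintype.card V) y w
    have h1 := hc y
    have h2 := hc w
    have h3 := hc z
    rw [if_pos rfl, if_pos rfl] at h1
    rw [if_neg hwy, if_pos rfl, if_neg hwy, if_pos rfl] at h2
    rw [if_neg hz.1, if_neg hz.2, if_neg hz.1, if_neg hz.2, div_mul_cancel₀ _ hm] at h3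
    have hS : ∑ u, c u = c y := by linarith
    rw [hS] at h2
    generalize (Fintype.card V : ℝ) = N at *
    have hyN : c y = -(N - 2) * c w := by
      rw [h1]
      field_simp
    have h4 : ((N - 2) ^ 2 - 1) * c w = 0 := by
      rw [hyN] at h2
      field_simp at h2
      linear_combination -h2
    have hw0 : c w = 0 := (mul_eq_zero.1 h4).resolve_left (by nlinarith)
    have hy0 : c y = 0 := by rw [hyN, hw0, mul_zero]
    exact ⟨hy0, hw0, hS.trans hy0⟩
  · rintro ⟨hy, hw, hS⟩ v
    split_ifs with hvy hvw
    · rw [hvy, hy, hw, mul_zero]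
    · rw [hvw, hw, hS, mul_zero, sub_zero]
    · rw [hS, hy, div_mul_cancel₀ _ hm]
      ring

theorem IsPendantClique.finrank_adjKer (h : IsPendantClique G y w) (hV : 4 ≤ Fintype.card V) :
    Module.finrank ℝ (adjKer G (-1 / (Fintype.card V - 2))) = Fintype.card V - 3 := by
  classical
  let φ : (V → ℝ) →ₗ[ℝ] (Fin 3 → ℝ) :=
    LinearMap.pi ![LinearMap.proj y, LinearMap.proj w, ∑ u, LinearMap.proj u]
  have hφ : ∀ c, φ c = ![c y, c w, ∑ u, c u] := by
    intro c
    ext i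
    fin_cases i <;> simp [φ]
  have hker : adjKer G (-1 / (Fintype.card V - 2)) = LinearMap.ker φ := by
    ext c
    rw [h.mem_adjKer_iff hV, LinearMap.mem_ker, hφ]
    simp
  have hsurj : Function.Surjective φ := by
    obtain ⟨z, hz⟩ := exists_ne_and_ne (by omega : 3 ≤ Fintype.card V) y w
    intro b
    refine ⟨Pi.single y (b 0) + Pi.single w (b 1) + Pi.single z (b 2 - b 0 - b 1), ?_⟩
    rw [hφ]
    ext i
    fin_cases i
    · simp [Pi.single_apply, h.1, Ne.symm hz.1]
    · simp [Pi.single_apply, h.1.symm, Ne.symm hz.2]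
    · simp [Finset.sum_add_distrib]
  have := φ.finrank_range_add_finrank_ker
  rw [LinearMap.range_eq_top.2 hsurj, finrank_top, Module.finrank_fin_fun, Module.finrank_pi] at this
  rw [hker]
  omega

theorem IsPendantClique.memG1Family [DecidableEq V] (h : IsPendantClique G y w)
    (hconn : G.Connected) (hV : 4 ≤ Fintype.card V) : memG1Family G (Fintype.card V) := by
  have : Nontrivial V := ⟨y, w, h.1⟩
  have hd : ∀ v, 0 < G.degree v :=
    fun v => hconn.preconnected.degree_pos_of_nontrivial v
  refine ⟨hconn, rfl, ⟨1 - -1 / (Fintype.card V - 2), ?_⟩, fun h1 => ?_,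
    h.indepNum_eq_two (by omega)⟩
  · rw [eigMult_normLap G hd, sub_sub_cancel, h.finrank_adjKer hV]
  · obtain ⟨⟨i, hi⟩, -⟩ := secondSmallestEig_spec (normLap_isHermitian G) (by omega)
    obtain ⟨c, hc0, hc, -⟩ := exists_adjKer_basis (G := G) hd
    have hci := hc i
    rw [hi, h1, sub_self, h.adjKer_zero_eq_bot hV, Submodule.mem_bot] at hci
    exact hc0 i hci

theorem exists_isPendantClique_of_memG1Family [DecidableEq V] {n : ℕ} (hn : 5 ≤ n)
    (h : _root_.memG1Family G n) (hc : IsCograph G) : ∃ y w, IsPendantClique G y w := by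
  obtain ⟨hconn, rfl, ⟨θ, hθ⟩, hρ, hν⟩ := h
  have : Nontrivial V := Fintype.one_lt_card_iff_nontrivial.1 (by omega)
  have hd : ∀ v, 0 < G.degree v :=
    fun v => hconn.preconnected.degree_pos_of_nontrivial v
  rw [eigMult_normLap G hd] at hθ
  obtain ⟨⟨x, y, hxy, hadj⟩, hind⟩ := indepNum_eq_two_iff.1 hν
  by_cases hm : ∀ u v v', u ≠ v → ¬ G.Adj u v → u ≠ v' → ¬ G.Adj u v' → v = v'
  · exact absurd (secondSmallestEig_eq_one (by omega) hd hm hxy hadj) hρ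
  push Not at hm
  obtain ⟨u, v, v', huv, hav, huv', hav', hvv⟩ := hm
  have hJ := isJoinSplit_of_isCograph hc hind (x := v) (y := u) huv.symm (fun h => hav h.symm)
  have hv : v ∈ Finset.univ.filter fun z => z ≠ u ∧ ¬ G.Adj z u := by
    simpa using ⟨huv.symm, fun h => hav h.symm⟩
  have hv' : v' ∈ Finset.univ.filter fun z => z ≠ u ∧ ¬ G.Adj z u := by
    simpa using ⟨huv'.symm, fun h => hav' h.symm⟩
  have hu : u ∈ Finset.univ.filter fun z => z ≠ v ∧ ¬ G.Adj z v := by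
    simpa using ⟨huv, hav⟩
  obtain ⟨hB, hR⟩ := hJ.card_right_eq_one_and_card_join_eq_one hn hθ
    (Finset.one_lt_card.2 ⟨v, hv, v', hv', hvv⟩) ⟨u, hu⟩ (hJ.join_nonempty hconn hv hu)
  obtain ⟨b, hb⟩ := Finset.card_eq_one.1 hB
  obtain ⟨w, hw⟩ := Finset.card_eq_one.1 hR
  rw [hb, hw] at hJ
  exact ⟨b, w, hJ.isPendantClique⟩

end PendantClique

theorem statement1 {V : Type*} [Fintype V] [DecidableEq V] (n : ℕ) (hn : 5 ≤ n)
    (G : SimpleGraph V) [DecidableRel G.Adj]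
    (hcard : Fintype.card V = n) (hconn : G.Connected) :
    (memG1Family G n ∧ IsCograph G) ↔ Nonempty (G ≃g graphG2 (n - 2)) := by
  have hcard' : Fintype.card V = Fintype.card (Unit ⊕ Fin (n - 2 + 1)) := by
    simp
    omega
  constructor
  · rintro ⟨h, hc⟩
    obtain ⟨y, w, hp⟩ := exists_isPendantClique_of_memG1Family hn h hc
    exact hp.nonempty_iso (graphG2_isPendantClique _) hcard'
  · rintro ⟨f⟩
    have hp := IsPendantClique.of_iso f (graphG2_isPendantClique _)
    refine ⟨?_, hp.isCograph⟩
    rw [← hcard]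
    exact hp.memG1Family hconn (by omega)
end

section
/- Let G ∈ 𝒢₁(n, n−3) with n ≥ 5, and let v₁v₂v₃v₄ be an induced path P₄ in G. If u₁ is a vertex such that u₁v₂v₃v₄ is also an induced path P₄ in G, then d_{u₁} = d_{v₁} (the degrees of u₁ and v₁ in G are equal). -/
open Matrix

/-- A square submatrix on more indices than the rank has vanishing determinant. -/
theorem Matrix.det_submatrix_eq_zero_of_rank_lt {m ι K : Type*} [Fintype m] [Fintype ι]
    [DecidableEq ι] [Field K] (M : Matrix m m K) (f g : ι → m)
    (h : M.rank < Fintype.card ι) : (M.submatrix f g).det = 0 := by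
  by_contra hdet
  have hrank : (M.submatrix f g).rank = Fintype.card ι :=
    rank_of_isUnit _ ((isUnit_iff_isUnit_det _).2 (isUnit_iff_ne_zero.2 hdet))
  have := M.rank_submatrix_le f g
  omega

theorem rank_add_eigMult {V : Type*} [Fintype V] [DecidableEq V] (M : Matrix V V ℝ) (μ : ℝ) :
    (M - μ • (1 : Matrix V V ℝ)).rank + eigMult M μ = Fintype.card V := by
  have h := LinearMap.finrank_range_add_finrank_ker (M - μ • (1 : Matrix V V ℝ)).mulVecLin
  rwa [Module.finrank_fintype_fun_eq_card] at h

theorem det_tridiagonal_four {R : Type*} [CommRing R] (t x y z : R) :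
    (!![t, x, 0, 0; x, t, y, 0; 0, y, t, z; 0, 0, z, t] : Matrix (Fin 4) (Fin 4) R).det =
      t ^ 4 - t ^ 2 * (x ^ 2 + y ^ 2 + z ^ 2) + x ^ 2 * z ^ 2 := by
  simp [det_succ_row_zero, Fin.sum_univ_succ, Fin.succAbove]
  ring

theorem IsInducedP4.pairwise_ne {V : Type*} {G : SimpleGraph V} {a b c d : V}
    (h : IsInducedP4 G a b c d) : a ≠ b ∧ a ≠ c ∧ a ≠ d ∧ b ≠ c ∧ b ≠ d ∧ c ≠ d := by
  obtain ⟨hab, hbc, hcd, hac, had, hbd⟩ := h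
  refine ⟨hab.ne, ?_, ?_, hbc.ne, ?_, hcd.ne⟩
  · rintro rfl; exact had hcd
  · rintro rfl; exact hac hcd.symm
  · rintro rfl; exact had hab

/-- If `normLap G - θ` has rank less than four, the principal minor on an induced `P₄` vanishes;
the minor is stated with the denominators cleared. -/
theorem IsInducedP4.minor_eq_zero {V : Type*} [Fintype V] [DecidableEq V] {G : SimpleGraph V}
    [DecidableRel G.Adj] {a b c d : V} (h : IsInducedP4 G a b c d) {θ : ℝ}
    (hrank : (normLap G - θ • (1 : Matrix V V ℝ)).rank < 4) :
    (1 - θ) ^ 4 * (G.degree a * G.degree b * G.degree c * G.degree d)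
      - (1 - θ) ^ 2 * (G.degree c * G.degree d + G.degree a * G.degree d
        + G.degree a * G.degree b) + 1 = 0 := by
  have hdet := det_submatrix_eq_zero_of_rank_lt _ ![a, b, c, d] ![a, b, c, d]
    (by simpa using hrank)
  obtain ⟨hab, hac, had, hbc, hbd, hcd⟩ := h.pairwise_ne
  obtain ⟨eab, ebc, ecd, nac, nad, nbd⟩ := h
  have pos {u v : V} (huv : G.Adj u v) : (0 : ℝ) < G.degree u :=
    Nat.cast_pos.2 ((G.degree_pos_iff_exists_adj u).2 ⟨v, huv⟩)
  have pa := pos eab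
  have pb := pos ebc
  have pc := pos ecd
  have pd := pos ecd.symm
  have hsub : (normLap G - θ • (1 : Matrix V V ℝ)).submatrix ![a, b, c, d] ![a, b, c, d] =
      !![1 - θ, -1 / √((G.degree a : ℝ) * G.degree b), 0, 0;
        -1 / √((G.degree a : ℝ) * G.degree b), 1 - θ, -1 / √((G.degree b : ℝ) * G.degree c), 0;
        0, -1 / √((G.degree b : ℝ) * G.degree c), 1 - θ, -1 / √((G.degree c : ℝ) * G.degree d);
        0, 0, -1 / √((G.degree c : ℝ) * G.degree d), 1 - θ] := by
    ext i j
    fin_cases i <;> fin_cases j <;>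
      simp [normLap, one_apply, hab, hac, had, hbc, hbd, hcd, hab.symm, hac.symm, had.symm,
        hbc.symm, hbd.symm, hcd.symm, eab, ebc, ecd, nac, nad, nbd, eab.symm, ebc.symm, ecd.symm,
        G.adj_comm c a, G.adj_comm d a, G.adj_comm d b, mul_comm]
  rw [hsub, det_tridiagonal_four] at hdet
  simp only [div_pow, Real.sq_sqrt (mul_pos pa pb).le, Real.sq_sqrt (mul_pos pb pc).le,
    Real.sq_sqrt (mul_pos pc pd).le] at hdet
  field_simp at hdet
  linear_combination hdet

theorem statement2 {V : Type*} [Fintype V] [DecidableEq V] (n : ℕ) (hn : 5 ≤ n)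
    (G : SimpleGraph V) [DecidableRel G.Adj] (hG : memG1Family G n)
    (v1 v2 v3 v4 u1 : V)
    (hP : IsInducedP4 G v1 v2 v3 v4) (hP' : IsInducedP4 G u1 v2 v3 v4) :
    G.degree u1 = G.degree v1 := by
  obtain ⟨-, hcard, ⟨θ, hθ⟩, -, -⟩ := hG
  have hrank : (normLap G - θ • (1 : Matrix V V ℝ)).rank < 4 := by
    have := rank_add_eigMult (normLap G) θ
    omega
  have h := hP.minor_eq_zero hrank
  have h' := hP'.minor_eq_zero hrank
  have ht : 1 - θ ≠ 0 := by
    intro h0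
    simp [h0] at h
  have hd : (G.degree v4 : ℝ) ≠ 0 :=
    Nat.cast_ne_zero.2 ((G.degree_pos_iff_exists_adj v4).2 ⟨v3, hP.2.2.1.symm⟩).ne'
  generalize 1 - θ = t at h h' ht
  by_contra hne
  have hsub : (G.degree u1 : ℝ) - G.degree v1 ≠ 0 := sub_ne_zero.2 (Nat.cast_injective.ne hne)
  have hz : t ^ 2 * (G.degree v2 * G.degree v3 * G.degree v4)
      - (G.degree v2 + G.degree v4) = (0 : ℝ) := by
    refine (mul_eq_zero.1 ?_).resolve_left (mul_ne_zero hsub (pow_ne_zero 2 ht))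
    linear_combination h' - h
  have hone : t ^ 2 * (G.degree v3 * G.degree v4) = (1 : ℝ) := by
    linear_combination t ^ 2 * G.degree v1 * hz - h
  exact hd (by linear_combination G.degree v2 * hone - hz)
end

section
/- Let n ≥ 5 and let G₁ be the graph on n vertices described below, with a, b ≥ 0 and a + b + 4 = n. Then the eigenvalues of the normalized Laplacian ℒ(G₁), with multiplicity, are: 0 with multiplicity 1, (2n − 3 + √(4n − 7))/(2n − 4) with multiplicity 1, (2n − 3 − √(4n − 7))/(2n − 4) with multiplicity 1, and (n − 1)/(n − 2) with multiplicity n − 3. -/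
open Matrix

lemma finrank_ker_mulVecLin_mul_mul {V : Type*} [Fintype V] [DecidableEq V]
    (P M Q : Matrix V V ℝ) (hP : IsUnit P.det) (hQ : IsUnit Q.det) :
    Module.finrank ℝ (LinearMap.ker (P * M * Q).mulVecLin) =
      Module.finrank ℝ (LinearMap.ker M.mulVecLin) := by
  have h₁ := LinearMap.finrank_range_add_finrank_ker (P * M * Q).mulVecLin
  have h₂ := LinearMap.finrank_range_add_finrank_ker M.mulVecLin
  have h₃ : (P * M * Q).rank = M.rank := by
    rw [Matrix.rank_mul_eq_left_of_isUnit_det _ _ hQ, Matrix.rank_mul_eq_right_of_isUnit_det _ _ hP]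
  simp only [Matrix.rank] at h₃
  omega

/-- The multiplicity of `μ` for the normalized Laplacian is the nullity of `(1 - μ) D - A`. -/
lemma eigMult_normLap_eq {V : Type*} [Fintype V] [DecidableEq V] (G : SimpleGraph V)
    [DecidableRel G.Adj] (hG : ∀ v, 0 < G.degree v) (μ : ℝ) :
    eigMult (normLap G) μ = Module.finrank ℝ (LinearMap.ker
      ((1 - μ) • Matrix.diagonal (fun v => (G.degree v : ℝ)) - G.adjMatrix ℝ).mulVecLin) := by
  have hpos : ∀ v, (0 : ℝ) < G.degree v := fun v => by exact_mod_cast hG v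
  have hunit : IsUnit (Matrix.diagonal fun v => Real.sqrt (G.degree v)).det := by
    rw [Matrix.det_diagonal, isUnit_iff_ne_zero, Finset.prod_ne_zero_iff]
    exact fun v _ => (Real.sqrt_pos.2 (hpos v)).ne'
  rw [eigMult, ← finrank_ker_mulVecLin_mul_mul _ _ _ hunit hunit]
  refine congrArg (fun M : Matrix V V ℝ => Module.finrank ℝ (LinearMap.ker M.mulVecLin)) ?_
  ext u v
  have hu := Real.mul_self_sqrt (hpos u).le
  have hu' := (Real.sqrt_pos.2 (hpos u)).ne'
  have hv' := (Real.sqrt_pos.2 (hpos v)).ne'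
  rw [Matrix.mul_diagonal, Matrix.diagonal_mul]
  by_cases h : u = v
  · subst h
    simp [normLap]
    linear_combination (1 - μ) * hu
  · by_cases hA : G.Adj u v
    · simp [normLap, h, hA]
      field_simp
    · simp [normLap, h, hA]

lemma graphG1_degree (a b : ℕ) :
    (graphG1 a b).degree (Sum.inl ()) = a + 1 ∧
    (∀ i, (graphG1 a b).degree (Sum.inr (Sum.inl i)) = a + b + 2) ∧
    (∀ j, (graphG1 a b).degree (Sum.inr (Sum.inr (Sum.inl j))) = a + b + 2) ∧
    (graphG1 a b).degree (Sum.inr (Sum.inr (Sum.inr ()))) = b + 1 := by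
  have h : ∀ (k : ℕ) (i : Fin (k + 1)),
      (∑ x : Fin (k + 1), if i ≠ x then 1 else 0) = k := fun k i => by
    rw [← Finset.card_filter, Finset.filter_ne]
    simp
  have key (v) := (graphG1 a b).degree_eq_sum_if_adj (R := ℕ) v
  simp only [Nat.cast_id] at key
  refine ⟨?_, fun i => ?_, fun j => ?_, ?_⟩
  · rw [key]
    simp [graphG1]
  · have := h a i
    rw [key]
    simp [graphG1] at this ⊢
    omega
  · have := h b j
    rw [key]
    simp [graphG1] at this ⊢
    omega
  · rw [key]
    simp [graphG1]

lemma graphG1_mem_ker_iff (a b : ℕ) (t : ℝ)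
    (f : Unit ⊕ (Fin (a + 1) ⊕ (Fin (b + 1) ⊕ Unit)) → ℝ) :
    f ∈ LinearMap.ker (t • Matrix.diagonal (fun v => ((graphG1 a b).degree v : ℝ))
      - (graphG1 a b).adjMatrix ℝ).mulVecLin ↔
    t * (a + 1) * f (.inl ()) = ∑ i, f (.inr (.inl i)) ∧
    (∀ i, (t * (a + b + 2) + 1) * f (.inr (.inl i)) = f (.inl ()) +
      (∑ i, f (.inr (.inl i)) + ∑ j, f (.inr (.inr (.inl j))))) ∧
    (∀ j, (t * (a + b + 2) + 1) * f (.inr (.inr (.inl j))) = f (.inr (.inr (.inr ()))) +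
      (∑ i, f (.inr (.inl i)) + ∑ j, f (.inr (.inr (.inl j))))) ∧
    t * (b + 1) * f (.inr (.inr (.inr ()))) = ∑ j, f (.inr (.inr (.inl j))) := by
  obtain ⟨hu, hA, hB, hw⟩ := graphG1_degree a b
  have hne : ∀ (k : ℕ) (i : Fin (k + 1)) (g : Fin (k + 1) → ℝ),
      (∑ x, if i ≠ x then g x else 0) = ∑ x, g x - g i := fun k i g => by
    rw [← Finset.sum_filter, Finset.filter_ne, ← Finset.sum_erase_add _ g (Finset.mem_univ i)]
    ring
  have key (v) : ((t • Matrix.diagonal (fun v => ((graphG1 a b).degree v : ℝ))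
      - (graphG1 a b).adjMatrix ℝ) *ᵥ f) v =
      t * (graphG1 a b).degree v * f v - ∑ w, if (graphG1 a b).Adj v w then f w else 0 := by
    rw [Matrix.sub_mulVec, Matrix.smul_mulVec, Pi.sub_apply, Pi.smul_apply, Matrix.mulVec_diagonal,
      smul_eq_mul, mul_assoc]
    simp [Matrix.mulVec, dotProduct]
  rw [LinearMap.mem_ker, Matrix.mulVecLin_apply, funext_iff]
  simp only [key, Sum.forall, Pi.zero_apply, Unique.forall_iff, PUnit.default_eq_unit, Fintype.sum_sum_type, sub_eq_zero]
  refine and_congr ?_ (and_congr (forall_congr' fun i => ?_)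
    (and_congr (forall_congr' fun j => ?_) ?_))
  · rw [hu]
    simp [graphG1]
  · have := hne a i (fun i => f (.inr (.inl i)))
    rw [hA]
    simp [graphG1] at this ⊢
    rw [this]
    constructor <;> intro h <;> linear_combination h
  · have := hne b j (fun i => f (.inr (.inr (.inl i))))
    rw [hB]
    simp [graphG1] at this ⊢
    rw [this]
    constructor <;> intro h <;> linear_combination h
  · rw [hw]
    simp [graphG1, eq_comm]

/-- Away from `t = -1 / (a + b + 2)`, a null vector is determined by its two values off the
clique. -/
lemma graphG1_mem_ker_iff_of_ne (a b : ℕ) (t : ℝ) (ht : t * (a + b + 2) + 1 ≠ 0)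
    (f : Unit ⊕ (Fin (a + 1) ⊕ (Fin (b + 1) ⊕ Unit)) → ℝ) :
    f ∈ LinearMap.ker (t • Matrix.diagonal (fun v => ((graphG1 a b).degree v : ℝ))
      - (graphG1 a b).adjMatrix ℝ).mulVecLin ↔
    (∀ i, f (.inr (.inl i)) = t * f (.inl ())) ∧
    (∀ j, f (.inr (.inr (.inl j))) = t * f (.inr (.inr (.inr ())))) ∧
    (t * (a + b + 2) + 1) * t * f (.inl ()) = f (.inl ()) +
      t * ((a + 1) * f (.inl ()) + (b + 1) * f (.inr (.inr (.inr ())))) ∧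
    (t * (a + b + 2) + 1) * t * f (.inr (.inr (.inr ()))) = f (.inr (.inr (.inr ()))) +
      t * ((a + 1) * f (.inl ()) + (b + 1) * f (.inr (.inr (.inr ())))) := by
  rw [graphG1_mem_ker_iff]
  have ha : (a : ℝ) + 1 ≠ 0 := by positivity
  have hb : (b : ℝ) + 1 ≠ 0 := by positivity
  constructor
  · rintro ⟨hu, hA, hB, hw⟩
    have hsA := Finset.sum_congr rfl fun i (_ : i ∈ Finset.univ) => hA i
    have hsB := Finset.sum_congr rfl fun j (_ : j ∈ Finset.univ) => hB j
    rw [← Finset.mul_sum, Finset.sum_const, ← hu, ← hw] at hsA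
    rw [← Finset.mul_sum, Finset.sum_const, ← hu, ← hw] at hsB
    simp only [Finset.card_univ, Fintype.card_fin, nsmul_eq_mul] at hsA hsB
    push_cast at hsA hsB
    rw [← hu, ← hw] at hA hB
    have hx : (t * (a + b + 2) + 1) * t * f (.inl ()) = f (.inl ()) +
        t * ((a + 1) * f (.inl ()) + (b + 1) * f (.inr (.inr (.inr ())))) :=
      mul_left_cancel₀ ha (by linear_combination hsA)
    have hy : (t * (a + b + 2) + 1) * t * f (.inr (.inr (.inr ()))) = f (.inr (.inr (.inr ()))) +
        t * ((a + 1) * f (.inl ()) + (b + 1) * f (.inr (.inr (.inr ())))) :=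
      mul_left_cancel₀ hb (by linear_combination hsB)
    refine ⟨fun i => mul_left_cancel₀ ht ?_, fun j => mul_left_cancel₀ ht ?_, ?_, ?_⟩
    · linear_combination hA i - hx
    · linear_combination hB j - hy
    · linear_combination hx
    · linear_combination hy
  · rintro ⟨hA, hB, hx, hy⟩
    simp only [hA, hB, Finset.sum_const, Finset.card_univ, Fintype.card_fin, nsmul_eq_mul]
    push_cast
    refine ⟨by ring, fun _ => ?_, fun _ => ?_, by ring⟩
    · linear_combination hx
    · linear_combination hy

lemma graphG1_ext {a b : ℕ} {f g : Unit ⊕ (Fin (a + 1) ⊕ (Fin (b + 1) ⊕ Unit)) → ℝ}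
    (hu : f (.inl ()) = g (.inl ())) (hA : ∀ i, f (.inr (.inl i)) = g (.inr (.inl i)))
    (hB : ∀ j, f (.inr (.inr (.inl j))) = g (.inr (.inr (.inl j))))
    (hw : f (.inr (.inr (.inr ()))) = g (.inr (.inr (.inr ())))) : f = g := by
  funext v
  rcases v with _ | i | j | _
  exacts [hu, hA i, hB j, hw]

lemma eigMult_graphG1 (a b : ℕ) (μ : ℝ) :
    eigMult (normLap (graphG1 a b)) μ = Module.finrank ℝ (LinearMap.ker
      ((1 - μ) • Matrix.diagonal (fun v => ((graphG1 a b).degree v : ℝ))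
        - (graphG1 a b).adjMatrix ℝ).mulVecLin) := by
  refine eigMult_normLap_eq _ (fun v => ?_) μ
  obtain ⟨hu, hA, hB, hw⟩ := graphG1_degree a b
  rcases v with _ | i | j | _
  · simp [hu]
  · simp [hA]
  · simp [hB]
  · simp [hw]

lemma eigMult_graphG1_zero (a b : ℕ) : eigMult (normLap (graphG1 a b)) 0 = 1 := by
  rw [eigMult_graphG1, sub_zero]
  have hm : (a : ℝ) + b + 2 ≠ 0 := by positivity
  have ht : (1 : ℝ) * (a + b + 2) + 1 ≠ 0 := by positivity
  rw [finrank_eq_one_iff']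
  refine ⟨⟨fun _ => 1, ?_⟩, ?_, ?_⟩
  · rw [graphG1_mem_ker_iff_of_ne a b 1 ht]
    refine ⟨fun _ => by ring, fun _ => by ring, by ring, by ring⟩
  · intro h
    simpa using congrFun (congrArg Subtype.val h) (.inl ())
  · rintro ⟨f, hf⟩
    rw [graphG1_mem_ker_iff_of_ne a b 1 ht] at hf
    obtain ⟨hA, hB, hx, hy⟩ := hf
    have hxy : f (.inr (.inr (.inr ()))) = f (.inl ()) :=
      mul_left_cancel₀ hm (by linear_combination hy - hx)
    refine ⟨f (.inl ()), Subtype.ext (graphG1_ext ?_ ?_ ?_ ?_)⟩ <;> simp [hA, hB, hxy]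

/-- Each root of `m t² + t = 1`, where `m = a + b + 2`, gives a simple eigenvalue `1 - t`. -/
lemma eigMult_graphG1_of_root (a b : ℕ) (μ : ℝ)
    (h : (a + b + 2) * (1 - μ) ^ 2 + (1 - μ) - 1 = 0) :
    eigMult (normLap (graphG1 a b)) μ = 1 := by
  rw [eigMult_graphG1]
  generalize 1 - μ = t at h ⊢
  have ht0 : t ≠ 0 := by rintro rfl; norm_num at h
  have ht : t * (a + b + 2) + 1 ≠ 0 := fun h0 => by
    have : (1 : ℝ) = 0 := by linear_combination t * h0 - h
    norm_num at this
  have ha : (a : ℝ) + 1 ≠ 0 := by positivity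
  have hb : (b : ℝ) + 1 ≠ 0 := by positivity
  rw [finrank_eq_one_iff']
  refine ⟨⟨Sum.elim (fun _ => b + 1) (Sum.elim (fun _ => t * (b + 1))
    (Sum.elim (fun _ => -(t * (a + 1))) (fun _ => -(a + 1)))), ?_⟩, ?_, ?_⟩
  · rw [graphG1_mem_ker_iff_of_ne a b t ht]
    refine ⟨fun _ => by simp, fun _ => by simp; ring, ?_, ?_⟩
    · simp only [Sum.elim_inl, Sum.elim_inr]
      linear_combination ((b : ℝ) + 1) * h
    · simp only [Sum.elim_inl, Sum.elim_inr]
      linear_combination -((a : ℝ) + 1) * h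
  · intro h0
    exact hb (congrFun (congrArg Subtype.val h0) (.inl ()))
  · rintro ⟨f, hf⟩
    rw [graphG1_mem_ker_iff_of_ne a b t ht] at hf
    obtain ⟨hA, hB, hx, hy⟩ := hf
    have hxy : (a + 1) * f (.inl ()) + (b + 1) * f (.inr (.inr (.inr ()))) = 0 :=
      mul_left_cancel₀ ht0 (by linear_combination f (.inl ()) * h - hx)
    have hw : f (.inr (.inr (.inr ()))) = -(f (.inl ()) / (b + 1) * (a + 1)) := by
      field_simp
      linear_combination hxy
    refine ⟨f (.inl ()) / (b + 1), Subtype.ext (graphG1_ext ?_ (fun i => ?_) (fun j => ?_) ?_)⟩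
    · simp [hb]
    · simp [hA]
      field_simp
    · simp [hB, hw]
      ring
    · simp [hw]
      ring

lemma eigMult_graphG1_eq_zero (a b : ℕ) (μ : ℝ) (h0 : μ ≠ 0)
    (ht : (1 - μ) * (a + b + 2) + 1 ≠ 0)
    (h : (a + b + 2) * (1 - μ) ^ 2 + (1 - μ) - 1 ≠ 0) :
    eigMult (normLap (graphG1 a b)) μ = 0 := by
  rw [eigMult_graphG1]
  suffices hbot : LinearMap.ker ((1 - μ) • Matrix.diagonal
      (fun v => ((graphG1 a b).degree v : ℝ)) - (graphG1 a b).adjMatrix ℝ).mulVecLin = ⊥ by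
    rw [hbot, finrank_bot]
  refine (Submodule.eq_bot_iff _).2 fun f hf => ?_
  rw [graphG1_mem_ker_iff_of_ne a b _ ht] at hf
  obtain ⟨hA, hB, hx, hy⟩ := hf
  have hxy : f (.inr (.inr (.inr ()))) = f (.inl ()) :=
    mul_left_cancel₀ h (by linear_combination hy - hx)
  have hu : f (.inl ()) = 0 := by
    refine (mul_eq_zero.1 ?_).resolve_left (mul_ne_zero h0 ht)
    rw [hxy] at hx
    linear_combination -hx
  exact graphG1_ext hu (by simp [hA, hu]) (by simp [hB, hxy, hu]) (by simp [hxy, hu])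

lemma eigMult_graphG1_clique (a b : ℕ) (μ : ℝ) (h : (1 - μ) * (a + b + 2) + 1 = 0) :
    eigMult (normLap (graphG1 a b)) μ = a + b + 1 := by
  rw [eigMult_graphG1]
  generalize 1 - μ = t at h ⊢
  let SA : (Unit ⊕ (Fin (a + 1) ⊕ (Fin (b + 1) ⊕ Unit)) → ℝ) →ₗ[ℝ] ℝ :=
    ∑ i, LinearMap.proj (.inr (.inl i))
  let SB : (Unit ⊕ (Fin (a + 1) ⊕ (Fin (b + 1) ⊕ Unit)) → ℝ) →ₗ[ℝ] ℝ :=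
    ∑ j, LinearMap.proj (.inr (.inr (.inl j)))
  have hSA (f) : SA f = ∑ i, f (.inr (.inl i)) := by simp [SA]
  have hSB (f) : SB f = ∑ j, f (.inr (.inr (.inl j))) := by simp [SB]
  let L : (Unit ⊕ (Fin (a + 1) ⊕ (Fin (b + 1) ⊕ Unit)) → ℝ) →ₗ[ℝ] ℝ × ℝ × ℝ :=
    (LinearMap.proj (Sum.inl ()) + (SA + SB)).prod
      ((LinearMap.proj (Sum.inr (Sum.inr (Sum.inr ()))) + (SA + SB)).prod
        (SA + (t * (a + 1)) • (SA + SB)))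
  have hker : LinearMap.ker (t • Matrix.diagonal (fun v => ((graphG1 a b).degree v : ℝ))
      - (graphG1 a b).adjMatrix ℝ).mulVecLin = LinearMap.ker L := by
    ext f
    rw [graphG1_mem_ker_iff, LinearMap.mem_ker]
    simp only [L, LinearMap.prod_apply, Function.prod_apply, LinearMap.add_apply,
      LinearMap.smul_apply, Prod.mk_eq_zero, hSA, hSB, LinearMap.proj_apply, h, zero_mul,
      smul_eq_mul, forall_const]
    constructor
    · rintro ⟨hu, hA, hB, hw⟩
      exact ⟨hA.symm, hB.symm, by linear_combination t * (a + 1) * (-hA) - hu⟩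
    · rintro ⟨hA, hB, hS⟩
      refine ⟨?_, hA.symm, hB.symm, ?_⟩
      · linear_combination t * (a + 1) * hA - hS
      · linear_combination t * (b + 1) * hB + hS -
          (∑ i, f (.inr (.inl i)) + ∑ j, f (.inr (.inr (.inl j)))) * h
  have hsurj : LinearMap.range L = ⊤ := by
    refine LinearMap.range_eq_top.2 ?_
    rintro ⟨x, y, z⟩
    refine ⟨Sum.elim (fun _ => x) (Sum.elim (fun i => if i = 0 then z else 0)
      (Sum.elim (fun j => if j = 0 then -z else 0) (fun _ => y))), ?_⟩
    simp [L, hSA, hSB]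
  have hrank := L.finrank_range_add_finrank_ker
  rw [hsurj, finrank_top] at hrank
  simp at hrank
  rw [hker]
  omega

theorem statement4 (n a b : ℕ) (hn : 5 ≤ n) (hab : a + b + 4 = n) :
    eigMult (normLap (graphG1 a b)) 0 = 1 ∧
    eigMult (normLap (graphG1 a b))
      ((2 * (n : ℝ) - 3 + Real.sqrt (4 * (n : ℝ) - 7)) / (2 * (n : ℝ) - 4)) = 1 ∧
    eigMult (normLap (graphG1 a b))
      ((2 * (n : ℝ) - 3 - Real.sqrt (4 * (n : ℝ) - 7)) / (2 * (n : ℝ) - 4)) = 1 ∧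
    eigMult (normLap (graphG1 a b)) (((n : ℝ) - 1) / ((n : ℝ) - 2)) = n - 3 ∧
    ∀ μ : ℝ, μ ∉ ({0,
        (2 * (n : ℝ) - 3 + Real.sqrt (4 * (n : ℝ) - 7)) / (2 * (n : ℝ) - 4),
        (2 * (n : ℝ) - 3 - Real.sqrt (4 * (n : ℝ) - 7)) / (2 * (n : ℝ) - 4),
        ((n : ℝ) - 1) / ((n : ℝ) - 2)} : Set ℝ) →
      eigMult (normLap (graphG1 a b)) μ = 0 := by
  have hm : (0 : ℝ) < a + b + 2 := by positivity
  obtain rfl : n = a + b + 4 := hab.symm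
  have hden : 2 * ((a + b + 4 : ℕ) : ℝ) - 4 = 2 * (a + b + 2) := by push_cast; ring
  have hden' : ((a + b + 4 : ℕ) : ℝ) - 2 = a + b + 2 := by push_cast; ring
  have hsq : Real.sqrt (4 * ((a + b + 4 : ℕ) : ℝ) - 7) ^ 2 = 4 * (a + b + 2) + 1 := by
    rw [Real.sq_sqrt] <;> push_cast <;> linarith
  have hnum : 2 * ((a + b + 4 : ℕ) : ℝ) - 3 = 2 * (a + b + 2) + 1 := by push_cast; ring
  have hnum' : ((a + b + 4 : ℕ) : ℝ) - 1 = a + b + 2 + 1 := by push_cast; ring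
  rw [hden, hden', hnum, hnum']
  generalize Real.sqrt (4 * ((a + b + 4 : ℕ) : ℝ) - 7) = s at hsq ⊢
  refine ⟨eigMult_graphG1_zero a b, eigMult_graphG1_of_root a b _ ?_,
    eigMult_graphG1_of_root a b _ ?_, ?_, fun μ hμ => ?_⟩
  · field_simp
    linear_combination hsq
  · field_simp
    linear_combination hsq
  · rw [eigMult_graphG1_clique a b _ (by field_simp; ring)]
    omega
  · simp only [Set.mem_insert_iff, Set.mem_singleton_iff, not_or] at hμ
    obtain ⟨h0, hp, hq, hc⟩ := hμ
    rw [eq_div_iff (by positivity)] at hp hq hc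
    refine eigMult_graphG1_eq_zero a b μ h0 (fun h => hc ?_) (fun h => ?_)
    · linear_combination -h
    · refine mul_ne_zero (sub_ne_zero.2 hp) (sub_ne_zero.2 hq) ?_
      linear_combination 4 * (a + b + 2) * h - hsq
end

section
/- Let n ≥ 5 and let G₂ be the graph on n vertices obtained from the complete graph K_{n−1} by attaching a pendant vertex to one of its vertices. Then the eigenvalues of the normalized Laplacian ℒ(G₂), with multiplicity, are: 0 with multiplicity 1, (2n² − 5n + 3 + √(4n³ − 23n² + 42n − 23))/(2(n² − 3n + 2)) with multiplicity 1, (2n² − 5n + 3 − √(4n³ − 23n² + 42n − 23))/(2(n² − 3n + 2)) with multiplicity 1, and (n − 1)/(n − 2) with multiplicity n − 3. -/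
open Matrix

lemma graphG2_adj_inl_inr (m : ℕ) (a : Unit) (j : Fin (m + 1)) :
    (graphG2 m).Adj (Sum.inl a) (Sum.inr j) ↔ j = 0 := by
  simp [graphG2]

lemma graphG2_adj_inr_inl (m : ℕ) (a : Unit) (j : Fin (m + 1)) :
    (graphG2 m).Adj (Sum.inr j) (Sum.inl a) ↔ j = 0 := by
  simp [graphG2]

lemma graphG2_adj_inr_inr (m : ℕ) (i j : Fin (m + 1)) :
    (graphG2 m).Adj (Sum.inr i) (Sum.inr j) ↔ i ≠ j := by
  simp [graphG2]

lemma graphG2_degree_eq_sum (m : ℕ) (v : Unit ⊕ Fin (m + 1)) :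
    (graphG2 m).degree v = (if (graphG2 m).Adj v (Sum.inl ()) then 1 else 0) +
      ((if (graphG2 m).Adj v (Sum.inr 0) then 1 else 0) +
        ∑ i : Fin m, if (graphG2 m).Adj v (Sum.inr i.succ) then 1 else 0) := by
  rw [← SimpleGraph.card_neighborFinset_eq_degree, SimpleGraph.neighborFinset_eq_filter,
    Finset.card_filter, Fintype.sum_sum_type, Fin.sum_univ_succ, Fintype.sum_unique]

lemma graphG2_degree_pendant (m : ℕ) (a : Unit) : (graphG2 m).degree (Sum.inl a) = 1 := by
  simp [graphG2_degree_eq_sum, graphG2_adj_inl_inr, -Finset.sum_boole]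

lemma graphG2_degree_zero (m : ℕ) : (graphG2 m).degree (Sum.inr 0) = m + 1 := by
  simp [graphG2_degree_eq_sum, graphG2_adj_inr_inl, graphG2_adj_inr_inr, -Finset.sum_boole,
    (Fin.succ_ne_zero _).symm, add_comm]

lemma graphG2_degree_succ (m : ℕ) (i : Fin m) : (graphG2 m).degree (Sum.inr i.succ) = m := by
  have h : ∑ j : Fin m, (if i = j then 0 else 1) = m - 1 := by
    simp [Finset.sum_ite, Finset.filter_ne]
  have := i.pos
  simp only [graphG2_degree_eq_sum, graphG2_adj_inr_inl, graphG2_adj_inr_inr, Fin.succ_ne_zero,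
    Fin.succ_inj, ne_eq, ite_not, h, if_false]
  omega

/-- Eigenvectors of `normLap (graphG2 m)`, described by the eigenvalue equation at each vertex. -/
lemma mem_ker_normLap_graphG2 (m : ℕ) (hm : 0 < m) (μ : ℝ) (x : Unit ⊕ Fin (m + 1) → ℝ) :
    x ∈ LinearMap.ker (normLap (graphG2 m) - μ • (1 : Matrix _ _ ℝ)).mulVecLin ↔
      (1 - μ) * x (Sum.inl ()) = x (Sum.inr 0) / √(m + 1) ∧
      (1 - μ) * x (Sum.inr 0) = x (Sum.inl ()) / √(m + 1) +
        (∑ i : Fin m, x (Sum.inr i.succ)) / (√(m + 1) * √m) ∧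
      ∀ i : Fin m, (1 - μ) * x (Sum.inr i.succ) = x (Sum.inr 0) / (√(m + 1) * √m) +
        ((∑ j : Fin m, x (Sum.inr j.succ)) - x (Sum.inr i.succ)) / m := by
  have hm' : (0 : ℝ) < m := by exact_mod_cast hm
  have hs : √((m : ℝ) + 1) ≠ 0 := by positivity
  have hr : √(m : ℝ) ≠ 0 := by positivity
  have hcast : √(((m : ℝ) + 1) * m) = √(m + 1) * √m := Real.sqrt_mul (by positivity) _
  have hcast' : √((m : ℝ) * (m + 1)) = √(m + 1) * √m := by rw [mul_comm, hcast]
  have hsum (i : Fin m) :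
      ∑ j : Fin m, (if i = j then (1 : ℝ) else -1 / m) * x (Sum.inr j.succ) =
        x (Sum.inr i.succ) - ((∑ j : Fin m, x (Sum.inr j.succ)) - x (Sum.inr i.succ)) / m := by
    have h (j : Fin m) : (if i = j then (1 : ℝ) else -1 / m) * x (Sum.inr j.succ) =
        (if i = j then (1 + 1 / m) * x (Sum.inr j.succ) else 0) - x (Sum.inr j.succ) / m := by
      split_ifs <;> ring
    simp only [h, Finset.sum_sub_distrib, Finset.sum_ite_eq, Finset.mem_univ, if_true,
      ← Finset.sum_div]
    ring
  rw [LinearMap.mem_ker, Matrix.mulVecLin_apply, Matrix.sub_mulVec, Matrix.smul_mulVec,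
    Matrix.one_mulVec, sub_eq_zero, funext_iff, Sum.forall, Fin.forall_fin_succ]
  simp only [Matrix.mulVec, dotProduct, normLap, Matrix.of_apply, Fintype.sum_sum_type,
    Fin.sum_univ_succ, graphG2_adj_inl_inr, graphG2_adj_inr_inl, graphG2_adj_inr_inr,
    graphG2_degree_pendant, graphG2_degree_zero, graphG2_degree_succ,
    Sum.inr.injEq, Fin.succ_inj, Fin.succ_ne_zero, (Fin.succ_ne_zero _).symm, ne_eq, reduceCtorEq,
    if_true, if_false, Pi.smul_apply, smul_eq_mul,
    Finset.univ_unique, Finset.sum_singleton, Nat.cast_add, Nat.cast_one, one_mul, mul_one,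
    zero_mul, Finset.sum_const_zero, add_zero, zero_add, ite_not, hcast, hcast',
    ← Finset.mul_sum]
  have hsum' (i : Fin m) : ∑ j : Fin m, (if i = j then (1 : ℝ)
      else if i = j then 0 else -1 / √(m * m)) * x (Sum.inr j.succ) =
        x (Sum.inr i.succ) - ((∑ j : Fin m, x (Sum.inr j.succ)) - x (Sum.inr i.succ)) / m := by
    rw [← hsum]
    refine Finset.sum_congr rfl fun j _ => ?_
    rw [Real.sqrt_mul_self hm'.le]
    split_ifs <;> rfl
  simp only [hsum', Unique.forall_iff]
  refine and_congr ?_ (and_congr ?_ (forall_congr' fun i => ?_))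
  all_goals
    constructor <;> intro h <;> linear_combination h

/-- An eigenvector of `normLap (graphG2 m)` for an eigenvalue `μ ≠ 1 + 1 / m` is a multiple of a
vector which is constant on the vertices of degree `m`. -/
lemma eq_of_mem_ker_normLap_graphG2 {m : ℕ} (hm : 0 < m) {μ : ℝ} (hμ : m * (1 - μ) + 1 ≠ 0)
    {x : Unit ⊕ Fin (m + 1) → ℝ}
    (hx : x ∈ LinearMap.ker (normLap (graphG2 m) - μ • (1 : Matrix _ _ ℝ)).mulVecLin) :
    x (Sum.inr 0) = (1 - μ) * √(m + 1) * x (Sum.inl ()) ∧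
      (∀ i : Fin m, x (Sum.inr i.succ) =
        √m * ((m + 1) * (1 - μ) ^ 2 - 1) / m * x (Sum.inl ())) ∧
      μ * (m * (m + 1) * (1 - μ) ^ 2 + (m + 1) * (1 - μ) + 1 - m) * x (Sum.inl ()) = 0 := by
  obtain ⟨hp, hz, hi⟩ := (mem_ker_normLap_graphG2 m hm μ x).1 hx
  have hm' : (0 : ℝ) < m := by exact_mod_cast hm
  set S := ∑ i : Fin m, x (Sum.inr i.succ) with hS
  have hs : √((m : ℝ) + 1) ≠ 0 := by positivity
  have hr : √(m : ℝ) ≠ 0 := by positivity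
  have hs2 : √((m : ℝ) + 1) ^ 2 = m + 1 := Real.sq_sqrt (by positivity)
  have hr2 : √(m : ℝ) ^ 2 = m := Real.sq_sqrt (by positivity)
  have hx0 : x (Sum.inr 0) = (1 - μ) * √(m + 1) * x (Sum.inl ()) := by
    field_simp at hp
    linear_combination -hp
  have hSp : S = √m * ((m + 1) * (1 - μ) ^ 2 - 1) * x (Sum.inl ()) := by
    rw [hx0] at hz
    field_simp at hz
    rw [hs2] at hz
    linear_combination -hz
  have hi' (i : Fin m) : (m * (1 - μ) + 1) * x (Sum.inr i.succ) =
      √m * (1 - μ) * x (Sum.inl ()) + S := by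
    have h := hi i
    rw [hx0] at h
    have h2 : (1 - μ) * √(m + 1) * x (Sum.inl ()) / (√(m + 1) * √m) =
        √m * (1 - μ) * x (Sum.inl ()) / m := by
      field_simp
      rw [hr2]
      ring
    rw [h2] at h
    field_simp at h
    linear_combination h
  have hsum : (m * (1 - μ) + 1) * S = m * (√m * (1 - μ) * x (Sum.inl ()) + S) := by
    rw [hS, Finset.mul_sum, Finset.sum_congr rfl fun i _ => hi' i]
    simp [hS, mul_add]
  refine ⟨hx0, fun i => ?_, mul_left_cancel₀ hr ?_⟩
  · have h : (m * (1 - μ) + 1) * (m * x (Sum.inr i.succ)) = (m * (1 - μ) + 1) * S := by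
      rw [hsum, ← hi' i]; ring
    have h := mul_left_cancel₀ hμ h
    field_simp
    rw [mul_comm, h, hSp]
  · rw [hSp] at hsum
    linear_combination -hsum

lemma eigMult_normLap_graphG2_eq_zero {m : ℕ} (hm : 0 < m) {μ : ℝ} (hμ : m * (1 - μ) + 1 ≠ 0)
    (hc : μ * (m * (m + 1) * (1 - μ) ^ 2 + (m + 1) * (1 - μ) + 1 - m) ≠ 0) :
    eigMult (normLap (graphG2 m)) μ = 0 := by
  rw [eigMult, Submodule.finrank_eq_zero, Submodule.eq_bot_iff]
  intro x hx
  obtain ⟨hz, hi, hp⟩ := eq_of_mem_ker_normLap_graphG2 hm hμ hx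
  have hp := (mul_eq_zero.1 hp).resolve_left hc
  ext v
  rcases v with v | v
  · exact hp
  · cases v using Fin.cases with
    | zero => simp [hz, hp]
    | succ i => simp [hi, hp]

lemma eigMult_normLap_graphG2_eq_one {m : ℕ} (hm : 0 < m) {μ : ℝ} (hμ : m * (1 - μ) + 1 ≠ 0)
    (hc : μ * (m * (m + 1) * (1 - μ) ^ 2 + (m + 1) * (1 - μ) + 1 - m) = 0) :
    eigMult (normLap (graphG2 m)) μ = 1 := by
  have hm' : (0 : ℝ) < m := by exact_mod_cast hm
  have hs : √((m : ℝ) + 1) ≠ 0 := by positivity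
  have hr : √(m : ℝ) ≠ 0 := by positivity
  have hs2 : √((m : ℝ) + 1) ^ 2 = m + 1 := Real.sq_sqrt (by positivity)
  have hr2 : √(m : ℝ) ^ 2 = m := Real.sq_sqrt (by positivity)
  let v : Unit ⊕ Fin (m + 1) → ℝ := Sum.elim (fun _ => 1)
    (Fin.cons ((1 - μ) * √(m + 1)) fun _ => √m * ((m + 1) * (1 - μ) ^ 2 - 1) / m)
  have hv : v ∈ LinearMap.ker (normLap (graphG2 m) - μ • (1 : Matrix _ _ ℝ)).mulVecLin := by
    rw [mem_ker_normLap_graphG2 m hm]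
    simp only [v, Sum.elim_inl, Sum.elim_inr, Fin.cons_zero, Fin.cons_succ, Finset.sum_const,
      Finset.card_univ, Fintype.card_fin, nsmul_eq_mul]
    refine ⟨?_, ?_, fun _ => ?_⟩
    · field_simp
    · field_simp
      rw [hs2]
      ring
    · field_simp
      rw [hr2]
      linear_combination -(m : ℝ) * hc
  rw [eigMult, finrank_eq_one_iff_of_nonzero' ⟨v, hv⟩ fun h => by
    simpa [v] using congrFun (congrArg Subtype.val h) (Sum.inl ())]
  rintro ⟨x, hx⟩
  obtain ⟨hz, hi, -⟩ := eq_of_mem_ker_normLap_graphG2 hm hμ hx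
  refine ⟨x (Sum.inl ()), Subtype.ext (funext fun w => ?_)⟩
  rcases w with w | w
  · simp [v]
  · cases w using Fin.cases with
    | zero => simp [v, hz, mul_comm]
    | succ i => simp [v, hi, mul_comm]

/-- The eigenvectors of `normLap (graphG2 m)` for the eigenvalue `1 + 1 / m`. -/
lemma mem_ker_normLap_graphG2_of_eq {m : ℕ} (hm : 2 ≤ m) {μ : ℝ} (hμ : m * (1 - μ) + 1 = 0)
    (x : Unit ⊕ Fin (m + 1) → ℝ) :
    x ∈ LinearMap.ker (normLap (graphG2 m) - μ • (1 : Matrix _ _ ℝ)).mulVecLin ↔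
      x (Sum.inl ()) = 0 ∧ x (Sum.inr 0) = 0 ∧ ∑ i : Fin m, x (Sum.inr i.succ) = 0 := by
  have hm2 : (2 : ℝ) ≤ m := by exact_mod_cast hm
  have hm' : (0 : ℝ) < m := by linarith
  have hl : 1 - μ = -1 / m := by
    field_simp
    linarith
  have hs : √((m : ℝ) + 1) ≠ 0 := by positivity
  have hr : √(m : ℝ) ≠ 0 := by positivity
  have hs2 : √((m : ℝ) + 1) ^ 2 = m + 1 := Real.sq_sqrt (by positivity)
  have hr2 : √(m : ℝ) ^ 2 = m := Real.sq_sqrt (by positivity)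
  rw [mem_ker_normLap_graphG2 m (by omega), hl]
  constructor
  · rintro ⟨hp, hz, hi⟩
    have hi := hi ⟨0, by omega⟩
    set S := ∑ i : Fin m, x (Sum.inr i.succ)
    have hp' : √(m + 1) * x (Sum.inl ()) = -m * x (Sum.inr 0) := by
      field_simp at hp
      linarith
    have hi' : S * √(m + 1) = - √m * x (Sum.inr 0) := by
      field_simp at hi
      refine mul_left_cancel₀ hr ?_
      linear_combination -hi + x (Sum.inr 0) * hr2
    have hz' : x (Sum.inr 0) = 0 := by
      field_simp at hz
      have h : √m * ((m : ℝ) ^ 2 - 1) * x (Sum.inr 0) = 0 := by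
        linear_combination √(m + 1) * hz + m * √m * hp' + m * hi' + √m * x (Sum.inr 0) * hs2
      have h1 : (m : ℝ) ^ 2 - 1 ≠ 0 := by nlinarith
      simpa [hr, h1] using h
    rw [hz'] at hp' hi'
    simp only [mul_zero, mul_eq_zero, hs, false_or, or_false] at hp' hi'
    exact ⟨hp', hz', hi'⟩
  · rintro ⟨hp, hz, hS⟩
    simp only [hp, hz, hS]
    refine ⟨by simp, by simp, fun i => by ring⟩

lemma eigMult_normLap_graphG2_of_eq {m : ℕ} (hm : 2 ≤ m) {μ : ℝ} (hμ : m * (1 - μ) + 1 = 0) :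
    eigMult (normLap (graphG2 m)) μ = m - 1 := by
  let σ : Module.Dual ℝ (Fin m → ℝ) := ∑ i, LinearMap.proj i
  have hσ : σ ≠ 0 := fun h => by
    have h1 := LinearMap.congr_fun h (Pi.single ⟨0, by omega⟩ 1)
    simp [σ] at h1
  let φ : (Fin m → ℝ) →ₗ[ℝ] (Unit ⊕ Fin (m + 1) → ℝ) :=
    { toFun := fun f => Sum.elim (fun _ => 0) (Fin.cons 0 f)
      map_add' := fun f g => by
        ext (v | v)
        · simp
        · cases v using Fin.cases <;> simp
      map_smul' := fun c f => by
        ext (v | v)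
        · simp
        · cases v using Fin.cases <;> simp }
  have hφ : Function.Injective φ := fun f g h => by
    ext i
    simpa [φ] using congrFun h (Sum.inr i.succ)
  have hker : LinearMap.ker (normLap (graphG2 m) - μ • (1 : Matrix _ _ ℝ)).mulVecLin =
      (LinearMap.ker σ).map φ := by
    ext x
    rw [mem_ker_normLap_graphG2_of_eq hm hμ, Submodule.mem_map]
    constructor
    · rintro ⟨hp, hz, hS⟩
      refine ⟨fun i => x (Sum.inr i.succ), by simpa [σ] using hS, ?_⟩
      ext (v | v)
      · simp [φ, hp]
      · cases v using Fin.cases <;> simp [φ, hz]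
    · rintro ⟨f, hf, rfl⟩
      simpa [φ, σ] using hf
  have hfin := Module.Dual.finrank_ker_add_one_of_ne_zero hσ
  rw [Module.finrank_fin_fun] at hfin
  rw [eigMult, hker, ← ((LinearMap.ker σ).equivMapOfInjective φ hφ).finrank_eq]
  omega

theorem statement5 (n : ℕ) (hn : 5 ≤ n) :
    eigMult (normLap (graphG2 (n - 2))) 0 = 1 ∧
    eigMult (normLap (graphG2 (n - 2)))
      ((2 * (n : ℝ) ^ 2 - 5 * (n : ℝ) + 3 +
          Real.sqrt (4 * (n : ℝ) ^ 3 - 23 * (n : ℝ) ^ 2 + 42 * (n : ℝ) - 23)) /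
        (2 * ((n : ℝ) ^ 2 - 3 * (n : ℝ) + 2))) = 1 ∧
    eigMult (normLap (graphG2 (n - 2)))
      ((2 * (n : ℝ) ^ 2 - 5 * (n : ℝ) + 3 -
          Real.sqrt (4 * (n : ℝ) ^ 3 - 23 * (n : ℝ) ^ 2 + 42 * (n : ℝ) - 23)) /
        (2 * ((n : ℝ) ^ 2 - 3 * (n : ℝ) + 2))) = 1 ∧
    eigMult (normLap (graphG2 (n - 2))) (((n : ℝ) - 1) / ((n : ℝ) - 2)) = n - 3 ∧
    ∀ μ : ℝ, μ ∉ ({0,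
        (2 * (n : ℝ) ^ 2 - 5 * (n : ℝ) + 3 +
            Real.sqrt (4 * (n : ℝ) ^ 3 - 23 * (n : ℝ) ^ 2 + 42 * (n : ℝ) - 23)) /
          (2 * ((n : ℝ) ^ 2 - 3 * (n : ℝ) + 2)),
        (2 * (n : ℝ) ^ 2 - 5 * (n : ℝ) + 3 -
            Real.sqrt (4 * (n : ℝ) ^ 3 - 23 * (n : ℝ) ^ 2 + 42 * (n : ℝ) - 23)) /
          (2 * ((n : ℝ) ^ 2 - 3 * (n : ℝ) + 2)),
        ((n : ℝ) - 1) / ((n : ℝ) - 2)} : Set ℝ) →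
      eigMult (normLap (graphG2 (n - 2))) μ = 0 := by
  generalize hmn : n - 2 = m
  obtain rfl : n = m + 2 := by omega
  have hm : 3 ≤ m := by omega
  have hm3 : (3 : ℝ) ≤ m := by exact_mod_cast hm
  simp only [Nat.cast_add, Nat.cast_ofNat]
  set w := √(4 * ((m : ℝ) + 2) ^ 3 - 23 * ((m : ℝ) + 2) ^ 2 + 42 * ((m : ℝ) + 2) - 23)
  have hw : w ^ 2 = 4 * (m : ℝ) ^ 3 + m ^ 2 - 2 * m + 1 := by
    rw [Real.sq_sqrt (by nlinarith [pow_pos (show (0 : ℝ) < m by linarith) 3])]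
    ring
  have hden : 2 * (((m : ℝ) + 2) ^ 2 - 3 * (m + 2) + 2) = 2 * (m * (m + 1)) := by ring
  rw [hden]
  set a := (2 * ((m : ℝ) + 2) ^ 2 - 5 * (m + 2) + 3 + w) / (2 * (m * (m + 1))) with ha
  set b := (2 * ((m : ℝ) + 2) ^ 2 - 5 * (m + 2) + 3 - w) / (2 * (m * (m + 1))) with hb
  have hm0 : (m : ℝ) ≠ 0 := by positivity
  have hm1 : (m : ℝ) + 1 ≠ 0 := by positivity
  have hfac (μ : ℝ) : m * (m + 1) * (1 - μ) ^ 2 + (m + 1) * (1 - μ) + 1 - m =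
      m * (m + 1) * ((μ - a) * (μ - b)) := by
    rw [ha, hb]
    field_simp
    linear_combination hw
  have hne {μ : ℝ} (h : m * (m + 1) * (1 - μ) ^ 2 + (m + 1) * (1 - μ) + 1 - m = 0) :
      m * (1 - μ) + 1 ≠ 0 := fun h1 => by
    have : (m : ℝ) * (m - 1) = 0 := by
      linear_combination (m + 1) * (m * (1 - μ)) * h1 - m * h
    nlinarith
  have hza : m * (m + 1) * (1 - a) ^ 2 + (m + 1) * (1 - a) + 1 - m = (0 : ℝ) := by
    rw [hfac]; ring
  have hzb : m * (m + 1) * (1 - b) ^ 2 + (m + 1) * (1 - b) + 1 - m = (0 : ℝ) := by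
    rw [hfac]; ring
  refine ⟨eigMult_normLap_graphG2_eq_one (by omega) (by simpa using hm1) (by simp),
    eigMult_normLap_graphG2_eq_one (by omega) (hne hza) (by rw [hza, mul_zero]),
    eigMult_normLap_graphG2_eq_one (by omega) (hne hzb) (by rw [hzb, mul_zero]), ?_,
    fun μ hμ => ?_⟩
  · rw [eigMult_normLap_graphG2_of_eq (by omega)]
    · omega
    · rw [add_sub_cancel_right]
      field_simp
      ring
  · simp only [Set.mem_insert_iff, Set.mem_singleton_iff, not_or] at hμ
    obtain ⟨h0, h1, h2, h3⟩ := hμ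
    refine eigMult_normLap_graphG2_eq_zero (by omega) (fun h => h3 ?_) ?_
    · rw [add_sub_cancel_right]
      field_simp
      linear_combination -h
    · rw [hfac]
      simp [h0, hm0, hm1, sub_eq_zero, h1, h2]
end
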